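/- arXiv:2411.13493 — 2 statements merged into one kernel-verified Lean document; each statement's English description precedes it below -/
import Mathlib

section
/- With W as below, min( H(W_r|W_{>r}), binom(m,r) − H(W_r|W_{>r}) ) ≤ 140·d(W_r|W_{>r}; W_r|W_{>r}). -/
open MeasureTheory

/-- Index set: binary strings of length `m` (indexing both coordinates and monomials). -/
abbrev Idx (m : ℕ) := Fin m → ZMod 2

/-- Hamming weight of a binary string. -/
def wt {m : ℕ} (x : Idx m) : ℕ := (Finset.univ.filter (fun i => x i = 1)).card

/-- The 2×2 base matrix `[[1,0],[1,1]]` (rows/columns indexed by `F₂`):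
entry `(a,b)` is `0` iff `a = 0` and `b = 1`. -/
def base : ZMod 2 → ZMod 2 → ZMod 2 := fun a b => if a = 0 ∧ b = 1 then 0 else 1

/-- The `m`-fold Kronecker power `G = [[1,0],[1,1]]^{⊗ m}`, as a matrix indexed by
binary strings of length `m`. -/
def Gmat (m : ℕ) : Matrix (Idx m) (Idx m) (ZMod 2) := fun x y => ∏ i, base (x i) (y i)

/-- The Bernoulli(δ) measure on `F₂` (probability `δ` of `1`). -/
noncomputable def bern2 (δ : ℝ) : Measure (ZMod 2) :=
  ENNReal.ofReal δ • Measure.dirac 1 + ENNReal.ofReal (1 - δ) • Measure.dirac 0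

/-- The law of the i.i.d. Bernoulli(δ) noise vector `Z = (Z_x)_{x ∈ F₂^m}`. -/
noncomputable def noise (m : ℕ) (δ : ℝ) : Measure (Idx m → ZMod 2) :=
  Measure.pi (fun _ => bern2 δ)

/-- The transformed noise vector `W = G Z`. -/
def Wfun (m : ℕ) (z : Idx m → ZMod 2) : Idx m → ZMod 2 := (Gmat m).mulVec z

/-- `W_r`: the coordinates of `W` whose index has Hamming weight exactly `r`. -/
def Wr (m r : ℕ) (z : Idx m → ZMod 2) : {x : Idx m // wt x = r} → ZMod 2 :=
  fun x => Wfun m z x.val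

/-- `W_{>r}`: the coordinates of `W` whose index has Hamming weight `> r`. -/
def Wgt (m r : ℕ) (z : Idx m → ZMod 2) : {x : Idx m // r < wt x} → ZMod 2 :=
  fun x => Wfun m z x.val

/-- `W_{≤r}`: the coordinates of `W` whose index has Hamming weight `≤ r`. -/
def Wle (m r : ℕ) (z : Idx m → ZMod 2) : {x : Idx m // wt x ≤ r} → ZMod 2 :=
  fun x => Wfun m z x.val

/-- Base-2 Shannon entropy of a random variable `X` (with finitely many values)
on the probability space `(Ω, μ)`: `H(X) = -∑ₛ P(X = s) log₂ P(X = s)`. -/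
noncomputable def ent {Ω S : Type*} [MeasurableSpace Ω] (μ : Measure Ω) (X : Ω → S) : ℝ :=
  -∑' s : S, (μ (X ⁻¹' {s})).toReal * Real.logb 2 (μ (X ⁻¹' {s})).toReal

/-- Conditional entropy `H(X|Y) = H(X,Y) - H(Y)`. -/
noncomputable def condEnt {Ω S T : Type*} [MeasurableSpace Ω] (μ : Measure Ω)
    (X : Ω → S) (Y : Ω → T) : ℝ :=
  ent μ (fun ω => (X ω, Y ω)) - ent μ Y

/-- Conditional Ruzsa distance
`d(X|A, Y|B) = H(X' + Y' | A', B') - (H(X'|A') + H(Y'|B'))/2`, where `(X', A')` and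
`(Y', B')` are independent copies of `(X, A)` and `(Y, B)` (realized on the product space). -/
noncomputable def condRdist {Ω₁ Ω₂ G S T : Type*} [MeasurableSpace Ω₁] [MeasurableSpace Ω₂]
    [Add G] (μ₁ : Measure Ω₁) (μ₂ : Measure Ω₂)
    (X : Ω₁ → G) (A : Ω₁ → S) (Y : Ω₂ → G) (B : Ω₂ → T) : ℝ :=
  condEnt (μ₁.prod μ₂) (fun ω => X ω.1 + Y ω.2) (fun ω => (A ω.1, B ω.2))
    - (condEnt μ₁ X A + condEnt μ₂ Y B) / 2

set_option linter.unusedSectionVars false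

namespace FinEnt

section FiniteEntropy

open Real

variable {Ω Ω' S T R V : Type*} [Fintype Ω] [Fintype Ω'] [Fintype S] [Fintype T] [Fintype R]

open Classical in
/-- The pushforward of the weight function `p` under `X`. -/
noncomputable def law (p : Ω → ℝ) (X : Ω → S) (s : S) : ℝ := ∑ ω, if X ω = s then p ω else 0

/-- Shannon entropy (natural logarithm) of `X` under the weight function `p`. -/
noncomputable def shannon (p : Ω → ℝ) (X : Ω → S) : ℝ := ∑ s, negMulLog (law p X s)

/-- The product weight function. -/
def tensor (p : Ω → ℝ) (q : Ω' → ℝ) (ω : Ω × Ω') : ℝ := p ω.1 * q ω.2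

theorem law_nonneg {p : Ω → ℝ} (hp : 0 ≤ p) (X : Ω → S) : 0 ≤ law p X := fun s =>
  Finset.sum_nonneg fun ω _ => by split_ifs; exacts [hp ω, le_rfl]

theorem sum_law_mul (p : Ω → ℝ) (X : Ω → S) (φ : S → ℝ) :
    ∑ s, law p X s * φ s = ∑ ω, p ω * φ (X ω) := by
  classical
  simp only [law, Finset.sum_mul]
  rw [Finset.sum_comm]
  refine Finset.sum_congr rfl fun ω _ => ?_
  simp [ite_mul]

theorem sum_law (p : Ω → ℝ) (X : Ω → S) : ∑ s, law p X s = ∑ ω, p ω := by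
  simpa using sum_law_mul p X 1

theorem law_law (p : Ω → ℝ) (X : Ω → S) (f : S → T) :
    law (law p X) f = law p (fun ω => f (X ω)) := by
  classical
  ext t
  have := sum_law_mul p X (fun s => if f s = t then 1 else 0)
  simpa [law] using this

theorem law_of_equiv {p : Ω → ℝ} {q : Ω' → ℝ} {X : Ω → S} {Y : Ω' → S} (e : Ω ≃ Ω')
    (hp : ∀ ω, p ω = q (e ω)) (hX : ∀ ω, X ω = Y (e ω)) : law p X = law q Y := by
  classical
  ext s
  simp only [law, hp, hX]
  exact e.sum_comp (fun ω => if Y ω = s then q ω else 0)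

theorem shannon_of_equiv {p : Ω → ℝ} {q : Ω' → ℝ} {X : Ω → S} {Y : Ω' → S} (e : Ω ≃ Ω')
    (hp : ∀ ω, p ω = q (e ω)) (hX : ∀ ω, X ω = Y (e ω)) : shannon p X = shannon q Y := by
  rw [shannon, law_of_equiv e hp hX, shannon]

theorem shannon_law (p : Ω → ℝ) (X : Ω → S) (f : S → T) :
    shannon (law p X) f = shannon p (fun ω => f (X ω)) := by
  rw [shannon, law_law, shannon]

theorem shannon_eq (p : Ω → ℝ) (X : Ω → S) :
    shannon p X = ∑ ω, p ω * -log (law p X (X ω)) := by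
  rw [shannon, ← sum_law_mul p X (fun s => -log (law p X s))]
  simp [negMulLog]

theorem law_le_law_of_determines {p : Ω → ℝ} (hp : 0 ≤ p) {X : Ω → S} {Y : Ω → T}
    (h : ∀ ω ω', p ω ≠ 0 → p ω' ≠ 0 → X ω = X ω' → Y ω = Y ω') {ω : Ω} (hω : p ω ≠ 0) :
    law p X (X ω) ≤ law p Y (Y ω) := by
  classical
  refine Finset.sum_le_sum fun ω' _ => ?_
  by_cases h0 : p ω' = 0
  · simp [h0]
  by_cases hx : X ω' = X ω
  · simp [hx, h _ _ h0 hω hx]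
  · simp only [hx, if_false]
    split_ifs; exacts [hp ω', le_rfl]

theorem le_law {p : Ω → ℝ} (hp : 0 ≤ p) (X : Ω → S) (ω : Ω) : p ω ≤ law p X (X ω) := by
  classical
  have := Finset.single_le_sum (f := fun ω' => if X ω' = X ω then p ω' else 0)
    (fun ω' _ => by split_ifs; exacts [hp ω', le_rfl]) (Finset.mem_univ ω)
  simpa [law] using this

/-- If `Y` is a function of `X` on the support of `p`, its entropy is at most that of `X`. -/
theorem shannon_le_of_determines {p : Ω → ℝ} (hp : 0 ≤ p) {X : Ω → S} {Y : Ω → T}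
    (h : ∀ ω ω', p ω ≠ 0 → p ω' ≠ 0 → X ω = X ω' → Y ω = Y ω') : shannon p Y ≤ shannon p X := by
  rw [shannon_eq, shannon_eq]
  refine Finset.sum_le_sum fun ω _ => ?_
  rcases (hp ω).eq_or_lt with h0 | h0
  · simp [← h0]
  · have h1 : 0 < law p X (X ω) := h0.trans_le (le_law hp X ω)
    have := log_le_log h1 (law_le_law_of_determines hp h h0.ne')
    exact mul_le_mul_of_nonneg_left (by linarith) h0.le

theorem shannon_congr_support {p : Ω → ℝ} (hp : 0 ≤ p) {X : Ω → S} {Y : Ω → T}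
    (h : ∀ ω ω', p ω ≠ 0 → p ω' ≠ 0 → (X ω = X ω' ↔ Y ω = Y ω')) : shannon p X = shannon p Y :=
  le_antisymm (shannon_le_of_determines hp fun _ _ h1 h2 => (h _ _ h1 h2).2)
    (shannon_le_of_determines hp fun _ _ h1 h2 => (h _ _ h1 h2).1)

theorem shannon_congr {p : Ω → ℝ} (hp : 0 ≤ p) {X : Ω → S} {Y : Ω → T}
    (h : ∀ ω ω', X ω = X ω' ↔ Y ω = Y ω') : shannon p X = shannon p Y :=
  shannon_congr_support hp fun ω ω' _ _ => h ω ω'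

theorem sum_law_pair (p : Ω → ℝ) (X : Ω → S) (Y : Ω → T) (t : T) :
    ∑ s, law p (fun ω => (X ω, Y ω)) (s, t) = law p Y t := by
  classical
  simp only [law, Prod.mk.injEq]
  rw [Finset.sum_comm]
  refine Finset.sum_congr rfl fun ω _ => ?_
  by_cases h : Y ω = t <;> simp [h]

/-- Submodularity of entropy. -/
theorem shannon_submodular {p : Ω → ℝ} (hp : 0 ≤ p) (X : Ω → S) (Y : Ω → T) (Z : Ω → R) :
    shannon p (fun ω => (X ω, Y ω, Z ω)) + shannon p Z ≤
      shannon p (fun ω => (X ω, Z ω)) + shannon p (fun ω => (Y ω, Z ω)) := by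
  classical
  set t := law p (fun ω => (X ω, Y ω, Z ω)) with ht
  set a := law p (fun ω => (X ω, Z ω)) with ha
  set b := law p (fun ω => (Y ω, Z ω)) with hb
  set c := law p Z with hc
  have ha0 : 0 ≤ a := law_nonneg hp _
  have hb0 : 0 ≤ b := law_nonneg hp _
  have hc0 : 0 ≤ c := law_nonneg hp _
  have ht0 : 0 ≤ t := law_nonneg hp _
  have key : ∀ x y z, t (x, y, z) * (log (a (x, z)) + log (b (y, z)) - log (t (x, y, z)) - log (c z))
      ≤ a (x, z) * b (y, z) / c z - t (x, y, z) := by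
    intro x y z
    rcases (ht0 (x, y, z)).eq_or_lt with h | h
    · simp only [Pi.zero_apply] at h
      rw [← h]
      simpa using div_nonneg (mul_nonneg (ha0 _) (hb0 _)) (hc0 _)
    · simp only [Pi.zero_apply] at h
      have le1 : t (x, y, z) ≤ a (x, z) := by
        rw [ha, ← sum_law_pair p Y]
        refine (Finset.single_le_sum (f := fun s => law p (fun ω => (Y ω, X ω, Z ω)) (s, x, z))
          (fun s _ => law_nonneg hp _ _) (Finset.mem_univ y)).trans' (le_of_eq ?_)
        simp only [ht, law, Prod.mk.injEq]
        refine Finset.sum_congr rfl fun ω _ => ?_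
        congr 1
        simp only [eq_iff_iff]; tauto
      have le2 : t (x, y, z) ≤ b (y, z) := by
        rw [hb, ← sum_law_pair p X]
        exact Finset.single_le_sum (f := fun s => law p (fun ω => (X ω, Y ω, Z ω)) (s, y, z))
          (fun s _ => law_nonneg hp _ _) (Finset.mem_univ x)
      have le3 : b (y, z) ≤ c z := by
        rw [hc, ← sum_law_pair p Y]
        exact Finset.single_le_sum (f := fun s => law p (fun ω => (Y ω, Z ω)) (s, z))
          (fun s _ => law_nonneg hp _ _) (Finset.mem_univ y)
      have pa := h.trans_le le1
      have pb := h.trans_le le2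
      have pc := pb.trans_le le3
      have hl : log (a (x, z)) + log (b (y, z)) - log (t (x, y, z)) - log (c z)
          = log (a (x, z) * b (y, z) / c z / t (x, y, z)) := by
        rw [log_div (by positivity) h.ne', log_div (by positivity) pc.ne',
          log_mul pa.ne' pb.ne']
        ring
      rw [hl]
      have h2 := log_le_sub_one_of_pos (x := a (x, z) * b (y, z) / c z / t (x, y, z))
        (by positivity)
      calc _ ≤ t (x, y, z) * (a (x, z) * b (y, z) / c z / t (x, y, z) - 1) :=
            mul_le_mul_of_nonneg_left h2 h.le
        _ = _ := by field_simp
  have hsum : ∑ s : S × T × R, t s * (log (a (s.1, s.2.2)) + log (b (s.2.1, s.2.2)) - log (t s)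
      - log (c s.2.2)) ≤ 0 := by
    refine (Finset.sum_le_sum fun s _ => key s.1 s.2.1 s.2.2).trans ?_
    rw [Finset.sum_sub_distrib]
    have e1 : ∑ s : S × T × R, t (s.1, s.2.1, s.2.2) = ∑ ω, p ω := sum_law p _
    have e2 : ∑ s : S × T × R, a (s.1, s.2.2) * b (s.2.1, s.2.2) / c s.2.2 = ∑ ω, p ω := by
      rw [← sum_law p Z, Fintype.sum_prod_type]
      simp only [Fintype.sum_prod_type]
      rw [Finset.sum_congr rfl fun x _ => Finset.sum_comm, Finset.sum_comm]
      refine Finset.sum_congr rfl fun z _ => ?_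
      simp only [← Finset.sum_div, ← Finset.mul_sum, ← Finset.sum_mul]
      rw [sum_law_pair p X Z, sum_law_pair p Y Z, ← hc]
      by_cases h : c z = 0
      · simp [h]
      · field_simp
    rw [e1, e2, sub_self]
  rw [sum_law_mul p _ (fun s => log (a (s.1, s.2.2)) + log (b (s.2.1, s.2.2)) - log (t s)
      - log (c s.2.2))] at hsum
  simp only [shannon_eq, ← ht, ← ha, ← hb, ← hc]
  simp only [mul_sub, mul_add, Finset.sum_sub_distrib, Finset.sum_add_distrib] at hsum
  simp only [mul_neg, Finset.sum_neg_distrib]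
  linarith

theorem sum_tensor (p : Ω → ℝ) (q : Ω' → ℝ) :
    ∑ ω, tensor p q ω = (∑ ω, p ω) * ∑ ω, q ω := by
  simp only [tensor, Fintype.sum_prod_type, Finset.sum_mul_sum]

theorem tensor_nonneg {p : Ω → ℝ} {q : Ω' → ℝ} (hp : 0 ≤ p) (hq : 0 ≤ q) : 0 ≤ tensor p q :=
  fun ω => mul_nonneg (hp ω.1) (hq ω.2)

theorem law_tensor (p : Ω → ℝ) (q : Ω' → ℝ) (X : Ω → S) (Y : Ω' → T) :
    law (tensor p q) (fun ω => (X ω.1, Y ω.2)) = tensor (law p X) (law q Y) := by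
  classical
  ext ⟨s, t⟩
  simp only [law, tensor, Prod.mk.injEq, Fintype.sum_prod_type, Finset.sum_mul_sum]
  refine Finset.sum_congr rfl fun ω _ => Finset.sum_congr rfl fun ω' _ => ?_
  by_cases h : X ω = s <;> by_cases h' : Y ω' = t <;> simp [h, h']

theorem shannon_tensor_law (p : Ω → ℝ) (q : Ω' → ℝ) (X : Ω → S) (Y : Ω' → T) (f : S × T → R) :
    shannon (tensor (law p X) (law q Y)) f = shannon (tensor p q) (fun ω => f (X ω.1, Y ω.2)) := by
  rw [← law_tensor, shannon_law]

/-- Entropy of a pair of independent variables, for weights of arbitrary mass. -/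
theorem shannon_tensor_pair (p : Ω → ℝ) (q : Ω' → ℝ) (X : Ω → S) (Y : Ω' → T) :
    shannon (tensor p q) (fun ω => (X ω.1, Y ω.2)) =
      (∑ ω, q ω) * shannon p X + (∑ ω, p ω) * shannon q Y := by
  simp only [shannon, law_tensor, tensor, negMulLog_mul, Fintype.sum_prod_type,
    Finset.sum_add_distrib]
  rw [← sum_law p X, ← sum_law q Y, Finset.sum_mul_sum, Finset.sum_mul_sum]
  rw [Finset.sum_comm]

theorem shannon_const (p : Ω → ℝ) : shannon p (fun _ => ()) = negMulLog (∑ ω, p ω) := by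
  simp [shannon, law]

theorem law_self (p : Ω → ℝ) : law p (fun ω => ω) = p := by
  classical
  ext; simp [law]

theorem law_tensor_fst (p : Ω → ℝ) {q : Ω' → ℝ} (hq : ∑ ω, q ω = 1) (X : Ω → S) :
    law (tensor p q) (fun ω => X ω.1) = law p X := by
  classical
  ext s
  simp only [law, tensor, Fintype.sum_prod_type]
  refine Finset.sum_congr rfl fun ω _ => ?_
  by_cases h : X ω = s <;> simp [h, ← Finset.mul_sum, hq]

theorem shannon_tensor_fst (p : Ω → ℝ) {q : Ω' → ℝ} (hq : ∑ ω, q ω = 1) (X : Ω → S) :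
    shannon (tensor p q) (fun ω => X ω.1) = shannon p X := by
  rw [shannon, law_tensor_fst p hq, shannon]

theorem shannon_tensor_snd {p : Ω → ℝ} (q : Ω' → ℝ) (hp : ∑ ω, p ω = 1) (X : Ω' → S) :
    shannon (tensor p q) (fun ω => X ω.2) = shannon q X := by
  rw [← shannon_tensor_fst q hp X]
  exact shannon_of_equiv (Equiv.prodComm _ _) (fun ω => mul_comm _ _) (fun ω => rfl)

/-- Conditional entropy of `X` given `C`; it is homogeneous of degree one in the weight `p`. -/
noncomputable def cond (p : Ω → ℝ) (X : Ω → S) (C : Ω → T) : ℝ :=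
  shannon p (fun ω => (X ω, C ω)) - shannon p C

open Classical in
/-- The restriction of the weight `p` to the event `C = c`. -/
noncomputable def fiber (p : Ω → ℝ) (C : Ω → T) (c : T) (ω : Ω) : ℝ := if C ω = c then p ω else 0

/-- The trivial random variable. -/
abbrev triv (Ω : Type*) : Ω → Unit := fun _ => ()

theorem fiber_nonneg {p : Ω → ℝ} (hp : 0 ≤ p) (C : Ω → T) (c : T) : 0 ≤ fiber p C c := fun ω => by
  unfold fiber; split_ifs; exacts [hp ω, le_rfl]

theorem sum_fiber (p : Ω → ℝ) (C : Ω → T) (c : T) : ∑ ω, fiber p C c ω = law p C c := rfl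

theorem law_fiber (p : Ω → ℝ) (C : Ω → T) (c : T) (X : Ω → S) (s : S) :
    law (fiber p C c) X s = law p (fun ω => (X ω, C ω)) (s, c) := by
  classical
  simp only [law, fiber, Prod.mk.injEq]
  refine Finset.sum_congr rfl fun ω _ => ?_
  by_cases h : X ω = s <;> by_cases h' : C ω = c <;> simp [h, h']

theorem sum_shannon_fiber (p : Ω → ℝ) (C : Ω → T) (X : Ω → S) :
    ∑ c, shannon (fiber p C c) X = shannon p (fun ω => (X ω, C ω)) := by
  simp only [shannon, law_fiber, Fintype.sum_prod_type]
  exact Finset.sum_comm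

theorem shannon_pair_assoc (p : Ω → ℝ) (X : Ω → S) (B : Ω → R) (C : Ω → T) :
    shannon p (fun ω => ((X ω, B ω), C ω)) = shannon p (fun ω => (X ω, B ω, C ω)) := by
  classical
  simp only [shannon]
  refine Fintype.sum_equiv (Equiv.prodAssoc S R T) _ _ fun s => ?_
  congr 1
  simp only [law, Prod.ext_iff, Equiv.prodAssoc_apply, and_assoc]

theorem sum_cond_fiber (p : Ω → ℝ) (X : Ω → S) (B : Ω → R) (C : Ω → T) :
    ∑ c, cond (fiber p C c) X B = cond p X (fun ω => (B ω, C ω)) := by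
  simp only [cond, Finset.sum_sub_distrib, sum_shannon_fiber, shannon_pair_assoc]

theorem law_smul (a : ℝ) (p : Ω → ℝ) (X : Ω → S) : law (a • p) X = a • law p X := by
  classical
  ext s
  simp only [law, Pi.smul_apply, smul_eq_mul, Finset.mul_sum, mul_ite, mul_zero]

theorem shannon_smul (a : ℝ) (p : Ω → ℝ) (X : Ω → S) :
    shannon (a • p) X = (∑ ω, p ω) * negMulLog a + a * shannon p X := by
  simp only [shannon, law_smul, Pi.smul_apply, smul_eq_mul, negMulLog_mul, Finset.sum_add_distrib,
    ← Finset.sum_mul, ← Finset.mul_sum, sum_law]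

theorem cond_smul (a : ℝ) (p : Ω → ℝ) (X : Ω → S) (C : Ω → T) :
    cond (a • p) X C = a * cond p X C := by
  simp only [cond, shannon_smul]; ring

theorem cond_law (p : Ω → ℝ) (X : Ω → S) (f : S → T) (g : S → R) :
    cond (law p X) f g = cond p (fun ω => f (X ω)) (fun ω => g (X ω)) := by
  simp only [cond, shannon_law]

theorem cond_triv {p : Ω → ℝ} (hp : 0 ≤ p) (X : Ω → S) :
    cond p X (triv Ω) = shannon p X - negMulLog (∑ ω, p ω) := by
  rw [cond, shannon_const, shannon_congr hp (Y := X)]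
  simp

theorem cond_triv_pair {p : Ω → ℝ} (hp : 0 ≤ p) (X : Ω → S) (C : Ω → T) :
    cond p X (fun ω => (triv Ω ω, C ω)) = cond p X C := by
  rw [cond, cond, shannon_congr hp (X := fun ω => (X ω, triv Ω ω, C ω)) (Y := fun ω => (X ω, C ω)),
    shannon_congr hp (X := fun ω => (triv Ω ω, C ω)) (Y := C)] <;> simp

theorem cond_tensor_pair {p : Ω → ℝ} {q : Ω' → ℝ} (hp : 0 ≤ p) (hq : 0 ≤ q) (X : Ω → S)
    (Y : Ω' → T) : cond (tensor p q) (fun ω => (X ω.1, Y ω.2)) (triv _) =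
      (∑ ω, q ω) * cond p X (triv _) + (∑ ω, p ω) * cond q Y (triv _) := by
  rw [cond_triv (tensor_nonneg hp hq), cond_triv hp, cond_triv hq, shannon_tensor_pair, sum_tensor,
    negMulLog_mul]
  ring

theorem cond_tensor_law (p : Ω → ℝ) (q : Ω' → ℝ) (Y : Ω' → S) (f : Ω × S → T) (g : Ω × S → R) :
    cond (tensor p (law q Y)) f g =
      cond (tensor p q) (fun ω => f (ω.1, Y ω.2)) (fun ω => g (ω.1, Y ω.2)) := by
  conv_lhs => rw [← law_self p, ← law_tensor, cond_law]

theorem cond_tensor_law_law (p : Ω → ℝ) (q : Ω' → ℝ) (X : Ω → V) [Fintype V] (Y : Ω' → S)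
    (f : V × S → T) (g : V × S → R) :
    cond (tensor (law p X) (law q Y)) f g =
      cond (tensor p q) (fun ω => f (X ω.1, Y ω.2)) (fun ω => g (X ω.1, Y ω.2)) := by
  rw [← law_tensor, cond_law]

theorem tensor_fiber_right (p : Ω → ℝ) (q : Ω' → ℝ) (C : Ω' → T) (c : T) :
    tensor p (fiber q C c) = fiber (tensor p q) (fun ω => C ω.2) c := by
  ext ω
  simp [tensor, fiber]

theorem tensor_fiber_fiber (p : Ω → ℝ) (q : Ω' → ℝ) (C : Ω → S) (C' : Ω' → T) (c : S) (c' : T) :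
    tensor (fiber p C c) (fiber q C' c') =
      fiber (tensor p q) (fun ω => (C ω.1, C' ω.2)) (c, c') := by
  ext ω
  by_cases h : C ω.1 = c <;> by_cases h' : C' ω.2 = c' <;> simp [tensor, fiber, h, h']

section Dist

variable [AddCommGroup V] [Fintype V]

/-- Bihomogeneous Ruzsa distance between two weights on `V` (in characteristic two). -/
noncomputable def rdist (μ ν : V → ℝ) : ℝ :=
  cond (tensor μ ν) (fun v => v.1 + v.2) (triv _) -
    ((∑ v, ν v) * cond μ id (triv _) + (∑ v, μ v) * cond ν id (triv _)) / 2

/-- Ruzsa distance from the conditional random variable `X | A` to the weight `μ`. -/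
noncomputable def refDist (p : Ω → ℝ) (X : Ω → V) (A : Ω → S) (μ : V → ℝ) : ℝ :=
  cond (tensor p μ) (fun ω => X ω.1 + ω.2) (fun ω => A ω.1) -
    ((∑ v, μ v) * cond p X A + cond μ id (triv _)) / 2

/-- The functional whose minimizers are sought. -/
noncomputable def tau (p : Ω → ℝ) (X : Ω → V) (A : Ω → S) (η : ℝ) (μ ν : V → ℝ) : ℝ :=
  rdist μ ν + η * ((∑ v, ν v) * refDist p X A μ + (∑ v, μ v) * refDist p X A ν)

theorem tensor_smul_smul (a b : ℝ) (p : Ω → ℝ) (q : Ω' → ℝ) :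
    tensor (a • p) (b • q) = (a * b) • tensor p q := by
  ext ω; simp [tensor]; ring

theorem rdist_smul (a b : ℝ) (μ ν : V → ℝ) : rdist (a • μ) (b • ν) = a * b * rdist μ ν := by
  simp only [rdist, tensor_smul_smul, cond_smul, Pi.smul_apply, smul_eq_mul, ← Finset.mul_sum]
  ring

theorem refDist_smul (p : Ω → ℝ) (X : Ω → V) (A : Ω → S) (a : ℝ) (μ : V → ℝ) :
    refDist p X A (a • μ) = a * refDist p X A μ := by
  have : tensor p (a • μ) = a • tensor p μ := by ext ω; simp [tensor]; ring
  simp only [refDist, this, cond_smul, Pi.smul_apply, smul_eq_mul, ← Finset.mul_sum]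
  ring

theorem tau_smul (p : Ω → ℝ) (X : Ω → V) (A : Ω → S) (η a b : ℝ) (μ ν : V → ℝ) :
    tau p X A η (a • μ) (b • ν) = a * b * tau p X A η μ ν := by
  simp only [tau, rdist_smul, refDist_smul, Pi.smul_apply, smul_eq_mul, ← Finset.mul_sum]
  ring

theorem exists_smul_mem_stdSimplex {μ : V → ℝ} (hμ : 0 ≤ μ) :
    ∃ μ' ∈ stdSimplex ℝ V, μ = (∑ v, μ v) • μ' := by
  classical
  by_cases h : ∑ v, μ v = 0
  · refine ⟨Pi.single 0 1, single_mem_stdSimplex ℝ 0, ?_⟩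
    rw [h, zero_smul]
    ext v
    exact (Finset.sum_eq_zero_iff_of_nonneg fun v _ => hμ v).1 h v (Finset.mem_univ v)
  · refine ⟨(∑ v, μ v)⁻¹ • μ, ⟨fun v => ?_, ?_⟩, ?_⟩
    · exact mul_nonneg (inv_nonneg.2 (Finset.sum_nonneg fun v _ => hμ v)) (hμ v)
    · simp only [Pi.smul_apply, smul_eq_mul, ← Finset.mul_sum]
      exact inv_mul_cancel₀ h
    · rw [smul_smul, mul_inv_cancel₀ h, one_smul]

/-- `t` is a lower bound of `tau` on probability weights. -/
def IsLowerTau (p : Ω → ℝ) (X : Ω → V) (A : Ω → S) (η t : ℝ) : Prop :=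
  ∀ μ ∈ stdSimplex ℝ V, ∀ ν ∈ stdSimplex ℝ V, t ≤ tau p X A η μ ν

variable {p₀ : Ω → ℝ} {X₀ : Ω → V} {A₀ : Ω → S} {η t : ℝ}

theorem IsLowerTau.mul_le (h : IsLowerTau p₀ X₀ A₀ η t) {μ ν : V → ℝ} (hμ : 0 ≤ μ) (hν : 0 ≤ ν) :
    (∑ v, μ v) * (∑ v, ν v) * t ≤ tau p₀ X₀ A₀ η μ ν := by
  obtain ⟨μ', hμ', e⟩ := exists_smul_mem_stdSimplex hμ
  obtain ⟨ν', hν', e'⟩ := exists_smul_mem_stdSimplex hν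
  conv_rhs => rw [e, e', tau_smul]
  exact mul_le_mul_of_nonneg_left (h _ hμ' _ hν')
    (mul_nonneg (Finset.sum_nonneg fun v _ => hμ v) (Finset.sum_nonneg fun v _ => hν v))

/-- Average over `c` of the distance from `X₀ | A₀` to `Y` restricted to `C = c`. -/
noncomputable def condRefDist (p₀ : Ω → ℝ) (X₀ : Ω → V) (A₀ : Ω → S) (q : Ω' → ℝ) (Y : Ω' → V)
    (C : Ω' → T) : ℝ :=
  ∑ c, refDist p₀ X₀ A₀ (law (fiber q C c) Y)

theorem condRefDist_eq {q : Ω' → ℝ} (hq : 0 ≤ q) (hq1 : ∑ ω, q ω = 1) (Y : Ω' → V) (C : Ω' → T) :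
    condRefDist p₀ X₀ A₀ q Y C =
      cond (tensor p₀ q) (fun ω => X₀ ω.1 + Y ω.2) (fun ω => (A₀ ω.1, C ω.2)) -
        (cond p₀ X₀ A₀ + cond q Y C) / 2 := by
  have h1 : ∑ c, cond (fiber q C c) Y (triv _) = cond q Y C := by
    rw [sum_cond_fiber, cond_triv_pair hq]
  simp only [condRefDist, refDist, Finset.sum_sub_distrib, ← Finset.sum_div,
    Finset.sum_add_distrib, ← Finset.sum_mul, cond_tensor_law, cond_law, sum_law, id_eq]
  rw [h1]
  simp only [sum_fiber, sum_law, hq1, one_mul, tensor_fiber_right, sum_cond_fiber]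

theorem refDist_law {q : Ω' → ℝ} (Y : Ω' → V) (hq1 : ∑ ω, q ω = 1) :
    refDist p₀ X₀ A₀ (law q Y) =
      cond (tensor p₀ q) (fun ω => X₀ ω.1 + Y ω.2) (fun ω => A₀ ω.1) -
        (cond p₀ X₀ A₀ + cond q Y (triv _)) / 2 := by
  simp only [refDist, cond_tensor_law, cond_law, sum_law, id_eq, hq1, one_mul]

theorem condRefDist_le (hp₀ : 0 ≤ p₀) {q : Ω' → ℝ} (hq : 0 ≤ q)
    (hq1 : ∑ ω, q ω = 1) (Y : Ω' → V) (C : Ω' → T) :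
    condRefDist p₀ X₀ A₀ q Y C ≤ refDist p₀ X₀ A₀ (law q Y) +
      (shannon q Y + shannon q C - shannon q (fun ω => (Y ω, C ω))) / 2 := by
  rw [condRefDist_eq hq hq1, refDist_law Y hq1, cond_triv hq, hq1, negMulLog_one]
  have hpq := tensor_nonneg hp₀ hq
  have := shannon_submodular hpq (fun ω => X₀ ω.1 + Y ω.2) (fun ω => C ω.2) (fun ω => A₀ ω.1)
  have e1 : shannon (tensor p₀ q) (fun ω => (X₀ ω.1 + Y ω.2, (C ω.2, A₀ ω.1))) =
      shannon (tensor p₀ q) (fun ω => (X₀ ω.1 + Y ω.2, (A₀ ω.1, C ω.2))) :=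
    shannon_congr hpq fun _ _ => by simp only [Prod.mk.injEq]; tauto
  have e2 : shannon (tensor p₀ q) (fun ω => (C ω.2, A₀ ω.1)) =
      shannon (tensor p₀ q) (fun ω => (A₀ ω.1, C ω.2)) :=
    shannon_congr hpq fun _ _ => by simp only [Prod.mk.injEq]; tauto
  simp only [cond]
  linarith

theorem IsLowerTau.le_cond (h : IsLowerTau p₀ X₀ A₀ η t) {Ω₁ Ω₂ T₁ T₂ : Type*} [Fintype Ω₁]
    [Fintype Ω₂] [Fintype T₁] [Fintype T₂] {p : Ω₁ → ℝ} {q : Ω₂ → ℝ} (hp : 0 ≤ p)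
    (hp1 : ∑ ω, p ω = 1) (hq : 0 ≤ q) (hq1 : ∑ ω, q ω = 1) (Y : Ω₁ → V) (C : Ω₁ → T₁)
    (Y' : Ω₂ → V) (C' : Ω₂ → T₂) :
    t ≤ cond (tensor p q) (fun ω => Y ω.1 + Y' ω.2) (fun ω => (C ω.1, C' ω.2)) -
      (cond p Y C + cond q Y' C') / 2 +
      η * (condRefDist p₀ X₀ A₀ p Y C + condRefDist p₀ X₀ A₀ q Y' C') := by
  have h0 : ∀ c c', law p C c * law q C' c' * t ≤
      cond (fiber (tensor p q) (fun ω => (C ω.1, C' ω.2)) (c, c')) (fun ω => Y ω.1 + Y' ω.2)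
        (triv _) - (law q C' c' * cond (fiber p C c) Y (triv _) +
          law p C c * cond (fiber q C' c') Y' (triv _)) / 2 +
      η * (law q C' c' * refDist p₀ X₀ A₀ (law (fiber p C c) Y) +
        law p C c * refDist p₀ X₀ A₀ (law (fiber q C' c') Y')) := by
    intro c c'
    have := h.mul_le (law_nonneg (fiber_nonneg hp C c) Y) (law_nonneg (fiber_nonneg hq C' c') Y')
    simpa only [tau, rdist, cond_tensor_law_law, cond_law, sum_law, sum_fiber, id_eq,
      tensor_fiber_fiber] using this
  have h1 := Finset.sum_le_sum fun c (_ : c ∈ Finset.univ) =>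
    Finset.sum_le_sum fun c' (_ : c' ∈ Finset.univ) => h0 c c'
  have e1 : ∑ c, ∑ c', cond (fiber (tensor p q) (fun ω => (C ω.1, C' ω.2)) (c, c'))
      (fun ω => Y ω.1 + Y' ω.2) (triv _) =
      cond (tensor p q) (fun ω => Y ω.1 + Y' ω.2) (fun ω => (C ω.1, C' ω.2)) := by
    rw [← cond_triv_pair (tensor_nonneg hp hq), ← sum_cond_fiber, Fintype.sum_prod_type]
  have e2 : ∑ c, cond (fiber p C c) Y (triv _) = cond p Y C := by
    rw [sum_cond_fiber, cond_triv_pair hp]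
  have e3 : ∑ c, cond (fiber q C' c) Y' (triv _) = cond q Y' C' := by
    rw [sum_cond_fiber, cond_triv_pair hq]
  simp only [Finset.sum_add_distrib, Finset.sum_sub_distrib, e1, ← Finset.sum_div,
    ← Finset.mul_sum, ← Finset.sum_mul, sum_law, hp1, hq1, e2, e3, one_mul] at h1
  simpa only [condRefDist, mul_add] using h1

open Classical in
/-- Two copies of a random element with weight `p`, conditionally independent given `Z`. -/
noncomputable def coupling (p : Ω → ℝ) (Z : Ω → T) (ω : Ω × Ω) : ℝ :=
  if Z ω.1 = Z ω.2 then (law p Z (Z ω.1))⁻¹ * (p ω.1 * p ω.2) else 0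

theorem fiber_coupling (p : Ω → ℝ) (Z : Ω → T) (z : T) :
    fiber (coupling p Z) (fun ω => Z ω.1) z =
      (law p Z z)⁻¹ • tensor (fiber p Z z) (fiber p Z z) := by
  ext ω
  by_cases h : Z ω.1 = z
  · by_cases h' : Z ω.2 = z
    · simp [fiber, coupling, tensor, h, h']
    · simp [fiber, coupling, tensor, h, h', Ne.symm h']
  · simp [fiber, tensor, h]

theorem coupling_nonneg {p : Ω → ℝ} (hp : 0 ≤ p) (Z : Ω → T) : 0 ≤ coupling p Z := fun ω => by
  unfold coupling
  split_ifs
  · exact mul_nonneg (inv_nonneg.2 (law_nonneg hp Z _)) (mul_nonneg (hp _) (hp _))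
  · exact le_rfl

theorem law_coupling_fst {p : Ω → ℝ} (hp : 0 ≤ p) (Z : Ω → T) :
    law (coupling p Z) Prod.fst = p := by
  classical
  ext ω
  have h1 : law (coupling p Z) Prod.fst ω = (law p Z (Z ω))⁻¹ * p ω * law p Z (Z ω) := by
    conv_rhs => rw [law, Finset.mul_sum]
    simp only [law, Fintype.sum_prod_type]
    rw [Finset.sum_comm]
    refine Finset.sum_congr rfl fun ω' _ => ?_
    by_cases h : Z ω = Z ω'
    · simp [coupling, h, mul_assoc, law]
    · simp [coupling, h, Ne.symm h]
  rw [h1]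
  by_cases h : law p Z (Z ω) = 0
  · have := le_law hp Z ω
    rw [h] at this
    simp [le_antisymm this (hp ω)]
  · field_simp

theorem law_coupling_snd {p : Ω → ℝ} (hp : 0 ≤ p) (Z : Ω → T) :
    law (coupling p Z) Prod.snd = p := by
  conv_rhs => rw [← law_coupling_fst hp Z]
  refine law_of_equiv (Equiv.prodComm _ _) (fun ω => ?_) (fun ω => rfl)
  by_cases h : Z ω.1 = Z ω.2
  · simp [coupling, h, mul_comm]
  · simp [coupling, h, Ne.symm h]

theorem shannon_coupling_fst {p : Ω → ℝ} (hp : 0 ≤ p) (Z : Ω → T) (X : Ω → R) :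
    shannon (coupling p Z) (fun ω => X ω.1) = shannon p X := by
  rw [← shannon_law _ Prod.fst X, law_coupling_fst hp]

theorem shannon_coupling_snd {p : Ω → ℝ} (hp : 0 ≤ p) (Z : Ω → T) (X : Ω → R) :
    shannon (coupling p Z) (fun ω => X ω.2) = shannon p X := by
  rw [← shannon_law _ Prod.snd X, law_coupling_snd hp]

theorem law_mul_inv_mul_cond {p : Ω → ℝ} (hp : 0 ≤ p) (Z : Ω → T) (z : T) (X : Ω → R) :
    (law p Z z)⁻¹ * (law p Z z * cond (fiber p Z z) X (triv _)) =
      cond (fiber p Z z) X (triv _) := by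
  by_cases h : law p Z z = 0
  · have : fiber p Z z = (0 : ℝ) • fiber p Z z := by
      rw [zero_smul]
      ext ω
      exact (Finset.sum_eq_zero_iff_of_nonneg fun ω _ => fiber_nonneg hp Z z ω).1 h ω
        (Finset.mem_univ ω)
    rw [this, cond_smul]
    simp
  · field_simp

theorem cond_coupling {p : Ω → ℝ} (hp : 0 ≤ p) (Z : Ω → T) (X : Ω → R) :
    cond (coupling p Z) (fun ω => (X ω.1, X ω.2)) (fun ω => Z ω.1) = 2 * cond p X Z := by
  rw [← cond_triv_pair (coupling_nonneg hp Z), ← sum_cond_fiber, ← cond_triv_pair hp,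
    ← sum_cond_fiber, Finset.mul_sum]
  refine Finset.sum_congr rfl fun z _ => ?_
  rw [fiber_coupling, cond_smul, cond_tensor_pair (fiber_nonneg hp Z z) (fiber_nonneg hp Z z),
    sum_fiber, mul_add, law_mul_inv_mul_cond hp]
  ring

theorem IsLowerTau.le_coupling (h : IsLowerTau p₀ X₀ A₀ η t) {q : Ω' → ℝ} (hq : 0 ≤ q)
    (hq1 : ∑ ω, q ω = 1) (Y : Ω' → V) (Z : Ω' → T) :
    t ≤ cond (coupling q Z) (fun ω => Y ω.1 + Y ω.2) (fun ω => Z ω.1) - cond q Y Z +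
      2 * η * condRefDist p₀ X₀ A₀ q Y Z := by
  have h0 : ∀ z, law q Z z * t ≤
      (law q Z z)⁻¹ * cond (tensor (fiber q Z z) (fiber q Z z)) (fun ω => Y ω.1 + Y ω.2)
        (triv _) - cond (fiber q Z z) Y (triv _) +
      2 * η * refDist p₀ X₀ A₀ (law (fiber q Z z) Y) := by
    intro z
    have hn := law_nonneg (fiber_nonneg hq Z z) Y
    by_cases hz : law q Z z = 0
    · have h1 : fiber q Z z = (0 : ℝ) • fiber q Z z := by
        rw [zero_smul]
        ext ω
        exact (Finset.sum_eq_zero_iff_of_nonneg fun ω _ => fiber_nonneg hq Z z ω).1 hz ω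
          (Finset.mem_univ ω)
      rw [h1, cond_smul, law_smul, refDist_smul, hz]
      simp
    · have hpos : 0 < law q Z z := lt_of_le_of_ne (law_nonneg hq Z z) (Ne.symm hz)
      have := h.mul_le hn hn
      simp only [tau, rdist, cond_tensor_law_law, cond_law, sum_law, sum_fiber, id_eq] at this
      refine le_of_mul_le_mul_left ?_ hpos
      refine (le_of_eq (by ring)).trans (this.trans (le_of_eq ?_))
      field_simp
      ring
  have h1 := Finset.sum_le_sum fun z (_ : z ∈ Finset.univ) => h0 z
  have e1 : ∑ z, (law q Z z)⁻¹ * cond (tensor (fiber q Z z) (fiber q Z z))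
      (fun ω => Y ω.1 + Y ω.2) (triv _) =
      cond (coupling q Z) (fun ω => Y ω.1 + Y ω.2) (fun ω => Z ω.1) := by
    rw [← cond_triv_pair (coupling_nonneg hq Z), ← sum_cond_fiber]
    simp only [fiber_coupling, cond_smul]
  have e2 : ∑ c, cond (fiber q Z c) Y (triv _) = cond q Y Z := by
    rw [sum_cond_fiber, cond_triv_pair hq]
  simpa only [Finset.sum_add_distrib, Finset.sum_sub_distrib, e1, ← Finset.mul_sum,
    ← Finset.sum_mul, sum_law, hq1, e2, one_mul, condRefDist] using h1

end Dist

variable [AddCommGroup V] [Fintype V]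

/-- Entropy of the sum of two independent variables with laws `p` and `q`. -/
noncomputable def sumEnt (p q : V → ℝ) : ℝ := shannon (tensor p q) (fun v => v.1 + v.2)

/-- Law of the sum of two independent variables with laws `p` and `q`. -/
noncomputable def conv (p q : V → ℝ) : V → ℝ := law (tensor p q) (fun v => v.1 + v.2)

theorem sumEnt_comm (p q : V → ℝ) : sumEnt p q = sumEnt q p :=
  shannon_of_equiv (Equiv.prodComm _ _) (fun _ => mul_comm _ _) (fun _ => add_comm _ _)

theorem shannon_conv (p q : V → ℝ) : shannon (conv p q) id = sumEnt p q := shannon_law _ _ id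

theorem law_mem_stdSimplex {p : Ω → ℝ} (hp : p ∈ stdSimplex ℝ Ω) (X : Ω → S) :
    law p X ∈ stdSimplex ℝ S :=
  ⟨law_nonneg hp.1 X, (sum_law p X).trans hp.2⟩

theorem tensor_mem_stdSimplex {p : Ω → ℝ} {q : Ω' → ℝ} (hp : p ∈ stdSimplex ℝ Ω)
    (hq : q ∈ stdSimplex ℝ Ω') : tensor p q ∈ stdSimplex ℝ (Ω × Ω') :=
  ⟨tensor_nonneg hp.1 hq.1, by rw [sum_tensor, hp.2, hq.2, one_mul]⟩

theorem conv_mem_stdSimplex {p q : V → ℝ} (hp : p ∈ stdSimplex ℝ V) (hq : q ∈ stdSimplex ℝ V) :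
    conv p q ∈ stdSimplex ℝ V :=
  law_mem_stdSimplex (tensor_mem_stdSimplex hp hq) _

theorem shannon_indep {p : Ω → ℝ} {q : Ω' → ℝ} (hp : p ∈ stdSimplex ℝ Ω)
    (hq : q ∈ stdSimplex ℝ Ω') (X : Ω → S) (Y : Ω' → T) :
    shannon (tensor p q) (fun ω => (X ω.1, Y ω.2)) = shannon p X + shannon q Y := by
  rw [shannon_tensor_pair, hp.2, hq.2, one_mul, one_mul]

/-- The Kaimanovich-Vershik inequality, with side information. -/
theorem shannon_kaimanovich_vershik {p : Ω → ℝ} {q r : V → ℝ} (hp : p ∈ stdSimplex ℝ Ω)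
    (hq : q ∈ stdSimplex ℝ V) (hr : r ∈ stdSimplex ℝ V) (X : Ω → V) (A : Ω → S) :
    shannon (tensor p (conv q r)) (fun ω => (X ω.1 + ω.2, A ω.1)) + shannon q id ≤
      shannon (tensor p q) (fun ω => (X ω.1 + ω.2, A ω.1)) + sumEnt q r := by
  have hP := tensor_mem_stdSimplex hp (tensor_mem_stdSimplex hq hr)
  have h := shannon_submodular hP.1 (fun ω => X ω.1) (fun ω => ω.2.2)
    (fun ω => (X ω.1 + (ω.2.1 + ω.2.2), A ω.1))
  have e0 : shannon (tensor p (conv q r)) (fun ω => (X ω.1 + ω.2, A ω.1)) =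
      shannon (tensor p (tensor q r)) (fun ω => (X ω.1 + (ω.2.1 + ω.2.2), A ω.1)) := by
    conv_lhs => rw [← law_self p, conv, shannon_tensor_law]
  have e1 : shannon (tensor p (tensor q r)) (fun ω => (X ω.1, ω.2.2, X ω.1 + (ω.2.1 + ω.2.2), A ω.1))
      = shannon p (fun ω => (X ω, A ω)) + (shannon q id + shannon r id) := by
    rw [← shannon_indep hq hr, ← shannon_indep hp (tensor_mem_stdSimplex hq hr)]
    refine shannon_congr hP.1 fun ω ω' => ?_
    simp only [Prod.mk.injEq, id]
    grind
  have e2 : shannon (tensor p (tensor q r)) (fun ω => (X ω.1, X ω.1 + (ω.2.1 + ω.2.2), A ω.1))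
      = shannon p (fun ω => (X ω, A ω)) + sumEnt q r := by
    rw [sumEnt, ← shannon_indep hp (tensor_mem_stdSimplex hq hr)]
    refine shannon_congr hP.1 fun ω ω' => ?_
    simp only [Prod.mk.injEq]
    grind
  have e3 : shannon (tensor p (tensor q r)) (fun ω => (ω.2.2, X ω.1 + (ω.2.1 + ω.2.2), A ω.1))
      = shannon (tensor p q) (fun ω => (X ω.1 + ω.2, A ω.1)) + shannon r id := by
    rw [← shannon_indep (tensor_mem_stdSimplex hp hq) hr]
    rw [shannon_congr hP.1 (Y := fun ω => ((X ω.1 + ω.2.1, A ω.1), ω.2.2))]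
    · exact shannon_of_equiv (Equiv.prodAssoc _ _ _).symm (fun ω => by simp [tensor, mul_assoc])
        (fun ω => rfl)
    · intro ω ω'
      simp only [Prod.mk.injEq]
      grind
  rw [e1, e2, e3] at h
  rw [e0]
  linarith

theorem sumEnt_conv_le {p q r : V → ℝ} (hp : p ∈ stdSimplex ℝ V) (hq : q ∈ stdSimplex ℝ V)
    (hr : r ∈ stdSimplex ℝ V) : sumEnt p (conv q r) + shannon q id ≤ sumEnt p q + sumEnt q r := by
  have := shannon_kaimanovich_vershik hp hq hr id (triv V)
  have e : ∀ s ∈ stdSimplex ℝ V, shannon (tensor p s) (fun ω => (id ω.1 + ω.2, triv V ω.1)) =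
      sumEnt p s := fun s hs => shannon_congr (tensor_mem_stdSimplex hp hs).1 fun _ _ => by simp
  rwa [e _ (conv_mem_stdSimplex hq hr), e _ hq] at this

theorem shannon_le_sumEnt {p q : V → ℝ} (hp : p ∈ stdSimplex ℝ V) (hq : q ∈ stdSimplex ℝ V) :
    shannon p id ≤ sumEnt p q := by
  have hP := tensor_mem_stdSimplex hp hq
  have h := shannon_submodular hP.1 (fun v => v.1 + v.2) (fun v => v.2) (triv _)
  have e1 : shannon (tensor p q) (fun v => (v.1 + v.2, v.2, triv _ v)) =
      shannon p id + shannon q id := by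
    rw [← shannon_indep hp hq]
    refine shannon_congr hP.1 fun ω ω' => ?_
    simp only [Prod.mk.injEq, id]
    grind
  have e2 : shannon (tensor p q) (fun v => (v.1 + v.2, triv _ v)) = sumEnt p q :=
    shannon_congr hP.1 fun ω ω' => by simp
  have e3 : shannon (tensor p q) (fun v => (v.2, triv _ v)) = shannon q id := by
    rw [← shannon_tensor_snd q hp.2]
    exact shannon_congr hP.1 fun ω ω' => by simp
  rw [e1, e2, e3, shannon_const, hP.2, negMulLog_one] at h
  linarith

theorem conv_comm (p q : V → ℝ) : conv p q = conv q p :=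
  law_of_equiv (Equiv.prodComm _ _) (fun _ => mul_comm _ _) (fun _ => add_comm _ _)

theorem sumEnt_le_sumEnt_conv {p q r : V → ℝ} (hp : p ∈ stdSimplex ℝ V) (hq : q ∈ stdSimplex ℝ V)
    (hr : r ∈ stdSimplex ℝ V) : sumEnt p r ≤ sumEnt p (conv q r) := by
  have h := shannon_le_sumEnt (conv_mem_stdSimplex hp hr) hq
  rw [shannon_conv] at h
  refine h.trans (le_of_eq ?_)
  have e1 : sumEnt (conv p r) q = shannon (tensor (tensor p r) q) (fun v => v.1.1 + v.1.2 + v.2) := by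
    conv_lhs => rw [sumEnt, conv, ← law_self q, shannon_tensor_law]
  have e2 : sumEnt p (conv q r) = shannon (tensor p (tensor q r)) (fun v => v.1 + (v.2.1 + v.2.2)) := by
    conv_lhs => rw [sumEnt, conv, ← law_self p, shannon_tensor_law]
  rw [e1, e2]
  refine shannon_of_equiv ((Equiv.prodAssoc _ _ _).trans
    (Equiv.prodCongr (Equiv.refl _) (Equiv.prodComm _ _))) (fun v => ?_) (fun v => ?_)
  · simp only [tensor, Equiv.trans_apply, Equiv.prodAssoc_apply, Equiv.prodCongr_apply,
      Equiv.coe_refl, Prod.map_apply, Equiv.prodComm_apply, Prod.swap_prod_mk, id]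
    ring
  · simp only [Equiv.trans_apply, Equiv.prodAssoc_apply, Equiv.prodCongr_apply,
      Equiv.coe_refl, Prod.map_apply, Equiv.prodComm_apply, Prod.swap_prod_mk, id]
    abel

/-- The Ruzsa triangle inequality, for sums. -/
theorem sumEnt_triangle {p q r : V → ℝ} (hp : p ∈ stdSimplex ℝ V) (hq : q ∈ stdSimplex ℝ V)
    (hr : r ∈ stdSimplex ℝ V) : sumEnt p r + shannon q id ≤ sumEnt p q + sumEnt q r :=
  (add_le_add_left (sumEnt_le_sumEnt_conv hp hq hr) _).trans (sumEnt_conv_le hp hq hr)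

section Min

variable {p₀ : Ω → ℝ} {X₀ : Ω → V} {A₀ : Ω → S} {η t : ℝ}

theorem refDist_conv_le (hp₀ : p₀ ∈ stdSimplex ℝ Ω) {q r : V → ℝ} (hq : q ∈ stdSimplex ℝ V)
    (hr : r ∈ stdSimplex ℝ V) :
    refDist p₀ X₀ A₀ (conv q r) ≤ refDist p₀ X₀ A₀ q + (sumEnt q r - shannon q id) / 2 := by
  have h := shannon_kaimanovich_vershik hp₀ hq hr X₀ A₀
  have hc := conv_mem_stdSimplex hq hr
  rw [refDist, refDist, cond_triv hc.1, cond_triv hq.1, hc.2, hq.2, shannon_conv, negMulLog_one]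
  simp only [cond]
  rw [shannon_tensor_fst _ hc.2, shannon_tensor_fst _ hq.2]
  linarith

theorem tau_eq {p q : V → ℝ} (hp : p ∈ stdSimplex ℝ V) (hq : q ∈ stdSimplex ℝ V) :
    tau p₀ X₀ A₀ η p q = sumEnt p q - (shannon p id + shannon q id) / 2 +
      η * (refDist p₀ X₀ A₀ p + refDist p₀ X₀ A₀ q) := by
  have hP := tensor_mem_stdSimplex hp hq
  rw [tau, rdist, cond_triv hP.1, cond_triv hp.1, cond_triv hq.1, hP.2, hp.2, hq.2, negMulLog_one,
    sumEnt]
  ring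

theorem IsLowerTau.le_sumEnt (h : IsLowerTau p₀ X₀ A₀ η t) {p q : V → ℝ}
    (hp : p ∈ stdSimplex ℝ V) (hq : q ∈ stdSimplex ℝ V) :
    t ≤ sumEnt p q - (shannon p id + shannon q id) / 2 +
      η * (refDist p₀ X₀ A₀ p + refDist p₀ X₀ A₀ q) :=
  (h p hp q hq).trans_eq (tau_eq hp hq)

end Min

section Min

variable {p₀ : Ω → ℝ} {X₀ : Ω → V} {A₀ : Ω → S} {η t : ℝ}

theorem shannon_fst_sum {a c : V → ℝ} (ha : a ∈ stdSimplex ℝ V) (hc : c ∈ stdSimplex ℝ V) :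
    shannon (tensor a c) (fun v => (v.1, v.1 + v.2)) = shannon a id + shannon c id := by
  rw [← shannon_indep ha hc]
  refine shannon_congr (tensor_mem_stdSimplex ha hc).1 fun ω ω' => ?_
  simp only [Prod.mk.injEq, id]
  grind

theorem condRefDist_fst_sum_le (hp₀ : p₀ ∈ stdSimplex ℝ Ω) {a c : V → ℝ}
    (ha : a ∈ stdSimplex ℝ V) (hc : c ∈ stdSimplex ℝ V) :
    condRefDist p₀ X₀ A₀ (tensor a c) (fun v => v.1) (fun v => v.1 + v.2) ≤
      refDist p₀ X₀ A₀ a + (sumEnt a c - shannon c id) / 2 := by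
  have hP := tensor_mem_stdSimplex ha hc
  have h := condRefDist_le (X₀ := X₀) (A₀ := A₀) hp₀.1 hP.1 hP.2 (fun v => v.1) (fun v => v.1 + v.2)
  rw [law_tensor_fst a hc.2 (fun v => v), law_self, shannon_fst_sum ha hc,
    shannon_tensor_fst a hc.2 (fun v => v)] at h
  refine h.trans (le_of_eq ?_)
  rw [sumEnt]
  change _ + (shannon a id + _ - _) / 2 = _
  ring

theorem IsLowerTau.le_fiber (h : IsLowerTau p₀ X₀ A₀ η t) (hη : 0 ≤ η)
    (hp₀ : p₀ ∈ stdSimplex ℝ Ω) {a b c d : V → ℝ} (ha : a ∈ stdSimplex ℝ V)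
    (hb : b ∈ stdSimplex ℝ V) (hc : c ∈ stdSimplex ℝ V) (hd : d ∈ stdSimplex ℝ V) :
    t ≤ shannon (tensor (tensor a c) (tensor b d))
        (fun v => (v.1.1 + v.2.1, v.1.1 + v.1.2, v.2.1 + v.2.2)) -
      (shannon a id + shannon b id + shannon c id + shannon d id) / 2 -
      (sumEnt a c + sumEnt b d) / 2 +
      η * (refDist p₀ X₀ A₀ a + refDist p₀ X₀ A₀ b +
        (sumEnt a c - shannon c id + (sumEnt b d - shannon d id)) / 2) := by
  have hac := tensor_mem_stdSimplex ha hc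
  have hbd := tensor_mem_stdSimplex hb hd
  have h1 := h.le_cond hac.1 hac.2 hbd.1 hbd.2 (fun v => v.1) (fun v => v.1 + v.2)
    (fun v => v.1) (fun v => v.1 + v.2)
  have h2 := condRefDist_fst_sum_le (X₀ := X₀) (A₀ := A₀) hp₀ ha hc
  have h3 := condRefDist_fst_sum_le (X₀ := X₀) (A₀ := A₀) hp₀ hb hd
  simp only [cond, shannon_fst_sum ha hc, shannon_fst_sum hb hd] at h1
  rw [shannon_indep hac hbd (fun v => v.1 + v.2) (fun v => v.1 + v.2), ← sumEnt, ← sumEnt] at h1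
  have h4 := mul_le_mul_of_nonneg_left (add_le_add h2 h3) hη
  refine h1.trans ((add_le_add le_rfl h4).trans (le_of_eq ?_))
  ring

/-- Rearranging `((x₁, x₃), (x₂, x₄))` to `((x₁, x₂), (x₃, x₄))`. -/
theorem shannon_tensor_comm (a b c d : V → ℝ) (f : (V × V) × (V × V) → R) :
    shannon (tensor (tensor a c) (tensor b d)) (fun v => f ((v.1.1, v.2.1), (v.1.2, v.2.2))) =
      shannon (tensor (tensor a b) (tensor c d)) f :=
  shannon_of_equiv (Equiv.prodProdProdComm _ _ _ _)
    (fun v => by simp only [tensor, Equiv.prodProdProdComm_apply]; ring) (fun v => rfl)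

/-- The entropic Balog-Szemerédi-Gowers estimate for a triple `u, v, u + v`, relative to `s`. -/
theorem shannon_coupling_sum_le (h2 : ∀ v : V, v + v = 0) {q : V × V × V → ℝ}
    (hq : q ∈ stdSimplex ℝ (V × V × V)) :
    shannon (coupling q (fun v => (v.1 + v.2.1, v.2.2)))
        (fun w => (w.1.1 + w.2.1, (w.1.1 + w.1.2.1, w.1.2.2))) ≤
      2 * shannon q (fun v => (v.1, v.2.2)) + 2 * shannon q (fun v => (v.2.1, v.2.2)) -
        3 * shannon q (fun v => v.2.2) - 2 * shannon q id +
        2 * shannon q (fun v => (v.1 + v.2.1, v.2.2)) := by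
  set Z : V × V × V → V × V := fun v => (v.1 + v.2.1, v.2.2) with hZ
  set Q := coupling q Z with hQ
  have hQ0 : 0 ≤ Q := coupling_nonneg hq.1 Z
  have supp : ∀ w, Q w ≠ 0 → Z w.1 = Z w.2 := by
    intro w hw
    by_contra hne
    exact hw (by simp [hQ, coupling, hne])
  have hall : shannon Q (fun w => w) = 2 * shannon q id - shannon q Z := by
    have e := cond_coupling hq.1 Z id
    rw [← hQ] at e
    simp only [cond, id] at e
    rw [shannon_coupling_fst hq.1 Z Z] at e
    rw [shannon_congr hQ0 (Y := fun w => w), shannon_congr hq.1 (X := fun v => (v, Z v)) (Y := id)]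
      at e
    · linarith
    · intro v v'; simp only [Prod.mk.injEq, id]; grind
    · intro w w'; simp only [Prod.ext_iff]; grind
  have a1 := shannon_submodular hQ0 (fun w => w.1.1 + w.2.2.1) (fun w => w.1.1 + w.1.2.1)
    (fun w => w.1.2.2)
  have a2 := shannon_submodular hQ0 (fun w => w.1.1) (fun w => w.1.2.1)
    (fun w => (w.1.1 + w.2.2.1, w.1.2.2))
  have a3 := shannon_submodular hQ0 (fun w => w.1.1) (fun w => w.2.2.1) (fun w => w.1.2.2)
  have a4 := shannon_submodular hQ0 (fun w => w.1.2.1) (fun w => w.2.1) (fun w => w.1.2.2)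
  have e1 : shannon Q (fun w => (w.1.1 + w.2.1, (w.1.1 + w.1.2.1, w.1.2.2))) =
      shannon Q (fun w => (w.1.1 + w.2.2.1, (w.1.1 + w.1.2.1, w.1.2.2))) := by
    have sum_eq : ∀ w, Q w ≠ 0 → w.1.1 + w.2.2.1 = w.1.1 + w.2.1 + (w.1.1 + w.1.2.1) := by
      intro w hw
      have e := congrArg Prod.fst (supp w hw)
      simp only [hZ] at e
      rw [e, add_assoc, ← add_assoc w.2.1, h2, zero_add]
    refine shannon_congr_support hQ0 fun w w' hw hw' => ?_
    simp only [sum_eq w hw, sum_eq w' hw', Prod.mk.injEq]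
    constructor
    · rintro ⟨a, b, c⟩
      exact ⟨by rw [a, b], b, c⟩
    · rintro ⟨a, b, c⟩
      rw [b] at a
      exact ⟨add_right_cancel a, b, c⟩
  have e2 : shannon Q (fun w => (w.1.1, w.1.2.1, (w.1.1 + w.2.2.1, w.1.2.2))) =
      shannon Q (fun w => w) := by
    refine shannon_congr_support hQ0 fun w w' hw hw' => ?_
    have := supp w hw
    have := supp w' hw'
    simp only [hZ, Prod.ext_iff] at *
    grind
  have e3 : shannon Q (fun w => (w.1.1, (w.1.1 + w.2.2.1, w.1.2.2))) =
      shannon Q (fun w => (w.1.1, w.2.2.1, w.1.2.2)) := by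
    refine shannon_congr hQ0 fun w w' => ?_
    simp only [Prod.mk.injEq]
    grind
  have e4 : shannon Q (fun w => (w.1.2.1, (w.1.1 + w.2.2.1, w.1.2.2))) =
      shannon Q (fun w => (w.1.2.1, w.2.1, w.1.2.2)) := by
    refine shannon_congr_support hQ0 fun w w' hw hw' => ?_
    have := supp w hw
    have := supp w' hw'
    have := h2 w.1.2.1
    have := h2 w.2.2.1
    have := h2 w'.1.2.1
    have := h2 w'.2.2.1
    simp only [hZ, Prod.mk.injEq] at *
    grind
  have e5 : shannon Q (fun w => (w.2.2.1, w.1.2.2)) = shannon q (fun v => (v.2.1, v.2.2)) := by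
    rw [← shannon_coupling_snd hq.1 Z]
    refine shannon_congr_support hQ0 fun w w' hw hw' => ?_
    have := supp w hw
    have := supp w' hw'
    simp only [hZ, Prod.mk.injEq] at *
    grind
  have e6 : shannon Q (fun w => (w.2.1, w.1.2.2)) = shannon q (fun v => (v.1, v.2.2)) := by
    rw [← shannon_coupling_snd hq.1 Z]
    refine shannon_congr_support hQ0 fun w w' hw hw' => ?_
    have := supp w hw
    have := supp w' hw'
    simp only [hZ, Prod.mk.injEq] at *
    grind
  have e7 := shannon_coupling_fst hq.1 Z (fun v => (v.1 + v.2.1, v.2.2))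
  have e8 := shannon_coupling_fst hq.1 Z (fun v => (v.1, v.2.2))
  have e9 := shannon_coupling_fst hq.1 Z (fun v => (v.2.1, v.2.2))
  have e10 := shannon_coupling_fst hq.1 Z (fun v => v.2.2)
  rw [← hQ] at e7 e8 e9 e10
  simp only [e2, e3, e4, e5, e6, e7, e8, e9, e10, hall] at a1 a2 a3 a4
  rw [e1]
  linarith

end Min

section Min

variable {p₀ : Ω → ℝ} {X₀ : Ω → V} {A₀ : Ω → S} {η t : ℝ}

theorem sumEnt_law_law {Ω₁ Ω₂ : Type*} [Fintype Ω₁] [Fintype Ω₂] (p : Ω₁ → ℝ) (q : Ω₂ → ℝ)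
    (X : Ω₁ → V) (Y : Ω₂ → V) :
    sumEnt (law p X) (law q Y) = shannon (tensor p q) (fun ω => X ω.1 + Y ω.2) :=
  shannon_tensor_law p q X Y (fun v => v.1 + v.2)

/-- At a minimizer of `tau` the Ruzsa distance of the two components vanishes. -/
theorem IsLowerTau.sumEnt_le (h2 : ∀ v : V, v + v = 0) (h : IsLowerTau p₀ X₀ A₀ (1 / 138) t)
    (hp₀ : p₀ ∈ stdSimplex ℝ Ω) {p q : V → ℝ} (hp : p ∈ stdSimplex ℝ V) (hq : q ∈ stdSimplex ℝ V)
    (ht : tau p₀ X₀ A₀ (1 / 138) p q ≤ t) :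
    sumEnt p q ≤ (shannon p id + shannon q id) / 2 := by
  have hpq := tensor_mem_stdSimplex hp hq
  have hP := tensor_mem_stdSimplex hpq hpq
  set P := tensor (tensor p q) (tensor p q) with hPdef
  rw [tau_eq hp hq] at ht
  set s := shannon P (fun v => v.1.1 + v.1.2 + (v.2.1 + v.2.2)) with hs
  set J := shannon P (fun v => (v.1.1 + v.1.2, v.2.1 + v.1.2, v.1.1 + v.1.2 + (v.2.1 + v.2.2)))
    with hJ
  -- the entropies of the various pairs of sums
  have sU : shannon P (fun v => (v.1.1 + v.1.2, v.1.1 + v.1.2 + (v.2.1 + v.2.2))) =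
      2 * sumEnt p q := by
    have e := shannon_indep hpq hpq (fun v => v.1 + v.2) (fun v => v.1 + v.2)
    rw [← sumEnt] at e
    rw [two_mul, ← e]
    refine shannon_congr hP.1 fun v v' => ?_
    simp only [Prod.mk.injEq]
    grind
  have sV : shannon P (fun v => (v.2.1 + v.1.2, v.1.1 + v.1.2 + (v.2.1 + v.2.2))) =
      2 * sumEnt p q := by
    have e := shannon_indep hpq hpq (fun v => v.1 + v.2) (fun v => v.1 + v.2)
    rw [← sumEnt] at e
    rw [two_mul, ← e]
    let φ : (V × V) × (V × V) ≃ (V × V) × (V × V) :=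
      ⟨fun v => ((v.2.1, v.1.2), (v.1.1, v.2.2)), fun v => ((v.2.1, v.1.2), (v.1.1, v.2.2)),
        fun _ => rfl, fun _ => rfl⟩
    rw [← shannon_of_equiv (p := P) (q := P)
      (X := fun v => (v.2.1 + v.1.2, v.1.1 + v.2.2))
      (Y := fun v => (v.1.1 + v.1.2, v.2.1 + v.2.2)) φ
      (fun v => by simp only [φ, hPdef, tensor, Equiv.coe_fn_mk]; ring) (fun v => rfl)]
    refine shannon_congr hP.1 fun v v' => ?_
    simp only [Prod.mk.injEq]
    grind
  have sW : shannon P (fun v => (v.1.1 + v.2.1, v.1.1 + v.1.2 + (v.2.1 + v.2.2))) =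
      sumEnt p p + sumEnt q q := by
    have e := shannon_indep (tensor_mem_stdSimplex hp hp) (tensor_mem_stdSimplex hq hq)
      (fun v => v.1 + v.2) (fun v => v.1 + v.2)
    rw [← sumEnt, ← sumEnt, shannon_tensor_comm p q p q
      (fun v => (v.1.1 + v.2.1, v.1.2 + v.2.2)), ← hPdef] at e
    rw [← e]
    refine shannon_congr hP.1 fun v v' => ?_
    simp only [Prod.mk.injEq]
    grind
  have sConv : sumEnt (conv p q) (conv p q) = s := sumEnt_law_law _ _ _ _
  have sConv' : sumEnt (conv p p) (conv q q) = s := by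
    rw [conv, conv, sumEnt_law_law, hs, hPdef, ← shannon_tensor_comm]
    refine congrArg _ (funext fun v => ?_)
    dsimp only
    abel
  have hs_le : s ≤ 3 * sumEnt p q - shannon p id - shannon q id := by
    have hc := conv_mem_stdSimplex hp hq
    have e1 := sumEnt_conv_le hc hq hp
    have e2 := sumEnt_conv_le hq hp hq
    rw [conv_comm q p, sConv, sumEnt_comm (conv p q) q, sumEnt_comm q p] at e1
    rw [sumEnt_comm q p] at e2
    linarith
  -- the fibring inequalities
  have i1 := h.le_sumEnt (conv_mem_stdSimplex hp hq) (conv_mem_stdSimplex hp hq)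
  have i2 := h.le_sumEnt (conv_mem_stdSimplex hp hp) (conv_mem_stdSimplex hq hq)
  have f1 := h.le_fiber (by norm_num) hp₀ hp hq hq hp
  have f2 := h.le_fiber (by norm_num) hp₀ hp hq hp hq
  have eJ1 : shannon (tensor (tensor p q) (tensor q p))
      (fun v => (v.1.1 + v.2.1, v.1.1 + v.1.2, v.2.1 + v.2.2)) = J := by
    let φ : (V × V) × (V × V) ≃ (V × V) × (V × V) :=
      ⟨fun v => ((v.1.1, v.2.1), (v.2.2, v.1.2)), fun v => ((v.1.1, v.2.2), (v.1.2, v.2.1)),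
        fun _ => rfl, fun _ => rfl⟩
    rw [shannon_of_equiv (p := tensor (tensor p q) (tensor q p)) (q := P)
      (X := fun v => (v.1.1 + v.2.1, v.1.1 + v.1.2, v.2.1 + v.2.2))
      (Y := fun v => (v.1.1 + v.1.2, v.1.1 + v.2.2, v.1.2 + v.2.1)) φ
      (fun v => by simp only [φ, hPdef, tensor, Equiv.coe_fn_mk]; ring) (fun v => rfl), hJ]
    refine shannon_congr hP.1 fun v v' => ?_
    simp only [Prod.mk.injEq]
    grind
  have eJ2 : shannon (tensor (tensor p p) (tensor q q))
      (fun v => (v.1.1 + v.2.1, v.1.1 + v.1.2, v.2.1 + v.2.2)) = J := by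
    rw [← shannon_tensor_comm, ← hPdef, hJ]
    have e : ∀ x y z : V, x + z = x + y + (z + y) := fun x y z => by
      rw [add_add_add_comm, h2, add_zero]
    have e' : ∀ x y z w : V, x + y + (z + w) = x + y + (z + y) + (y + w) := fun x y z w => by
      rw [← e]; abel
    refine shannon_congr hP.1 fun v v' => ?_
    simp only [Prod.mk.injEq, e v.1.1 v.1.2 v.2.1, e v'.1.1 v'.1.2 v'.2.1,
      e' v.1.1 v.1.2 v.2.1 v.2.2, e' v'.1.1 v'.1.2 v'.2.1 v'.2.2]
    constructor
    · rintro ⟨a, b, c⟩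
      rw [a] at b
      exact ⟨a, add_left_cancel b, by rw [a, c, add_left_cancel b]⟩
    · rintro ⟨a, b, c⟩
      rw [a, b] at c
      exact ⟨a, by rw [a, b], add_left_cancel c⟩
  have c1 := refDist_conv_le (X₀ := X₀) (A₀ := A₀) hp₀ hp hq
  have c2 := refDist_conv_le (X₀ := X₀) (A₀ := A₀) hp₀ hq hp
  have c3 := refDist_conv_le (X₀ := X₀) (A₀ := A₀) hp₀ hp hp
  have c4 := refDist_conv_le (X₀ := X₀) (A₀ := A₀) hp₀ hq hq
  have t1 := sumEnt_triangle hp hq hp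
  have t2 := sumEnt_triangle hq hp hq
  rw [conv_comm q p] at c2
  rw [shannon_conv, sConv] at i1
  rw [shannon_conv, shannon_conv, sConv'] at i2
  rw [eJ1] at f1
  rw [eJ2] at f2
  rw [sumEnt_comm q p] at c2 t1 t2 f1
  -- the endgame
  set ρ := law P (fun v => (v.1.1 + v.1.2, v.2.1 + v.1.2, v.1.1 + v.1.2 + (v.2.1 + v.2.2))) with hρ
  have hρm : ρ ∈ stdSimplex ℝ (V × V × V) := law_mem_stdSimplex hP _
  have g1 := h.le_coupling hρm.1 hρm.2 (fun v => v.1) (fun v => (v.1 + v.2.1, v.2.2))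
  have g2 := shannon_coupling_sum_le h2 hρm
  have g3 := condRefDist_le (X₀ := X₀) (A₀ := A₀) hp₀.1 hρm.1 hρm.2 (fun v => v.1)
    (fun v => (v.1 + v.2.1, v.2.2))
  have eW : shannon ρ (fun v => (v.1 + v.2.1, v.2.2)) = sumEnt p p + sumEnt q q := by
    rw [hρ, shannon_law, ← sW]
    refine shannon_congr hP.1 fun v v' => ?_
    have e : ∀ x y z : V, x + y + (z + y) = x + z := fun x y z => by
      rw [add_add_add_comm, h2, add_zero]
    simp only [e]
  have eU : shannon ρ (fun v => (v.1, v.2.2)) = 2 * sumEnt p q := by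
    rw [hρ, shannon_law, sU]
  have eV : shannon ρ (fun v => (v.2.1, v.2.2)) = 2 * sumEnt p q := by
    rw [hρ, shannon_law, sV]
  have eS : shannon ρ (fun v => v.2.2) = s := by rw [hρ, shannon_law]
  have eId : shannon ρ id = J := by rw [hρ, shannon_law]; rfl
  have eUW : shannon ρ (fun v => (v.1, (v.1 + v.2.1, v.2.2))) = J := by
    rw [← eId]
    refine shannon_congr hρm.1 fun v v' => ?_
    simp only [id, Prod.ext_iff]
    grind
  have eLaw : law ρ (fun v => v.1) = conv p q := by
    rw [hρ, law_law]
    exact law_tensor_fst (tensor p q) hpq.2 (fun v => v.1 + v.2)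
  have eFst : shannon ρ (fun v => v.1) = sumEnt p q := by
    rw [← shannon_conv, ← eLaw, shannon_law ρ]
    rfl
  have eCpl := shannon_coupling_fst hρm.1 (fun v => (v.1 + v.2.1, v.2.2))
    (fun v => (v.1 + v.2.1, v.2.2))
  simp only [cond, eCpl, eUW, eW] at g1
  rw [eLaw, eFst, eW, eUW] at g3
  rw [eU, eV, eS, eId, eW] at g2
  linarith

end Min

theorem continuous_shannon {E : Type*} [TopologicalSpace E] {f : E → Ω → ℝ} (hf : Continuous f)
    (X : Ω → S) : Continuous fun x => shannon (f x) X := by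
  classical
  unfold shannon law
  refine continuous_finsetSum _ fun s _ => continuous_negMulLog.comp
    (continuous_finsetSum _ fun ω _ => ?_)
  split_ifs
  · exact (continuous_apply ω).comp hf
  · exact continuous_const

theorem continuous_tensor {E : Type*} [TopologicalSpace E] {f : E → Ω → ℝ} {g : E → Ω' → ℝ}
    (hf : Continuous f) (hg : Continuous g) : Continuous fun x => tensor (f x) (g x) := by
  unfold tensor
  fun_prop

theorem continuous_cond {E : Type*} [TopologicalSpace E] {f : E → Ω → ℝ} (hf : Continuous f)
    (X : Ω → S) (C : Ω → T) : Continuous fun x => cond (f x) X C :=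
  (continuous_shannon hf _).sub (continuous_shannon hf _)

theorem continuous_refDist (p₀ : Ω → ℝ) (X₀ : Ω → V) (A₀ : Ω → S) :
    Continuous fun μ => refDist p₀ X₀ A₀ μ := by
  have h1 : Continuous fun μ : V → ℝ => ∑ v, μ v := by fun_prop
  exact (continuous_cond (continuous_tensor continuous_const continuous_id) _ _).sub
    (((h1.mul continuous_const).add (continuous_cond continuous_id _ _)).div_const 2)

theorem continuous_tau (p₀ : Ω → ℝ) (X₀ : Ω → V) (A₀ : Ω → S) (η : ℝ) :
    Continuous fun μ : (V → ℝ) × (V → ℝ) => tau p₀ X₀ A₀ η μ.1 μ.2 := by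
  have h1 : Continuous fun μ : (V → ℝ) × (V → ℝ) => ∑ v, μ.1 v := by fun_prop
  have h2 : Continuous fun μ : (V → ℝ) × (V → ℝ) => ∑ v, μ.2 v := by fun_prop
  have h3 := continuous_refDist p₀ X₀ A₀
  have h4 := continuous_cond (S := V) (Ω := V) continuous_id id (triv V)
  exact ((continuous_cond (continuous_tensor continuous_fst continuous_snd) _ _).sub
    (((h2.mul (h4.comp continuous_fst)).add (h1.mul (h4.comp continuous_snd))).div_const 2)).add
    (continuous_const.mul
      ((h2.mul (h3.comp continuous_fst)).add (h1.mul (h3.comp continuous_snd))))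

theorem exists_isLowerTau (p₀ : Ω → ℝ) (X₀ : Ω → V) (A₀ : Ω → S) (η : ℝ) :
    ∃ p ∈ stdSimplex ℝ V, ∃ q ∈ stdSimplex ℝ V,
      IsLowerTau p₀ X₀ A₀ η (tau p₀ X₀ A₀ η p q) := by
  classical
  have hne : (stdSimplex ℝ V).Nonempty := ⟨_, single_mem_stdSimplex ℝ (0 : V)⟩
  obtain ⟨μ, hμ, h⟩ :=
    ((isCompact_stdSimplex ℝ V).prod (isCompact_stdSimplex ℝ V)).exists_isMinOn (hne.prod hne)
      (continuous_tau p₀ X₀ A₀ η).continuousOn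
  exact ⟨μ.1, hμ.1, μ.2, hμ.2, fun ν hν ρ hρ => isMinOn_iff.1 h (ν, ρ) ⟨hν, hρ⟩⟩

/-- There are two weights at Ruzsa distance zero from each other, both near `X₀ | A₀`. -/
theorem exists_sumEnt_le (h2 : ∀ v : V, v + v = 0) {p₀ : Ω → ℝ} (hp₀ : p₀ ∈ stdSimplex ℝ Ω)
    (X₀ : Ω → V) (A₀ : Ω → S) :
    ∃ p ∈ stdSimplex ℝ V, ∃ q ∈ stdSimplex ℝ V,
      sumEnt p q ≤ (shannon p id + shannon q id) / 2 ∧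
      refDist p₀ X₀ A₀ p + refDist p₀ X₀ A₀ q ≤
        140 * (cond (tensor p₀ p₀) (fun ω => X₀ ω.1 + X₀ ω.2) (fun ω => (A₀ ω.1, A₀ ω.2)) -
          cond p₀ X₀ A₀) := by
  obtain ⟨p, hp, q, hq, h⟩ := exists_isLowerTau p₀ X₀ A₀ (1 / 138)
  refine ⟨p, hp, q, hq, h.sumEnt_le h2 hp₀ hp hq le_rfl, ?_⟩
  have h3 := h.le_cond hp₀.1 hp₀.2 hp₀.1 hp₀.2 X₀ A₀ X₀ A₀
  rw [condRefDist_eq hp₀.1 hp₀.2, tau_eq hp hq] at h3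
  have h4 := shannon_le_sumEnt hp hq
  have h5 := shannon_le_sumEnt hq hp
  rw [sumEnt_comm] at h5
  linarith

theorem conv_apply (p q : V → ℝ) (x : V) : conv p q x = ∑ y, p y * q (x - y) := by
  classical
  rw [conv, law, Fintype.sum_prod_type]
  refine Finset.sum_congr rfl fun y _ => ?_
  rw [Finset.sum_eq_single (x - y)]
  · simp [tensor]
  · intro z _ hz
    rw [if_neg]
    rintro rfl
    simp at hz
  · simp

theorem shannon_id (p : V → ℝ) : shannon p id = ∑ v, negMulLog (p v) := by
  rw [shannon]
  exact congrArg (fun q : V → ℝ => ∑ v, negMulLog (q v)) (law_self p)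

/-- Equality in the Jensen inequality for the entropy of `p * p`. -/
theorem apply_sub_eq_conv {p : V → ℝ} (hp : p ∈ stdSimplex ℝ V)
    (h : sumEnt p p ≤ shannon p id) (x y : V) (hy : p y ≠ 0) : p (x - y) = conv p p x := by
  have jensen : ∀ x, ∑ y, p y * negMulLog (p (x - y)) ≤ negMulLog (conv p p x) := by
    intro x
    rw [conv_apply]
    exact concaveOn_negMulLog.le_map_sum (fun y _ => hp.1 y) hp.2 (fun y _ => hp.1 _)
  have hsum : ∑ x, ∑ y, p y * negMulLog (p (x - y)) = shannon p id := by
    rw [Finset.sum_comm]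
    simp only [← Finset.mul_sum]
    have : ∀ y, ∑ x, negMulLog (p (x - y)) = shannon p id := fun y => by
      rw [shannon_id]
      exact (Equiv.subRight y).sum_comp (fun x => negMulLog (p x))
    simp only [this, ← Finset.sum_mul, hp.2, one_mul]
  rw [← shannon_conv, shannon_id (conv p p), ← hsum] at h
  have heq := (Finset.sum_eq_sum_iff_of_le fun x _ => jensen x).1
    (le_antisymm (Finset.sum_le_sum fun x _ => jensen x) h) x (Finset.mem_univ x)
  rw [conv_apply] at heq ⊢
  exact ((strictConcaveOn_negMulLog.map_sum_eq_iff' (fun y _ => hp.1 y) hp.2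
    (fun y _ => hp.1 _)).1 heq.symm y (Finset.mem_univ y) hy)

/-- The uniform weight on the coset `y + K`. -/
noncomputable def unif [Module (ZMod 2) V] (K : Submodule (ZMod 2) V) (y : V) (v : V) : ℝ :=
  open Classical in if v - y ∈ K then (Nat.card K : ℝ)⁻¹ else 0

theorem sum_unif [Module (ZMod 2) V] (K : Submodule (ZMod 2) V) (y : V) :
    ∑ v, unif K y v = 1 := by
  classical
  have hc : (Nat.card K : ℝ) ≠ 0 := by exact_mod_cast Nat.card_pos.ne'
  rw [← Equiv.sum_comp (Equiv.addRight y)]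
  simp only [unif, Equiv.coe_addRight, add_sub_cancel_right, Finset.sum_ite, Finset.sum_const_zero,
    add_zero, Finset.sum_const, nsmul_eq_mul]
  rw [← Fintype.card_subtype, ← Nat.card_eq_fintype_card]
  exact mul_inv_cancel₀ hc

theorem exists_eq_unif [Module (ZMod 2) V] {p : V → ℝ} (hp : p ∈ stdSimplex ℝ V)
    (h : sumEnt p p ≤ shannon p id) : ∃ K : Submodule (ZMod 2) V, ∃ y, p = unif K y := by
  classical
  obtain ⟨y₀, hy₀⟩ : ∃ y, p y ≠ 0 := by
    by_contra! hc
    simpa [hc] using hp.2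
  let A : AddSubgroup V :=
    { carrier := {v | ∀ x, p (x + v) = p x}
      zero_mem' := fun x => by rw [add_zero]
      add_mem' := fun {a b} ha hb x => by rw [← add_assoc, hb, ha]
      neg_mem' := fun {a} ha x => by rw [← ha, neg_add_cancel_right] }
  have hA : ∀ v, v ∈ A ↔ ∀ x, p (x + v) = p x := fun v => Iff.rfl
  refine ⟨AddSubgroup.toZModSubmodule 2 A, y₀, ?_⟩
  have hmem : ∀ v, v - y₀ ∈ AddSubgroup.toZModSubmodule 2 A ↔ p v ≠ 0 := by
    intro v
    rw [AddSubgroup.mem_toZModSubmodule, hA]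
    constructor
    · intro hv
      have := hv y₀
      rw [add_sub_cancel] at this
      rwa [this]
    · intro hv x
      have e1 := apply_sub_eq_conv hp h (x + v) v hv
      have e2 := apply_sub_eq_conv hp h (x + v) y₀ hy₀
      rw [add_sub_cancel_right] at e1
      rw [← add_sub_assoc, e1, e2]
  have hval : ∀ v, p v ≠ 0 → p v = p y₀ := by
    intro v hv
    have := (hmem v).2 hv
    rw [AddSubgroup.mem_toZModSubmodule, hA] at this
    simpa using this y₀
  set K := AddSubgroup.toZModSubmodule 2 A
  have hp' : ∀ v, p v = p y₀ * Nat.card K * unif K y₀ v := by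
    intro v
    have hc : (Nat.card K : ℝ) ≠ 0 := by exact_mod_cast Nat.card_pos.ne'
    by_cases hv : p v = 0
    · have : v - y₀ ∉ K := fun hn => (hmem v).1 hn hv
      simp [unif, this, hv]
    · simp only [unif, if_pos ((hmem v).2 hv), hval v hv]
      field_simp
  have h1 : p y₀ * Nat.card K = 1 := by
    have := hp.2
    rwa [Finset.sum_congr rfl fun v _ => hp' v, ← Finset.mul_sum, sum_unif, mul_one] at this
  ext v
  rw [hp', h1, one_mul]

theorem unif_mem_stdSimplex [Module (ZMod 2) V] (K : Submodule (ZMod 2) V) (y : V) :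
    unif K y ∈ stdSimplex ℝ V :=
  ⟨fun v => by unfold unif; split_ifs <;> positivity, sum_unif K y⟩

theorem mem_of_unif_ne_zero [Module (ZMod 2) V] {K : Submodule (ZMod 2) V} {y v : V}
    (h : unif K y v ≠ 0) : v - y ∈ K := by
  by_contra hn
  simp [unif, hn] at h

theorem shannon_unif [Module (ZMod 2) V] (K : Submodule (ZMod 2) V) (y : V) :
    shannon (unif K y) id = log (Nat.card K) := by
  rw [shannon_id]
  have : ∀ v, negMulLog (unif K y v) = unif K y v * log (Nat.card K) := by
    intro v
    by_cases h : v - y ∈ K <;> simp [unif, h, negMulLog]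
  simp only [this, ← Finset.sum_mul, sum_unif, one_mul]

noncomputable instance [Module (ZMod 2) V] (K : Submodule (ZMod 2) V) : Fintype (V ⧸ K) :=
  Fintype.ofFinite _

/-- The entropy of `(X mod K, A)`. -/
noncomputable def quotEnt [Module (ZMod 2) V] (p : Ω → ℝ) (X : Ω → V) (A : Ω → S)
    (K : Submodule (ZMod 2) V) : ℝ :=
  shannon p (fun ω => (K.mkQ (X ω), A ω))

theorem shannon_add_unif [Module (ZMod 2) V] {p : Ω → ℝ} (hp : p ∈ stdSimplex ℝ Ω) (X : Ω → V)
    (A : Ω → S) (K : Submodule (ZMod 2) V) (y : V) :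
    shannon (tensor p (unif K y)) (fun ω => (X ω.1 + ω.2, A ω.1)) =
      quotEnt p X A K + log (Nat.card K) := by
  classical
  have hc : (Nat.card K : ℝ) ≠ 0 := by exact_mod_cast Nat.card_pos.ne'
  have hlaw : ∀ z a, law (tensor p (unif K y)) (fun ω => (X ω.1 + ω.2, A ω.1)) (z, a) =
      (Nat.card K : ℝ)⁻¹ * law p (fun ω => (K.mkQ (X ω), A ω)) (K.mkQ (z - y), a) := by
    intro z a
    simp only [law, Fintype.sum_prod_type, Finset.mul_sum, Prod.mk.injEq]
    refine Finset.sum_congr rfl fun ω _ => ?_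
    rw [Finset.sum_eq_single (z - X ω)]
    · have : K.mkQ (X ω) = K.mkQ (z - y) ↔ z - X ω - y ∈ K := by
        rw [eq_comm, Submodule.mkQ_apply, Submodule.mkQ_apply, Submodule.Quotient.eq,
          sub_right_comm]
      by_cases h1 : A ω = a <;> by_cases h2 : z - X ω - y ∈ K <;>
        simp [tensor, unif, h1, h2, this, mul_comm, -Submodule.mkQ_apply, -map_sub]
    · intro v _ hv
      rw [if_neg]
      rintro ⟨rfl, -⟩
      simp at hv
    · simp
  have hterm : ∀ ω : Ω × V, tensor p (unif K y) ω *
      -log (law (tensor p (unif K y)) (fun ω => (X ω.1 + ω.2, A ω.1)) (X ω.1 + ω.2, A ω.1)) =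
      tensor p (unif K y) ω *
        (-log (law p (fun ω => (K.mkQ (X ω), A ω)) (K.mkQ (X ω.1), A ω.1)) + log (Nat.card K)) := by
    rintro ⟨ω, v⟩
    by_cases h0 : p ω = 0
    · simp [tensor, h0]
    by_cases h1 : unif K y v = 0
    · simp [tensor, h1]
    have h2 : K.mkQ (X ω + v - y) = K.mkQ (X ω) := by
      rw [Submodule.mkQ_apply, Submodule.mkQ_apply, Submodule.Quotient.eq]
      convert mem_of_unif_ne_zero h1 using 1
      abel
    have h3 : 0 < law p (fun ω => (K.mkQ (X ω), A ω)) (K.mkQ (X ω), A ω) :=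
      ((hp.1 ω).lt_of_ne' h0).trans_le (le_law hp.1 (fun ω => (K.mkQ (X ω), A ω)) ω)
    rw [hlaw, h2, log_mul (inv_ne_zero hc) h3.ne', log_inv]
    ring
  rw [shannon_eq, Finset.sum_congr rfl fun ω _ => hterm ω, quotEnt, shannon_eq]
  simp only [tensor, mul_add, Finset.sum_add_distrib, Fintype.sum_prod_type]
  congr 1
  · refine Finset.sum_congr rfl fun ω _ => ?_
    rw [← Finset.sum_mul, ← Finset.mul_sum, sum_unif, mul_one]
  · simp only [← Finset.sum_mul, ← Finset.mul_sum, sum_unif, mul_one, hp.2, one_mul]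

/-- Up to an additive constant, the distance from `X | A` to the uniform weight on `K`. -/
noncomputable def quotDist [Module (ZMod 2) V] (p : Ω → ℝ) (X : Ω → V) (A : Ω → S)
    (K : Submodule (ZMod 2) V) : ℝ :=
  quotEnt p X A K + log (Nat.card K) / 2

theorem refDist_unif [Module (ZMod 2) V] {p : Ω → ℝ} (hp : p ∈ stdSimplex ℝ Ω) (X : Ω → V)
    (A : Ω → S) (K : Submodule (ZMod 2) V) (y : V) :
    refDist p X A (unif K y) = quotDist p X A K - shannon p A - cond p X A / 2 := by
  have hu := unif_mem_stdSimplex K y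
  rw [refDist, cond_triv hu.1, hu.2, negMulLog_one, shannon_unif, cond, shannon_add_unif hp,
    shannon_tensor_fst p hu.2, quotDist]
  ring

/-- There are two subspaces whose uniform weights are both near `X | A`. -/
theorem exists_quotDist_add_le [Module (ZMod 2) V] {p : Ω → ℝ} (hp : p ∈ stdSimplex ℝ Ω)
    (X : Ω → V) (A : Ω → S) :
    ∃ K L : Submodule (ZMod 2) V,
      quotDist p X A K + quotDist p X A L - 2 * shannon p A - cond p X A ≤
        140 * (cond (tensor p p) (fun ω => X ω.1 + X ω.2) (fun ω => (A ω.1, A ω.2)) -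
          cond p X A) := by
  have h2 : ∀ v : V, v + v = 0 := ZModModule.add_self
  obtain ⟨μ, hμ, ν, hν, hle, hd⟩ := exists_sumEnt_le h2 hp X A
  have h3 := shannon_le_sumEnt hμ hν
  have h4 := shannon_le_sumEnt hν hμ
  have h5 := sumEnt_triangle hμ hν hμ
  have h6 := sumEnt_triangle hν hμ hν
  rw [sumEnt_comm ν μ] at h4 h5 h6
  obtain ⟨K, y, rfl⟩ := exists_eq_unif hμ (by linarith)
  obtain ⟨L, z, rfl⟩ := exists_eq_unif hν (by linarith)
  refine ⟨K, L, ?_⟩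
  rw [refDist_unif hp, refDist_unif hp] at hd
  linarith

section Quot

variable [Module (ZMod 2) V]

theorem log_card_sup_add_log_card_inf (K L : Submodule (ZMod 2) V) :
    log (Nat.card (K ⊔ L : Submodule (ZMod 2) V)) + log (Nat.card (K ⊓ L : Submodule (ZMod 2) V)) =
      log (Nat.card K) + log (Nat.card L) := by
  have e : ∀ K : Submodule (ZMod 2) V,
      log (Nat.card K) = (Module.finrank (ZMod 2) K : ℝ) * log 2 := fun K => by
    rw [Module.natCard_eq_pow_finrank (K := ZMod 2), Nat.card_zmod]
    simp
  rw [e, e, e, e, ← add_mul, ← add_mul]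
  congr 1
  exact_mod_cast Submodule.finrank_sup_add_finrank_inf_eq K L

theorem quotDist_submodular {p : Ω → ℝ} (hp : 0 ≤ p) (X : Ω → V) (A : Ω → S)
    (K L : Submodule (ZMod 2) V) :
    quotDist p X A (K ⊔ L) + quotDist p X A (K ⊓ L) ≤ quotDist p X A K + quotDist p X A L := by
  have h := shannon_submodular hp (fun ω => K.mkQ (X ω)) (fun ω => L.mkQ (X ω))
    (fun ω => ((K ⊔ L).mkQ (X ω), A ω))
  have hc := log_card_sup_add_log_card_inf K L
  have hK : ∀ v w : V, v - w ∈ K → v - w ∈ K ⊔ L := fun v w h => (le_sup_left : K ≤ K ⊔ L) h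
  have hL : ∀ v w : V, v - w ∈ L → v - w ∈ K ⊔ L := fun v w h => (le_sup_right : L ≤ K ⊔ L) h
  have e1 : shannon p (fun ω => (K.mkQ (X ω), L.mkQ (X ω), (K ⊔ L).mkQ (X ω), A ω)) =
      quotEnt p X A (K ⊓ L) := by
    refine shannon_congr hp fun ω ω' => ?_
    simp only [Prod.mk.injEq, Submodule.mkQ_apply, Submodule.Quotient.eq, Submodule.mem_inf]
    have := hK (X ω) (X ω')
    tauto
  have e2 : shannon p (fun ω => (K.mkQ (X ω), (K ⊔ L).mkQ (X ω), A ω)) = quotEnt p X A K := by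
    refine shannon_congr hp fun ω ω' => ?_
    simp only [Prod.mk.injEq, Submodule.mkQ_apply, Submodule.Quotient.eq]
    have := hK (X ω) (X ω')
    tauto
  have e3 : shannon p (fun ω => (L.mkQ (X ω), (K ⊔ L).mkQ (X ω), A ω)) = quotEnt p X A L := by
    refine shannon_congr hp fun ω ω' => ?_
    simp only [Prod.mk.injEq, Submodule.mkQ_apply, Submodule.Quotient.eq]
    have := hL (X ω) (X ω')
    tauto
  rw [e1, e2, e3, ← quotEnt] at h
  simp only [quotDist]
  linarith

/-- `quotDist` has a minimizer that is contained in every other minimizer. -/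
theorem exists_least_quotDist {p : Ω → ℝ} (hp : 0 ≤ p) (X : Ω → V) (A : Ω → S) :
    ∃ K : Submodule (ZMod 2) V, (∀ L, quotDist p X A K ≤ quotDist p X A L) ∧
      ∀ L, quotDist p X A L ≤ quotDist p X A K → K ≤ L := by
  obtain ⟨K₀, hK₀⟩ := Finite.exists_min (quotDist p X A)
  obtain ⟨K, hK⟩ := Set.Finite.exists_minimal
    (s := {K : Submodule (ZMod 2) V | ∀ L, quotDist p X A K ≤ quotDist p X A L})
    (Set.toFinite _) ⟨K₀, hK₀⟩
  refine ⟨K, hK.1, fun L hL => ?_⟩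
  have h := quotDist_submodular hp X A K L
  have h1 := hK.1 (K ⊔ L)
  refine (hK.2 (y := K ⊓ L) (fun M => ?_) inf_le_left).trans inf_le_right
  have := hK.1 M
  linarith

/-- A measure preserving map acting on `X` through a linear involution `M`, up to functions of
`A`, preserves `quotDist`. -/
theorem quotDist_comap_le {p : Ω → ℝ} (hp : 0 ≤ p) {X : Ω → V} {A : Ω → S} (σ : Ω ≃ Ω)
    (hσ : ∀ ω, p (σ ω) = p ω) (M : V →ₗ[ZMod 2] V) (hM : ∀ v, M (M v) = v)
    (hA : ∀ ω ω', A ω = A ω' → A (σ ω) = A (σ ω'))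
    (hX : ∀ ω ω', A ω = A ω' → X (σ ω) - X (σ ω') = M (X ω - X ω'))
    (K : Submodule (ZMod 2) V) : quotDist p X A (K.comap M) ≤ quotDist p X A K := by
  have hle : ∀ K : Submodule (ZMod 2) V, quotEnt p X A K ≤ quotEnt p X A (K.comap M) := by
    intro K
    have e : quotEnt p X A K = shannon p (fun ω => (K.mkQ (X (σ ω)), A (σ ω))) :=
      (shannon_of_equiv σ (fun ω => (hσ ω).symm) (fun ω => rfl)).symm
    rw [e]
    refine shannon_le_of_determines hp fun ω ω' _ _ h => ?_
    simp only [Prod.mk.injEq, Submodule.mkQ_apply, Submodule.Quotient.eq,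
      Submodule.mem_comap] at h ⊢
    exact ⟨by rw [hX _ _ h.2]; exact h.1, hA _ _ h.2⟩
  have hinv : (K.comap M).comap M = K := by
    ext v
    simp [hM]
  have h1 := hle (K.comap M)
  rw [hinv] at h1
  have hcard : Nat.card (K.comap M) = Nat.card K :=
    Nat.card_congr
      { toFun := fun v => ⟨M v, v.2⟩
        invFun := fun v => ⟨M v, by simp [hM]⟩
        left_inv := fun v => by simp [hM]
        right_inv := fun v => by simp [hM] }
  rw [quotDist, quotDist, hcard]
  linarith

theorem quotDist_bot {p : Ω → ℝ} (hp : 0 ≤ p) (X : Ω → V) (A : Ω → S)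
    : quotDist p X A ⊥ = shannon p (fun ω => (X ω, A ω)) := by
  rw [quotDist, quotEnt, Nat.card_unique, Nat.cast_one, log_one, zero_div, add_zero]
  refine shannon_congr hp fun ω ω' => ?_
  simp only [Prod.mk.injEq, Submodule.mkQ_apply, Submodule.Quotient.eq, Submodule.mem_bot,
    sub_eq_zero]

theorem quotDist_top {p : Ω → ℝ} (hp : 0 ≤ p) (X : Ω → V) (A : Ω → S)
    : quotDist p X A ⊤ = shannon p A + log (Fintype.card V) / 2 := by
  rw [quotDist, quotEnt, Nat.card_congr (Equiv.subtypeUnivEquiv fun _ => Submodule.mem_top),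
    Nat.card_eq_fintype_card]
  congr 1
  refine shannon_congr hp fun ω ω' => ?_
  simp only [Prod.mk.injEq, Submodule.mkQ_apply, Submodule.Quotient.eq, Submodule.mem_top,
    true_and]

/-- If the only subspaces of `V` invariant under the symmetries of `X | A` are trivial, then `X | A`
has either small or nearly full entropy in terms of its doubling. -/
theorem min_cond_le {p : Ω → ℝ} (hp : p ∈ stdSimplex ℝ Ω) (X : Ω → V) (A : Ω → S)
    (h : ∀ K : Submodule (ZMod 2) V,
      (∀ M : V →ₗ[ZMod 2] V, (∀ L, quotDist p X A (L.comap M) ≤ quotDist p X A L) →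
        K ≤ K.comap M) → K = ⊥ ∨ K = ⊤) :
    min (cond p X A) (log (Fintype.card V) - cond p X A) ≤
      140 * (cond (tensor p p) (fun ω => X ω.1 + X ω.2) (fun ω => (A ω.1, A ω.2)) -
        cond p X A) := by
  obtain ⟨K, L, hKL⟩ := exists_quotDist_add_le hp X A
  obtain ⟨N, hN, hN'⟩ := exists_least_quotDist hp.1 X A
  have hK := hN K
  have hL := hN L
  rcases h N fun M hM => hN' _ (hM N) with rfl | rfl
  · refine (min_le_left _ _).trans ?_
    rw [quotDist_bot hp.1] at hK hL
    have e : cond p X A = shannon p (fun ω => (X ω, A ω)) - shannon p A := rfl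
    linarith
  · refine (min_le_right _ _).trans ?_
    rw [quotDist_top hp.1] at hK hL
    linarith

end Quot

end FiniteEntropy

section TransformedNoise

variable {m r : ℕ}

theorem wt_comp (x : Idx m) (f : Equiv.Perm (Fin m)) : wt (x ∘ f) = wt x :=
  Finset.card_bijective f f.bijective fun i => by simp

theorem wt_update_one {x : Idx m} {i : Fin m} (hi : x i = 0) :
    wt (Function.update x i 1) = wt x + 1 := by
  have : (Finset.univ.filter fun k => Function.update x i 1 k = 1) =
      insert i (Finset.univ.filter fun k => x k = 1) := by
    ext k
    by_cases hk : k = i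
    · simp [hk]
    · simp [hk]
  rw [wt, this, Finset.card_insert_of_notMem (by simp [hi]), wt]

/-- The index `x` with the coordinates `i` and `j` exchanged. -/
def swapIdx (i j : Fin m) (x : {x : Idx m // wt x = r}) : {x : Idx m // wt x = r} :=
  ⟨x.1 ∘ Equiv.swap i j, (wt_comp _ _).trans x.2⟩

theorem swapIdx_swapIdx (i j : Fin m) (x : {x : Idx m // wt x = r}) :
    swapIdx i j (swapIdx i j x) = x := by
  ext k
  simp [swapIdx]

theorem swapIdx_comm (i j : Fin m) (x : {x : Idx m // wt x = r}) :
    swapIdx i j x = swapIdx j i x := by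
  rw [swapIdx, swapIdx, Subtype.mk.injEq, Equiv.swap_comm]

/-- The elementary operator moving the coordinate `j` of an index to the coordinate `i`. -/
def moveMap (i j : Fin m) :
    ({x : Idx m // wt x = r} → ZMod 2) →ₗ[ZMod 2] ({x : Idx m // wt x = r} → ZMod 2) where
  toFun c x := if x.1 i = 0 ∧ x.1 j = 1 then c (swapIdx i j x) else 0
  map_add' c d := by ext x; simp only [Pi.add_apply]; split_ifs <;> simp
  map_smul' a c := by ext x; simp

theorem moveMap_apply (i j : Fin m) (c : {x : Idx m // wt x = r} → ZMod 2)
    (x : {x : Idx m // wt x = r}) :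
    moveMap i j c x = if x.1 i = 0 ∧ x.1 j = 1 then c (swapIdx i j x) else 0 := rfl

theorem moveMap_moveMap_self (i j : Fin m) (c : {x : Idx m // wt x = r} → ZMod 2) :
    moveMap i j (moveMap i j c) = 0 := by
  ext x
  simp only [moveMap_apply, swapIdx, Function.comp_apply, Equiv.swap_apply_left,
    Equiv.swap_apply_right, Pi.zero_apply]
  split_ifs with h1 h2
  · simp [h1.1] at h2
  · rfl
  · rfl

theorem moveMap_moveMap (i j : Fin m) (c : {x : Idx m // wt x = r} → ZMod 2)
    (x : {x : Idx m // wt x = r}) :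
    moveMap j i (moveMap i j c) x = if x.1 j = 0 ∧ x.1 i = 1 then c x else 0 := by
  simp only [moveMap_apply, swapIdx_comm j i, swapIdx_swapIdx]
  split_ifs with h1 h2
  · rfl
  · simp [swapIdx, h1] at h2
  · rfl

theorem moveMap_single {i j : Fin m} {x : {x : Idx m // wt x = r}} (hi : x.1 i = 1)
    (hj : x.1 j = 0) : moveMap i j (Pi.single x 1) = Pi.single (swapIdx i j x) 1 := by
  ext y
  rw [moveMap_apply]
  by_cases h : y = swapIdx i j x
  · subst h
    rw [swapIdx_swapIdx]
    simp [swapIdx, hi, hj]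
  · have : swapIdx i j y ≠ x := fun e => h (by rw [← e, swapIdx_swapIdx])
    simp [h, this]

theorem eq_one_of_ne_zero {a : ZMod 2} (h : a ≠ 0) : a = 1 := by
  revert a; decide

/-- Two distinct indices of the same weight are separated in both directions. -/
theorem exists_one_zero {x y : {x : Idx m // wt x = r}} (h : x ≠ y) :
    ∃ i, x.1 i = 1 ∧ y.1 i = 0 := by
  by_contra! hc
  refine h (Subtype.ext ?_)
  have hsub : (Finset.univ.filter fun i => x.1 i = 1) ⊆ Finset.univ.filter fun i => y.1 i = 1 := by
    intro i hi
    simp only [Finset.mem_filter, Finset.mem_univ, true_and] at hi ⊢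
    exact eq_one_of_ne_zero (hc i hi)
  have heq := Finset.eq_of_subset_of_card_le hsub (y.2.trans x.2.symm).le
  ext i
  have := Finset.ext_iff.1 heq i
  simp only [Finset.mem_filter, Finset.mem_univ, true_and] at this
  by_cases hx : x.1 i = 1
  · rw [hx, this.1 hx]
  · have hy : ¬ y.1 i = 1 := fun e => hx (this.2 e)
    have h0 : ∀ a : ZMod 2, a ≠ 1 → a = 0 := by decide
    rw [h0 _ hx, h0 _ hy]

theorem exists_comp_eq (x y : {x : Idx m // wt x = r}) :
    ∃ f : Equiv.Perm (Fin m), x.1 ∘ f = y.1 := by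
  have hcard : Fintype.card {k // y.1 k = 1} = Fintype.card {k // x.1 k = 1} := by
    rw [Fintype.card_subtype, Fintype.card_subtype]
    exact y.2.trans x.2.symm
  let e := Fintype.equivOfCardEq hcard
  refine ⟨e.extendSubtype, ?_⟩
  ext k
  have h0 : ∀ a : ZMod 2, a ≠ 1 → a = 0 := by decide
  by_cases hk : y.1 k = 1
  · rw [Function.comp_apply, e.extendSubtype_mem k hk, hk]
  · rw [Function.comp_apply, h0 _ (e.extendSubtype_not_mem k hk), h0 _ hk]

/-- The only subspaces invariant under all the elementary operators are trivial. -/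
theorem eq_bot_or_eq_top (K : Submodule (ZMod 2) ({x : Idx m // wt x = r} → ZMod 2))
    (hK : ∀ i j, i ≠ j → ∀ c ∈ K, moveMap i j c ∈ K) : K = ⊥ ∨ K = ⊤ := by
  classical
  refine or_iff_not_imp_left.2 fun hne => ?_
  obtain ⟨c, hc, hc0⟩ := Submodule.exists_mem_ne_zero_of_ne_bot hne
  obtain ⟨x, hx⟩ := Function.ne_iff.1 hc0
  have isolate : ∀ T : Finset {x : Idx m // wt x = r}, x ∉ T →
      ∃ d ∈ K, d x = 1 ∧ ∀ y ∈ T, d y = 0 := by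
    intro T
    induction T using Finset.induction_on with
    | empty => exact fun _ => ⟨c, hc, eq_one_of_ne_zero hx, by simp⟩
    | insert y T hy ih =>
      intro hxT
      rw [Finset.mem_insert, not_or] at hxT
      obtain ⟨d, hd, hdx, hdT⟩ := ih hxT.2
      obtain ⟨i, hxi, hyi⟩ := exists_one_zero hxT.1
      obtain ⟨j, hyj, hxj⟩ := exists_one_zero (Ne.symm hxT.1)
      have hij : i ≠ j := by
        rintro rfl
        simp [hxi] at hxj
      refine ⟨_, hK j i hij.symm _ (hK i j hij d hd), ?_, ?_⟩
      · rw [moveMap_moveMap, if_pos ⟨hxj, hxi⟩, hdx]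
      · intro z hz
        rw [moveMap_moveMap]
        rcases Finset.mem_insert.1 hz with rfl | hz
        · simp [hyj]
        · simp [hdT z hz]
  obtain ⟨d, hd, hdx, hdT⟩ := isolate (Finset.univ.erase x) (Finset.notMem_erase _ _)
  have hsingle : Pi.single x 1 ∈ K := by
    convert hd
    ext y
    by_cases hy : y = x
    · simp [hy, hdx]
    · simp [hy, hdT y (by simp [hy])]
  have hswap : ∀ i j, ∀ y : {x : Idx m // wt x = r}, Pi.single y 1 ∈ K →
      Pi.single (swapIdx i j y) 1 ∈ K := by
    intro i j y hy
    by_cases hij : y.1 i = y.1 j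
    · convert hy
      refine Subtype.ext (funext fun k => ?_)
      simp only [swapIdx, Function.comp_apply, Equiv.swap_apply_def]
      split_ifs with h1 h2
      · rw [h1, hij]
      · rw [h2, hij]
      · rfl
    · have hne : i ≠ j := fun e => hij (by rw [e])
      have hcases : ∀ a b : ZMod 2, a ≠ b → a = 1 ∧ b = 0 ∨ b = 1 ∧ a = 0 := by decide
      rcases hcases _ _ hij with ⟨h1, h0⟩ | ⟨h1, h0⟩
      · exact moveMap_single h1 h0 ▸ hK i j hne _ hy
      · exact swapIdx_comm j i y ▸ moveMap_single h1 h0 ▸ hK j i hne.symm _ hy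
  have hperm : ∀ f : Equiv.Perm (Fin m), ∀ y : {x : Idx m // wt x = r}, x.1 ∘ f = y.1 →
      Pi.single y 1 ∈ K := by
    intro f
    induction f using Equiv.Perm.swap_induction_on' with
    | one => 
      intro y hy
      rwa [← show x = y from Subtype.ext hy]
    | mul_swap g i j hij ih =>
      intro y hy
      have := hswap i j _ (ih (swapIdx i j y) ?_)
      · rwa [swapIdx_swapIdx] at this
      · ext k
        change x.1 (g k) = y.1 (Equiv.swap i j k)
        rw [← hy]
        simp
  refine eq_top_iff.2 fun v _ => ?_
  rw [← Finset.univ_sum_single v]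
  refine Submodule.sum_mem _ fun y _ => ?_
  obtain ⟨f, hf⟩ := exists_comp_eq x y
  have := K.smul_mem (v y) (hperm f y hf)
  rwa [← Pi.single_smul, smul_eq_mul, mul_one] at this

theorem Gmat_eq_mul {i j : Fin m} (hij : i ≠ j) (x y : Idx m) :
    Gmat m x y = base (x i) (y i) * base (x j) (y j) *
      ∏ k ∈ (Finset.univ.erase i).erase j, base (x k) (y k) := by
  rw [Gmat, mul_assoc, Finset.mul_prod_erase _ (fun k => base (x k) (y k)) (by simp [hij.symm]),
    Finset.mul_prod_erase _ (fun k => base (x k) (y k)) (Finset.mem_univ i)]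

theorem Gmat_update_add {i j : Fin m} (hij : i ≠ j) (x y : Idx m) :
    Gmat m x (Function.update y i (y i + y j)) = Gmat m x y +
      if x i = 0 ∧ x j = 1 then
        Gmat m (x ∘ Equiv.swap i j) y + Gmat m (Function.update x i 1) y
      else 0 := by
  have factor : ∀ a b c d : ZMod 2, base a (c + d) * base b d = base a c * base b d +
      if a = 0 ∧ b = 1 then base b c * base a d + base 1 c * base b d else 0 := by decide
  have rest : ∀ x' y' : Idx m, (∀ k, k ≠ i → k ≠ j → x' k = x k ∧ y' k = y k) →
      ∏ k ∈ (Finset.univ.erase i).erase j, base (x' k) (y' k) =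
        ∏ k ∈ (Finset.univ.erase i).erase j, base (x k) (y k) := by
    refine fun x' y' h => Finset.prod_congr rfl fun k hk => ?_
    simp only [Finset.mem_erase, Finset.mem_univ, and_true] at hk
    rw [(h k hk.2 hk.1).1, (h k hk.2 hk.1).2]
  simp only [Gmat_eq_mul hij]
  rw [rest x _ fun k hi hj => ⟨rfl, by simp [hi]⟩,
    rest (x ∘ Equiv.swap i j) y fun k hi hj => ⟨by simp [Equiv.swap_apply_of_ne_of_ne hi hj], rfl⟩,
    rest (Function.update x i 1) y fun k hi hj => ⟨by simp [hi], rfl⟩]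
  simp only [Function.update_self, Function.update_of_ne hij.symm, Function.comp_apply,
    Equiv.swap_apply_left, Equiv.swap_apply_right]
  rw [factor, add_mul]
  split_ifs <;> ring

/-- The shear of the index space adding the coordinate `j` to the coordinate `i`. -/
def shear {i j : Fin m} (hij : i ≠ j) : Equiv.Perm (Idx m) where
  toFun y := Function.update y i (y i + y j)
  invFun y := Function.update y i (y i + y j)
  left_inv y := by
    ext k
    by_cases hk : k = i
    · subst hk
      simp [hij.symm, add_assoc, CharTwo.add_self_eq_zero]
    · simp [hk]
  right_inv y := by
    ext k
    by_cases hk : k = i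
    · subst hk
      simp [hij.symm, add_assoc, CharTwo.add_self_eq_zero]
    · simp [hk]

theorem Wfun_comp_shear {i j : Fin m} (hij : i ≠ j) (z : Idx m → ZMod 2) (x : Idx m) :
    Wfun m (z ∘ shear hij) x = Wfun m z x +
      if x i = 0 ∧ x j = 1 then
        Wfun m z (x ∘ Equiv.swap i j) + Wfun m z (Function.update x i 1)
      else 0 := by
  have reindex : Wfun m (z ∘ shear hij) x =
      ∑ y, Gmat m x (Function.update y i (y i + y j)) * z y := by
    rw [← Equiv.sum_comp (shear hij)]
    refine Finset.sum_congr rfl fun y _ => ?_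
    change _ = Gmat m x ((shear hij).symm (shear hij y)) * _
    rw [Equiv.symm_apply_apply]
    rfl
  rw [reindex]
  simp only [Gmat_update_add hij, add_mul, Finset.sum_add_distrib]
  split_ifs with h
  · simp only [add_mul, Finset.sum_add_distrib]
    rfl
  · simp only [zero_mul, Finset.sum_const_zero]
    rfl

/-- The symmetries of the transformed noise leave no nontrivial subspace invariant. -/
theorem eq_bot_or_eq_top_of_quotDist {w : ZMod 2 → ℝ} (hw : 0 ≤ w)
    (K : Submodule (ZMod 2) ({x : Idx m // wt x = r} → ZMod 2))
    (hK : ∀ M : ({x : Idx m // wt x = r} → ZMod 2) →ₗ[ZMod 2] ({x : Idx m // wt x = r} → ZMod 2),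
      (∀ L, quotDist (fun z : Idx m → ZMod 2 => ∏ x, w (z x)) (Wr m r) (Wgt m r) (L.comap M) ≤
        quotDist (fun z => ∏ x, w (z x)) (Wr m r) (Wgt m r) L) → K ≤ K.comap M) :
    K = ⊥ ∨ K = ⊤ := by
  refine eq_bot_or_eq_top K fun i j hij c hc => ?_
  have hM := hK (LinearMap.id + moveMap i j) (quotDist_comap_le
    (fun z => Finset.prod_nonneg fun x _ => hw (z x))
    ((shear hij).symm.arrowCongr (Equiv.refl (ZMod 2))) ?_ _ ?_ ?_ ?_) hc
  · have := K.sub_mem hM hc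
    simpa using this
  · intro z
    exact Equiv.prod_comp (shear hij) fun x => w (z x)
  · intro v
    simp only [LinearMap.add_apply, LinearMap.id_apply, map_add, moveMap_moveMap_self, add_zero]
    ext x
    simp [add_assoc, CharTwo.add_self_eq_zero]
  · intro z z' hz
    ext x
    have hz' : ∀ y, r < wt y → Wfun m z y = Wfun m z' y := fun y hy => congrFun hz ⟨y, hy⟩
    change Wfun m (z ∘ shear hij) x = Wfun m (z' ∘ shear hij) x
    rw [Wfun_comp_shear, Wfun_comp_shear, hz' x x.2]
    split_ifs with h
    · rw [hz' _ ((wt_comp _ _).symm ▸ x.2), hz' _ ?_]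
      rw [wt_update_one h.1]
      exact x.2.trans (Nat.lt_succ_self _)
    · rfl
  · intro z z' hz
    ext x
    have hz' : ∀ y, r < wt y → Wfun m z y = Wfun m z' y := fun y hy => congrFun hz ⟨y, hy⟩
    change Wfun m (z ∘ shear hij) x - Wfun m (z' ∘ shear hij) x =
      Wr m r z x - Wr m r z' x + moveMap i j (Wr m r z - Wr m r z') x
    rw [Wfun_comp_shear, Wfun_comp_shear, moveMap_apply]
    split_ifs with h
    · rw [hz' (Function.update x.1 i 1) (by rw [wt_update_one h.1, x.2]; exact Nat.lt_succ_self _)]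
      simp only [Pi.sub_apply, Wr, swapIdx]
      ring
    · simp [Wr]

section Entropy

variable {Ω S T V : Type*} [Fintype Ω] [Fintype S] [Fintype T] [MeasurableSpace Ω]
  [MeasurableSingletonClass Ω] (μ : Measure Ω) [IsFiniteMeasure μ]

theorem ent_eq (X : Ω → S) :
    ent μ X = shannon (fun ω => (μ {ω}).toReal) X / Real.log 2 := by
  classical
  have hlaw : ∀ s, (μ (X ⁻¹' {s})).toReal = law (fun ω => (μ {ω}).toReal) X s := by
    intro s
    rw [law, ← Finset.sum_filter, ← ENNReal.toReal_sum fun _ _ => measure_ne_top _ _,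
      sum_measure_singleton]
    congr 2
    ext ω
    simp
  rw [ent, tsum_fintype, shannon, Finset.sum_div, ← Finset.sum_neg_distrib]
  refine Finset.sum_congr rfl fun s _ => ?_
  rw [hlaw, Real.logb, Real.negMulLog]
  ring

theorem condEnt_eq (X : Ω → S) (A : Ω → T) :
    condEnt μ X A = cond (fun ω => (μ {ω}).toReal) X A / Real.log 2 := by
  rw [condEnt, ent_eq, ent_eq, cond, sub_div]

theorem condRdist_self_eq [AddCommGroup V] [Fintype V] (X : Ω → V) (A : Ω → T) :
    condRdist μ μ X A X A =
      (cond (tensor (fun ω => (μ {ω}).toReal) fun ω => (μ {ω}).toReal)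
        (fun ω => X ω.1 + X ω.2) (fun ω => (A ω.1, A ω.2)) -
          cond (fun ω => (μ {ω}).toReal) X A) / Real.log 2 := by
  have hprod : (fun ω : Ω × Ω => ((μ.prod μ) {ω}).toReal) =
      tensor (fun ω => (μ {ω}).toReal) fun ω => (μ {ω}).toReal := by
    ext ω
    rw [tensor, ← ENNReal.toReal_mul, ← Measure.prod_prod, Set.singleton_prod_singleton]
  rw [condRdist, condEnt_eq, condEnt_eq, hprod]
  ring

theorem measure_singleton_mem_stdSimplex [IsProbabilityMeasure μ] :
    (fun ω => (μ {ω}).toReal) ∈ stdSimplex ℝ Ω := by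
  refine ⟨fun ω => ENNReal.toReal_nonneg, ?_⟩
  rw [← ENNReal.toReal_sum fun _ _ => measure_ne_top _ _, sum_measure_singleton]
  simp

end Entropy

theorem isProbabilityMeasure_bern2 {δ : ℝ} (h0 : 0 ≤ δ) (h1 : δ ≤ 1) :
    IsProbabilityMeasure (bern2 δ) := by
  constructor
  simp [bern2, ← ENNReal.ofReal_add h0 (sub_nonneg.2 h1)]

theorem card_wt_eq : Fintype.card {x : Idx m // wt x = r} = m.choose r := by
  classical
  rw [Fintype.card_subtype]
  have : (Finset.univ.filter fun x : Idx m => wt x = r).card =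
      (Finset.powersetCard r (Finset.univ : Finset (Fin m))).card := by
    refine Finset.card_bij' (fun x _ => Finset.univ.filter fun i => x i = 1)
      (fun s _ i => if i ∈ s then 1 else 0) ?_ ?_ ?_ ?_
    · intro x hx
      exact Finset.mem_powersetCard.2 ⟨Finset.subset_univ _, (Finset.mem_filter.1 hx).2⟩
    · intro s hs
      refine Finset.mem_filter.2 ⟨Finset.mem_univ _, ?_⟩
      simpa [wt] using (Finset.mem_powersetCard.1 hs).2
    · intro x _
      ext i
      have h0 : ∀ a : ZMod 2, a ≠ 1 → a = 0 := by decide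
      by_cases hi : x i = 1
      · simp [hi]
      · simp [h0 _ hi]
    · intro s _
      ext i
      simp
  rw [this, Finset.card_powersetCard, Finset.card_univ, Fintype.card_fin]

end TransformedNoise

end FinEnt

open FinEnt

/-- `min(H(W_r|W_{>r}), binom(m,r) - H(W_r|W_{>r})) ≤ 140 · d(W_r|W_{>r}; W_r|W_{>r})`. -/
theorem stmt9 (m r : ℕ) (δ : ℝ) (hδ : δ ∈ Set.Ioo 0 (1/2 : ℝ)) :
    min (condEnt (noise m δ) (Wr m r) (Wgt m r))
        ((m.choose r : ℝ) - condEnt (noise m δ) (Wr m r) (Wgt m r))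
      ≤ 140 * condRdist (noise m δ) (noise m δ) (Wr m r) (Wgt m r) (Wr m r) (Wgt m r) := by
  have : IsProbabilityMeasure (bern2 δ) :=
    isProbabilityMeasure_bern2 hδ.1.le (by linarith [hδ.2])
  have : IsProbabilityMeasure (noise m δ) := by
    unfold noise
    infer_instance
  have hweight : (fun z => (noise m δ {z}).toReal) =
      fun z : Idx m → ZMod 2 => ∏ x, (bern2 δ {z x}).toReal := by
    ext z
    rw [noise, Measure.pi_singleton, ENNReal.toReal_prod]
  have hlog : (0 : ℝ) < Real.log 2 := Real.log_pos one_lt_two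
  have hmin := min_cond_le (measure_singleton_mem_stdSimplex (noise m δ)) (Wr m r) (Wgt m r)
    fun K hK => eq_bot_or_eq_top_of_quotDist (w := fun a => (bern2 δ {a}).toReal)
      (fun _ => ENNReal.toReal_nonneg) K (by simpa only [hweight] using hK)
  have hcard : Real.log (Fintype.card ({x : Idx m // wt x = r} → ZMod 2)) =
      m.choose r * Real.log 2 := by
    rw [Fintype.card_fun, card_wt_eq, ZMod.card]
    simp
  rw [hcard] at hmin
  rw [condEnt_eq, condRdist_self_eq, ← mul_div_assoc, le_div_iff₀ hlog,
    min_mul_of_nonneg _ _ hlog.le, sub_mul, div_mul_cancel₀ _ hlog.ne']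
  exact hmin
end

section
/- Consider the binary symmetric channel with error parameter δ ∈ [0, 1/2), and a sequence of integers r_m with limsup_{m→∞} binom(m, ≤ r_m)/2^m < 1 − H(δ). Then the bit-error probability of the Reed–Muller code RM(m, r_m) under bitwise maximum-likelihood decoding satisfies P_bit = 2^{−Ω(√m)}; i.e., there exist c > 0 and m₀ such that for all m ≥ m₀, P_bit(RM(m, r_m)) ≤ 2^{−c√m}. -/
open MeasureTheory

/-- The binary entropy function `H(δ) = -δ log₂ δ - (1-δ) log₂ (1-δ)`. -/
noncomputable def Hbin (δ : ℝ) : ℝ :=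
  -(δ * Real.logb 2 δ) - (1 - δ) * Real.logb 2 (1 - δ)

/-- `binom(m, ≤ r) = ∑_{i=0}^{r} binom(m,i)`. -/
def binomLe (m r : ℕ) : ℕ := ∑ i ∈ Finset.range (r + 1), m.choose i

/-- The uniform probability measure on a (finite, nonempty) type: normalized counting measure. -/
noncomputable def unifM (α : Type*) [MeasurableSpace α] : Measure α :=
  (Measure.count (Set.univ : Set α))⁻¹ • Measure.count

/-- Message space of `RM(m,r)`: coefficients of the monomials of degree `≤ r`
(indexed by the binary strings of weight `≤ r`), so `F₂^{binom(m, ≤ r)}`. -/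
abbrev CoefLe (m r : ℕ) := {x : Idx m // wt x ≤ r} → ZMod 2

/-- The `RM(m,r)` encoder: the evaluation vector over `F₂^m` of the multilinear
polynomial of degree `≤ r` with coefficient vector `u`. -/
def encode (m r : ℕ) (u : CoefLe m r) : Idx m → ZMod 2 :=
  fun x => ∑ s : {x : Idx m // wt x ≤ r}, Gmat m x s.val * u s

/-- The joint law of `(U, Z)`: `U` uniform on `F₂^{binom(m, ≤ r)}`, `Z` the i.i.d.
Bernoulli(δ) noise of the `BSC(δ)`, independent. -/
noncomputable def μRM (m r : ℕ) (δ : ℝ) : Measure (CoefLe m r × (Idx m → ZMod 2)) :=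
  (unifM (CoefLe m r)).prod (noise m δ)

/-- The transmitted codeword `X = encode(U)`. -/
def Xrm (m r : ℕ) (p : CoefLe m r × (Idx m → ZMod 2)) : Idx m → ZMod 2 :=
  encode m r p.1

/-- The received word `Y = X + Z` (output of the binary symmetric channel). -/
def Yrm (m r : ℕ) (p : CoefLe m r × (Idx m → ZMod 2)) : Idx m → ZMod 2 :=
  encode m r p.1 + p.2


/-- Expectation of `F` under the product of the weights `w` on `F₂`. -/
noncomputable def prodExp {ι : Type*} [Fintype ι] [DecidableEq ι] (w : ZMod 2 → ℝ)
    (F : (ι → ZMod 2) → ℝ) : ℝ :=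
  ∑ z : ι → ZMod 2, (∏ x, w (z x)) * F z

theorem sum_zmod_two (F : ZMod 2 → ℝ) : ∑ b, F b = F 0 + F 1 := Fin.sum_univ_two F

theorem sum_pi_fin_succ {n : ℕ} (F : (Fin (n + 1) → ZMod 2) → ℝ) :
    ∑ z, F z = ∑ b : ZMod 2, ∑ z : Fin n → ZMod 2, F (Fin.cons b z) := by
  rw [← Fintype.sum_prod_type' (f := fun b z => F (Fin.cons b z))]
  exact (Fintype.sum_equiv (Fin.consEquiv (fun _ : Fin (n + 1) => ZMod 2)) _ _
    (fun _ => rfl)).symm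

theorem sum_pi_equiv {ι κ : Type*} [Fintype ι] [DecidableEq ι] [Fintype κ] [DecidableEq κ]
    (e : ι ≃ κ) (F : (ι → ZMod 2) → ℝ) : ∑ z, F z = ∑ z : κ → ZMod 2, F (z ∘ e) :=
  (Fintype.sum_equiv (Equiv.arrowCongr e.symm (Equiv.refl (ZMod 2))) _ _ (fun _ => rfl)).symm

theorem prodExp_equiv {ι κ : Type*} [Fintype ι] [DecidableEq ι] [Fintype κ] [DecidableEq κ]
    (e : ι ≃ κ) (w : ZMod 2 → ℝ) (F : (ι → ZMod 2) → ℝ) :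
    prodExp w F = prodExp w (fun z : κ → ZMod 2 => F (z ∘ e)) := by
  unfold prodExp
  rw [sum_pi_equiv e]
  refine Finset.sum_congr rfl fun z _ => ?_
  congr 1
  exact e.prod_comp (fun x => w (z x))

theorem prodExp_succ {n : ℕ} (w : ZMod 2 → ℝ) (F : (Fin (n + 1) → ZMod 2) → ℝ) :
    prodExp w F = w 0 * prodExp w (fun z => F (Fin.cons 0 z))
      + w 1 * prodExp w (fun z => F (Fin.cons 1 z)) := by
  unfold prodExp
  rw [sum_pi_fin_succ, sum_zmod_two, Finset.mul_sum, Finset.mul_sum]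
  simp [Fin.prod_univ_succ, mul_assoc]

section Linear

variable {ι : Type*} [Fintype ι] [DecidableEq ι] (w : ZMod 2 → ℝ)

theorem prodExp_sum {α : Type*} (s : Finset α) (f : α → (ι → ZMod 2) → ℝ) :
    prodExp w (fun z => ∑ a ∈ s, f a z) = ∑ a ∈ s, prodExp w (f a) := by
  unfold prodExp
  simp_rw [Finset.mul_sum]
  exact Finset.sum_comm

theorem prodExp_add (F G : (ι → ZMod 2) → ℝ) :
    prodExp w (fun z => F z + G z) = prodExp w F + prodExp w G := by
  simp [prodExp, mul_add, Finset.sum_add_distrib]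

theorem prodExp_const_mul (c : ℝ) (F : (ι → ZMod 2) → ℝ) :
    prodExp w (fun z => c * F z) = c * prodExp w F := by
  simp only [prodExp, Finset.mul_sum]
  exact Finset.sum_congr rfl fun z _ => by ring

theorem sum_prod_weights (hw1 : w 0 + w 1 = 1) : ∑ z : ι → ZMod 2, ∏ x, w (z x) = 1 := by
  have h := Finset.prod_univ_sum (fun _ : ι => (Finset.univ : Finset (ZMod 2))) (fun _ b => w b)
  rw [Fintype.piFinset_univ] at h
  rw [← h]
  simp [sum_zmod_two, hw1]

theorem prodExp_const (hw1 : w 0 + w 1 = 1) (c : ℝ) :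
    prodExp w (fun _ : ι → ZMod 2 => c) = c := by
  rw [prodExp, ← Finset.sum_mul, sum_prod_weights w hw1, one_mul]

variable {w}

theorem prodExp_mono (hw : ∀ b, 0 ≤ w b) {F G : (ι → ZMod 2) → ℝ} (h : ∀ z, F z ≤ G z) :
    prodExp w F ≤ prodExp w G :=
  Finset.sum_le_sum fun z _ =>
    mul_le_mul_of_nonneg_left (h z) (Finset.prod_nonneg fun _ _ => hw _)

/-- Marginalisation of a product law along an injection of the coordinates. -/
theorem prodExp_comp_injective {κ : Type*} [Fintype κ] [DecidableEq κ] (hw1 : w 0 + w 1 = 1)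
    {T : ι → κ} (hT : Function.Injective T) (F : (ι → ZMod 2) → ℝ) :
    prodExp w (fun z : κ → ZMod 2 => F (z ∘ T)) = prodExp w F := by
  classical
  let e := Equiv.ofInjective T hT
  unfold prodExp
  rw [← Fintype.sum_equiv (Equiv.piEquivPiSubtypeProd (fun x => x ∈ Set.range T)
    (fun _ => ZMod 2)).symm
    (fun p => ((∏ x, w (p.1 x)) * ∏ x, w (p.2 x)) * F (p.1 ∘ e)) _ ?_]
  · rw [Fintype.sum_prod_type, sum_pi_equiv e]
    refine Finset.sum_congr rfl fun z _ => ?_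
    have h := sum_prod_weights (ι := {x // ¬ x ∈ Set.range T}) w hw1
    dsimp only
    rw [← Finset.sum_mul, ← Finset.mul_sum, h, mul_one]
    congr 1
    exact (e.prod_comp (fun x => w (z x))).symm
  · rintro ⟨p, p'⟩
    congr 1
    · rw [← Fintype.prod_subtype_mul_prod_subtype (fun x => x ∈ Set.range T)]
      congr 1
      · refine Finset.prod_congr (Finset.ext fun _ => by simp) fun x _ => ?_
        rw [Equiv.piEquivPiSubtypeProd_symm_apply, dif_pos x.2]
      · refine Finset.prod_congr rfl fun x _ => ?_
        rw [Equiv.piEquivPiSubtypeProd_symm_apply, dif_neg x.2]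
    · congr 1
      funext x
      simp only [Function.comp_apply]
      rw [Equiv.piEquivPiSubtypeProd_symm_apply, dif_pos (Set.mem_range_self x)]
      rfl

end Linear

/-- Variance of an aggregate of functions each of which depends on few coordinates. -/
theorem variance_sum_le_fin {α : Type*} [Fintype α] [DecidableEq α] {w : ZMod 2 → ℝ}
    (hw : ∀ b, 0 ≤ w b) (hw1 : w 0 + w 1 = 1) {K : ℝ} :
    ∀ (n : ℕ) (f : α → (Fin n → ZMod 2) → ℝ) (D : Fin n → Finset α),
      (∀ j, ((D j).card : ℝ) ≤ K) →
      (∀ j, ∀ a ∉ D j, ∀ z b, f a (Function.update z j b) = f a z) →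
      prodExp w (fun z => (∑ a, f a z) ^ 2) - (prodExp w (fun z => ∑ a, f a z)) ^ 2
        ≤ K * ∑ a, (prodExp w (fun z => f a z ^ 2) - prodExp w (f a) ^ 2) := by
  intro n
  induction n with
  | zero =>
    intro f D _ _
    simp [prodExp]
  | succ n ih =>
    intro f D hK hf
    have step (b : ZMod 2) := ih (fun a z => f a (Fin.cons b z)) (fun j => D j.succ)
      (fun j => hK j.succ) (fun j a ha z c => by
        rw [Fin.cons_update]; exact hf j.succ a ha _ _)
    have two_point : ∀ A B x y : ℝ, (w 0 * A + w 1 * B) - (w 0 * x + w 1 * y) ^ 2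
        = w 0 * (A - x ^ 2) + w 1 * (B - y ^ 2) + w 0 * w 1 * (x - y) ^ 2 := by
      intro A B x y
      have : w 1 = 1 - w 0 := by linarith
      rw [this]; ring
    simp only [prodExp_succ w, two_point, Finset.sum_add_distrib, ← Finset.mul_sum, mul_add]
    have h0 := mul_le_mul_of_nonneg_left (step 0) (hw 0)
    have h1 := mul_le_mul_of_nonneg_left (step 1) (hw 1)
    have key : (prodExp w (fun z => ∑ a, f a (Fin.cons 0 z))
        - prodExp w (fun z => ∑ a, f a (Fin.cons 1 z))) ^ 2
        ≤ K * ∑ a, (prodExp w (fun z => f a (Fin.cons 0 z))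
          - prodExp w (fun z => f a (Fin.cons 1 z))) ^ 2 := by
      rw [prodExp_sum, prodExp_sum, ← Finset.sum_sub_distrib]
      have hz : ∀ a ∉ D 0, prodExp w (fun z => f a (Fin.cons 0 z))
          - prodExp w (fun z => f a (Fin.cons 1 z)) = 0 := by
        intro a ha
        rw [sub_eq_zero]
        congr 1
        funext z
        have := hf 0 a ha (Fin.cons 1 z) 0
        rwa [Fin.update_cons_zero] at this
      rw [← Finset.sum_subset (Finset.subset_univ (D 0)) (fun a _ ha => hz a ha)]
      refine sq_sum_le_card_mul_sum_sq.trans ?_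
      refine mul_le_mul (hK 0) ?_ (Finset.sum_nonneg fun _ _ => sq_nonneg _)
        (le_trans (Nat.cast_nonneg _) (hK 0))
      exact Finset.sum_le_sum_of_subset_of_nonneg (Finset.subset_univ _)
        (fun _ _ _ => sq_nonneg _)
    have h2 := mul_le_mul_of_nonneg_left key (mul_nonneg (hw 0) (hw 1))
    linarith

theorem variance_sum_le {ι α : Type*} [Fintype ι] [DecidableEq ι] [Fintype α] [DecidableEq α]
    {w : ZMod 2 → ℝ} (hw : ∀ b, 0 ≤ w b) (hw1 : w 0 + w 1 = 1) {K : ℝ}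
    (f : α → (ι → ZMod 2) → ℝ) (D : ι → Finset α) (hK : ∀ j, ((D j).card : ℝ) ≤ K)
    (hf : ∀ j, ∀ a ∉ D j, ∀ z b, f a (Function.update z j b) = f a z) :
    prodExp w (fun z => (∑ a, f a z) ^ 2) - (prodExp w (fun z => ∑ a, f a z)) ^ 2
      ≤ K * ∑ a, (prodExp w (fun z => f a z ^ 2) - prodExp w (f a) ^ 2) := by
  let e := Fintype.equivFin ι
  have h := variance_sum_le_fin hw hw1 (K := K) (Fintype.card ι) (fun a z => f a (z ∘ e))
    (fun j => D (e.symm j)) (fun j => hK _) (fun j a ha z b => by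
      rw [Function.update_comp_equiv]; exact hf _ a ha _ _)
  simpa only [prodExp_equiv e w] using h

theorem two_point_entropy_le {a b : ℝ} (ha : 0 ≤ a) (hb : 0 ≤ b) :
    a * Real.log a + b * Real.log b - (a + b) * Real.log (a + b) + (a + b) * Real.log 2
      ≤ (a - b) ^ 2 / (a + b) := by
  rcases (add_nonneg ha hb).eq_or_lt with h | h
  · have ha' : a = 0 := by linarith
    have hb' : b = 0 := by linarith
    simp [ha', hb']
  have aux : ∀ x : ℝ, 0 ≤ x → x * Real.log x - x * Real.log (a + b) + x * Real.log 2
      ≤ x * (2 * x / (a + b) - 1) := by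
    intro x hx
    rcases hx.eq_or_lt with rfl | hx
    · simp
    have hlog := Real.log_le_sub_one_of_pos (show 0 < 2 * x / (a + b) by positivity)
    rw [Real.log_div (by positivity) h.ne', Real.log_mul (by norm_num) hx.ne'] at hlog
    have := mul_le_mul_of_nonneg_left hlog hx.le
    linarith
  have e : (a - b) ^ 2 / (a + b) = a * (2 * a / (a + b) - 1) + b * (2 * b / (a + b) - 1) := by
    field_simp
    ring
  rw [e]
  linarith [aux a ha, aux b hb]

/-- The local chi-square discrepancy of `p` at coordinate `j`. -/
noncomputable def chiSq {ι : Type*} [DecidableEq ι] (p : (ι → ZMod 2) → ℝ) (j : ι)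
    (z : ι → ZMod 2) : ℝ :=
  (p (Function.update z j 0) - p (Function.update z j 1)) ^ 2
    / (p (Function.update z j 0) + p (Function.update z j 1))

theorem sq_sum_sub_div_le {β : Type*} (s : Finset β) (a b : β → ℝ) (ha : ∀ i, 0 ≤ a i)
    (hb : ∀ i, 0 ≤ b i) :
    (∑ i ∈ s, a i - ∑ i ∈ s, b i) ^ 2 / (∑ i ∈ s, a i + ∑ i ∈ s, b i)
      ≤ ∑ i ∈ s, (a i - b i) ^ 2 / (a i + b i) := by
  have h := Finset.sum_sq_le_sum_mul_sum_of_sq_le_mul s (r := fun i => a i - b i)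
    (f := fun i => (a i - b i) ^ 2 / (a i + b i)) (g := fun i => a i + b i)
    (fun i _ => div_nonneg (sq_nonneg _) (add_nonneg (ha i) (hb i)))
    (fun i _ => add_nonneg (ha i) (hb i))
    (fun i _ => le_of_eq <| by
      rcases (add_nonneg (ha i) (hb i)).eq_or_lt with h | h
      · have h1 : a i = 0 := by linarith [ha i, hb i]
        have h2 : b i = 0 := by linarith [ha i, hb i]
        simp [h1, h2]
      · field_simp)
  rw [Finset.sum_sub_distrib, Finset.sum_add_distrib] at h
  refine div_le_of_le_mul₀ ?_ ?_ h
  · exact add_nonneg (Finset.sum_nonneg fun i _ => ha i) (Finset.sum_nonneg fun i _ => hb i)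
  · exact Finset.sum_nonneg fun i _ => div_nonneg (sq_nonneg _) (add_nonneg (ha i) (hb i))

/-- Relative entropy to the uniform law is at most the sum of the local chi-square terms. -/
theorem entropy_deficit_le_fin :
    ∀ (n : ℕ) (p : (Fin n → ZMod 2) → ℝ), (∀ z, 0 ≤ p z) →
      ∑ z, p z * Real.log (p z) - (∑ z, p z) * Real.log (∑ z, p z)
        + (∑ z, p z) * (n * Real.log 2) ≤ ∑ j, ∑ z, chiSq p j z / 2 := by
  intro n
  induction n with
  | zero => intro p _; simp
  | succ n ih =>
    intro p hp
    have h0 := ih (fun z => p (Fin.cons 0 z)) (fun z => hp _)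
    have h1 := ih (fun z => p (Fin.cons 1 z)) (fun z => hp _)
    have hP (b : ZMod 2) : 0 ≤ ∑ z : Fin n → ZMod 2, p (Fin.cons b z) :=
      Finset.sum_nonneg fun z _ => hp _
    have h2 := two_point_entropy_le (hP 0) (hP 1)
    have h3 := sq_sum_sub_div_le (Finset.univ) (fun z : Fin n → ZMod 2 => p (Fin.cons 0 z))
      (fun z => p (Fin.cons 1 z)) (fun z => hp _) (fun z => hp _)
    have hs (b : ZMod 2) (j : Fin n) (z : Fin n → ZMod 2) :
        chiSq p j.succ (Fin.cons b z) = chiSq (fun z => p (Fin.cons b z)) j z := by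
      simp only [chiSq, Fin.cons_update]
    have hz (b : ZMod 2) (z : Fin n → ZMod 2) :
        chiSq p 0 (Fin.cons b z) = (p (Fin.cons 0 z) - p (Fin.cons 1 z)) ^ 2
          / (p (Fin.cons 0 z) + p (Fin.cons 1 z)) := by
      simp only [chiSq, Fin.update_cons_zero]
    rw [Fin.sum_univ_succ]
    simp only [sum_pi_fin_succ, sum_zmod_two, hs, hz, Finset.sum_add_distrib,
      ← Finset.sum_div] at h0 h1 h2 h3 ⊢
    push_cast
    linarith

theorem entropy_deficit_le {ι : Type*} [Fintype ι] [DecidableEq ι] (p : (ι → ZMod 2) → ℝ)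
    (hp : ∀ z, 0 ≤ p z) (hp1 : ∑ z, p z = 1) :
    ∑ z, p z * Real.log (p z) + Fintype.card ι * Real.log 2
      ≤ ∑ j, ∑ z, chiSq p j z / 2 := by
  let e := Fintype.equivFin ι
  have h := entropy_deficit_le_fin (Fintype.card ι) (fun z => p (z ∘ e)) (fun z => hp _)
  rw [← sum_pi_equiv e p, hp1, ← sum_pi_equiv e (fun z => p z * Real.log (p z))] at h
  have hr : ∑ j, ∑ z, chiSq (fun z => p (z ∘ e)) j z / 2 = ∑ j, ∑ z, chiSq p j z / 2 := by
    rw [← e.sum_comp]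
    refine Finset.sum_congr rfl fun j _ => ?_
    rw [sum_pi_equiv e (fun z => chiSq p j z / 2)]
    refine Finset.sum_congr rfl fun z _ => ?_
    simp only [chiSq, Function.update_comp_equiv, Equiv.symm_apply_apply]
  rw [hr] at h
  simpa using h

theorem zmod_two_cases (b : ZMod 2) : b = 0 ∨ b = 1 := by
  revert b; decide

theorem sum_update_pair {ι : Type*} [Fintype ι] [DecidableEq ι] (i : ι)
    (F : (ι → ZMod 2) → ℝ) :
    ∑ z, (F (Function.update z i 0) + F (Function.update z i 1)) / 2 = ∑ z, F z := by
  let e : (ι → ZMod 2) ≃ (ι → ZMod 2) := Equiv.addRight (Pi.single i 1)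
  have he : ∑ z, F (e z) = ∑ z, F z := e.sum_comp F
  have hpt : ∀ z, F (Function.update z i 0) + F (Function.update z i 1) = F z + F (e z) := by
    intro z
    have h1 : e z = Function.update z i (z i + 1) := by
      funext x
      by_cases hx : x = i
      · subst hx; simp [e]
      · simp [e, hx]
    rw [h1]
    rcases zmod_two_cases (z i) with h | h
    · rw [h, zero_add]
      conv_rhs => rw [← Function.update_eq_self i z, h]
      simp
    · rw [h, show (1 : ZMod 2) + 1 = 0 by decide, add_comm (F z)]
      conv_rhs => rw [← Function.update_eq_self i z, h]
      simp
  rw [← Finset.sum_div, Finset.sum_congr rfl fun z _ => hpt z, Finset.sum_add_distrib, he]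
  ring

theorem prodExp_mul_of_indep {ι : Type*} [Fintype ι] [DecidableEq ι] {w : ZMod 2 → ℝ}
    (hw1 : w 0 + w 1 = 1) (i : ι) (s : ZMod 2 → ℝ) (f : (ι → ZMod 2) → ℝ)
    (hf : ∀ z b, f (Function.update z i b) = f z) :
    prodExp w (fun z => s (z i) * f z) = (w 0 * s 0 + w 1 * s 1) * prodExp w f := by
  unfold prodExp
  rw [← sum_update_pair i, ← sum_update_pair i (fun z => (∏ x, w (z x)) * f z), Finset.mul_sum]
  refine Finset.sum_congr rfl fun z _ => ?_
  have hprod (b : ZMod 2) : ∏ x, w (Function.update z i b x)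
      = w b * ∏ x ∈ Finset.univ \ {i}, w (z x) := by
    have := Finset.prod_update_of_mem (Finset.mem_univ i) (fun x => w (z x)) (w b)
    rw [← this]
    refine Finset.prod_congr rfl fun x _ => ?_
    by_cases hx : x = i
    · subst hx; simp
    · simp [hx]
  simp only [hf, hprod, Function.update_self]
  linear_combination
    (-(1 / 2) * (w 0 * s 0 + w 1 * s 1) * (∏ x ∈ Finset.univ \ {i}, w (z x)) * f z) * hw1

theorem prodExp_coord {ι : Type*} [Fintype ι] [DecidableEq ι] {w : ZMod 2 → ℝ}
    (hw1 : w 0 + w 1 = 1) (i : ι) (s : ZMod 2 → ℝ) :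
    prodExp w (fun z : ι → ZMod 2 => s (z i)) = w 0 * s 0 + w 1 * s 1 := by
  have h := prodExp_mul_of_indep hw1 i s (fun _ => 1) (fun _ _ => rfl)
  simpa [prodExp_const w hw1] using h

theorem prodExp_log_prod {ι : Type*} [Fintype ι] [DecidableEq ι] {w : ZMod 2 → ℝ}
    (hw1 : w 0 + w 1 = 1) :
    prodExp w (fun z : ι → ZMod 2 => Real.log (∏ x, w (z x)))
      = Fintype.card ι * (w 0 * Real.log (w 0) + w 1 * Real.log (w 1)) := by
  have h : prodExp w (fun z : ι → ZMod 2 => Real.log (∏ x, w (z x)))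
      = prodExp w (fun z : ι → ZMod 2 => ∑ x, Real.log (w (z x))) := by
    refine Finset.sum_congr rfl fun z _ => ?_
    by_cases h0 : ∏ x, w (z x) = 0
    · simp [h0]
    · congr 1
      exact Real.log_prod fun x hx hzero => h0 (Finset.prod_eq_zero hx hzero)
  rw [h, prodExp_sum, Finset.sum_congr rfl fun x _ =>
    prodExp_coord hw1 x (fun b => Real.log (w b))]
  simp only [Finset.sum_const, Finset.card_univ, nsmul_eq_mul]

/-- Point masses of the crossover law of `BSC(δ)`. -/
noncomputable def bscWeight (δ : ℝ) (b : ZMod 2) : ℝ := if b = 1 then δ else 1 - δ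

theorem bscWeight_zero (δ : ℝ) : bscWeight δ 0 = 1 - δ := by simp [bscWeight]

theorem bscWeight_one (δ : ℝ) : bscWeight δ 1 = δ := by simp [bscWeight]

theorem bscWeight_sum (δ : ℝ) : bscWeight δ 0 + bscWeight δ 1 = 1 := by
  rw [bscWeight_zero, bscWeight_one]; ring

theorem bscWeight_nonneg {δ : ℝ} (h0 : 0 ≤ δ) (h1 : δ < 1 / 2) (b : ZMod 2) :
    0 ≤ bscWeight δ b := by
  unfold bscWeight; split_ifs <;> linarith

theorem card_wt_le (m r : ℕ) : Fintype.card {x : Idx m // wt x ≤ r} = binomLe m r := by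
  have hfib (i : ℕ) : ((Finset.univ : Finset (Idx m)).filter fun x => wt x = i).card
      = m.choose i := by
    have hc := Finset.card_powersetCard i (Finset.univ : Finset (Fin m))
    rw [Finset.card_univ, Fintype.card_fin] at hc
    rw [← hc]
    refine Finset.card_bij (fun x _ => Finset.univ.filter fun j => x j = 1) ?_ ?_ ?_
    · intro x hx
      exact Finset.mem_powersetCard.mpr ⟨Finset.subset_univ _, (Finset.mem_filter.mp hx).2⟩
    · intro x _ y _ hxy
      funext j
      have := Finset.ext_iff.mp hxy j
      simp only [Finset.mem_filter, Finset.mem_univ, true_and] at this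
      rcases zmod_two_cases (x j) with hx | hx <;> rcases zmod_two_cases (y j) with hy | hy <;>
        simp_all
    · intro s hs
      refine ⟨fun j => if j ∈ s then 1 else 0, ?_, ?_⟩
      · refine Finset.mem_filter.mpr ⟨Finset.mem_univ _, ?_⟩
        simpa [wt] using (Finset.mem_powersetCard.mp hs).2
      · ext j; simp
  rw [Fintype.card_subtype, binomLe, Finset.card_eq_sum_card_fiberwise (f := wt)
    (t := Finset.range (r + 1)) (fun x hx => by
      simp only [Finset.coe_filter, Finset.mem_univ, true_and, Set.mem_ofPred_eq] at hx
      simp; omega)]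
  refine Finset.sum_congr rfl fun i hi => ?_
  rw [← hfib i, Finset.filter_filter]
  congr 1
  ext x
  simp only [Finset.mem_filter, Finset.mem_univ, true_and, Finset.mem_range] at hi ⊢
  omega

theorem card_coefLe (m r : ℕ) : Fintype.card (CoefLe m r) = 2 ^ binomLe m r := by
  rw [Fintype.card_fun, card_wt_le, ZMod.card]

theorem encode_add (m r : ℕ) (u v : CoefLe m r) :
    encode m r (u + v) = encode m r u + encode m r v := by
  funext x
  simp [encode, mul_add, Finset.sum_add_distrib]

theorem add_self_word {ι : Type*} (c : ι → ZMod 2) : c + c = 0 :=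
  funext fun _ => CharTwo.add_self_eq_zero _

/-- Law of the channel output when a uniform codeword of `RM(m,r)` is sent. -/
noncomputable def outLaw (m r : ℕ) (δ : ℝ) (y : Idx m → ZMod 2) : ℝ :=
  (Fintype.card (CoefLe m r) : ℝ)⁻¹ * ∑ u, ∏ x, bscWeight δ ((y + encode m r u) x)

theorem outLaw_add_encode (m r : ℕ) (δ : ℝ) (y : Idx m → ZMod 2) (v : CoefLe m r) :
    outLaw m r δ (y + encode m r v) = outLaw m r δ y := by
  unfold outLaw
  refine congrArg₂ (· * ·) rfl ?_
  rw [← Equiv.sum_comp (Equiv.addLeft v) (fun u => ∏ x, bscWeight δ ((y + encode m r u) x))]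
  simp [encode_add, add_assoc]

theorem sum_outLaw_mul (m r : ℕ) (δ : ℝ) (F : (Idx m → ZMod 2) → ℝ) :
    ∑ y, outLaw m r δ y * F y = (Fintype.card (CoefLe m r) : ℝ)⁻¹ *
      ∑ u, prodExp (bscWeight δ) (fun z => F (z + encode m r u)) := by
  simp only [outLaw, mul_assoc, ← Finset.mul_sum, Finset.sum_mul]
  rw [Finset.sum_comm]
  refine congrArg₂ (· * ·) rfl ?_
  refine Finset.sum_congr rfl fun u _ => ?_
  rw [prodExp, ← Equiv.sum_comp (Equiv.addRight (encode m r u)) (fun y =>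
    (∏ x, bscWeight δ ((y + encode m r u) x)) * F y)]
  simp only [Equiv.coe_addRight, add_assoc, add_self_word, add_zero]

theorem sum_outLaw_mul_of_invariant (m r : ℕ) (δ : ℝ) (F : (Idx m → ZMod 2) → ℝ)
    (hF : ∀ z u, F (z + encode m r u) = F z) :
    ∑ y, outLaw m r δ y * F y = prodExp (bscWeight δ) F := by
  rw [sum_outLaw_mul]
  simp only [hF]
  simp

section OutLaw

variable (m r : ℕ) {δ : ℝ}

theorem sum_outLaw : ∑ y, outLaw m r δ y = 1 := by
  have h := sum_outLaw_mul_of_invariant m r δ (fun _ => 1) (fun _ _ => rfl)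
  simpa [prodExp_const _ (bscWeight_sum δ)] using h

theorem outLaw_nonneg (h0 : 0 ≤ δ) (h1 : δ < 1 / 2) (y : Idx m → ZMod 2) :
    0 ≤ outLaw m r δ y :=
  mul_nonneg (by positivity) (Finset.sum_nonneg fun _ _ =>
    Finset.prod_nonneg fun _ _ => bscWeight_nonneg h0 h1 _)

theorem prod_div_le_outLaw (h0 : 0 ≤ δ) (h1 : δ < 1 / 2) (z : Idx m → ZMod 2) :
    (∏ x, bscWeight δ (z x)) / Fintype.card (CoefLe m r) ≤ outLaw m r δ z := by
  rw [div_eq_inv_mul, outLaw]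
  refine mul_le_mul_of_nonneg_left ?_ (by positivity)
  have h := Finset.single_le_sum (f := fun u => ∏ x, bscWeight δ ((z + encode m r u) x))
    (fun u _ => Finset.prod_nonneg fun _ _ => bscWeight_nonneg h0 h1 _)
    (Finset.mem_univ (0 : CoefLe m r))
  have e0 : encode m r 0 = 0 := by funext x; simp [encode]
  simpa [e0] using h

theorem neg_entropy_outLaw_ge (h0 : 0 ≤ δ) (h1 : δ < 1 / 2) :
    -(2 ^ m * (Hbin δ * Real.log 2)) - binomLe m r * Real.log 2
      ≤ ∑ y, outLaw m r δ y * Real.log (outLaw m r δ y) := by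
  rw [sum_outLaw_mul_of_invariant m r δ (fun y => Real.log (outLaw m r δ y))
    (fun z u => by rw [outLaw_add_encode])]
  have hcard : (Fintype.card (Idx m) : ℝ) = 2 ^ m := by simp
  have hlog2 : Real.log 2 ≠ 0 := (Real.log_pos one_lt_two).ne'
  have hH : Hbin δ * Real.log 2 = -((1 - δ) * Real.log (1 - δ) + δ * Real.log δ) := by
    unfold Hbin Real.logb
    field_simp
    ring
  have hM : Real.log (Fintype.card (CoefLe m r)) = binomLe m r * Real.log 2 := by
    rw [card_coefLe]; push_cast; rw [Real.log_pow]
  have hq := prodExp_log_prod (ι := Idx m) (bscWeight_sum δ)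
  rw [bscWeight_zero, bscWeight_one, hcard] at hq
  have hsub : prodExp (bscWeight δ) (fun z : Idx m → ZMod 2 =>
      Real.log (∏ x, bscWeight δ (z x)) + -Real.log (Fintype.card (CoefLe m r)))
      ≤ prodExp (bscWeight δ) (fun z => Real.log (outLaw m r δ z)) := by
    refine Finset.sum_le_sum fun z _ => ?_
    have hnn : 0 ≤ ∏ x, bscWeight δ (z x) :=
      Finset.prod_nonneg fun _ _ => bscWeight_nonneg h0 h1 _
    rcases hnn.eq_or_lt with hz | hz
    · rw [← hz]; simp
    · have hMpos : (0 : ℝ) < Fintype.card (CoefLe m r) := by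
        exact_mod_cast Fintype.card_pos
      refine mul_le_mul_of_nonneg_left ?_ hnn
      dsimp only
      rw [← sub_eq_add_neg, ← Real.log_div hz.ne' hMpos.ne']
      exact Real.log_le_log (by positivity) (prod_div_le_outLaw m r h0 h1 z)
  rw [prodExp_add, hq, prodExp_const _ (bscWeight_sum δ), hM] at hsub
  rw [hH]
  linarith

end OutLaw

/-- The character `b ↦ (-1)^b` of `F₂`. -/
noncomputable def signBit (b : ZMod 2) : ℝ := if b = 0 then 1 else -1

/-- Posterior bias of the output bit at `i` given the other output bits. -/
noncomputable def bitBias (m r : ℕ) (δ : ℝ) (i : Idx m) (y : Idx m → ZMod 2) : ℝ :=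
  (outLaw m r δ (Function.update y i 0) - outLaw m r δ (Function.update y i 1)) /
    (outLaw m r δ (Function.update y i 0) + outLaw m r δ (Function.update y i 1))

section BitBias

variable (m r : ℕ) {δ : ℝ} (i : Idx m)

theorem bitBias_update (y : Idx m → ZMod 2) (b : ZMod 2) :
    bitBias m r δ i (Function.update y i b) = bitBias m r δ i y := by
  simp [bitBias]

theorem bitBias_add_encode (y : Idx m → ZMod 2) (u : CoefLe m r) :
    bitBias m r δ i (y + encode m r u) = signBit (encode m r u i) * bitBias m r δ i y := by
  set c := encode m r u with hc
  have hup (b : ZMod 2) : outLaw m r δ (Function.update (y + c) i b)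
      = outLaw m r δ (Function.update y i (b + c i)) := by
    rw [← outLaw_add_encode m r δ (Function.update y i (b + c i)) u]
    congr 1
    funext x
    by_cases hx : x = i
    · subst hx
      simp [← hc, add_assoc, CharTwo.add_self_eq_zero]
    · simp [hx, ← hc]
  unfold bitBias
  rw [hup, hup]
  rcases zmod_two_cases (c i) with h | h
  · simp [h, signBit]
  · rw [h, zero_add, show (1 : ZMod 2) + 1 = 0 by decide]
    simp only [signBit, one_ne_zero, if_false]
    rw [add_comm (outLaw m r δ (Function.update y i 1))]
    ring

theorem abs_bitBias_le (h0 : 0 ≤ δ) (h1 : δ < 1 / 2) (y : Idx m → ZMod 2) :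
    |bitBias m r δ i y| ≤ 1 := by
  have ha := outLaw_nonneg m r h0 h1 (Function.update y i 0)
  have hb := outLaw_nonneg m r h0 h1 (Function.update y i 1)
  unfold bitBias
  rw [abs_div, abs_of_nonneg (add_nonneg ha hb)]
  refine div_le_one_of_le₀ ?_ (add_nonneg ha hb)
  rw [abs_le]
  constructor <;> linarith

theorem sum_chiSq_outLaw :
    ∑ z, chiSq (outLaw m r δ) i z / 2
      = (1 - 2 * δ) * prodExp (bscWeight δ) (bitBias m r δ i) := by
  have h1 : prodExp (bscWeight δ) (fun z => signBit (z i) * bitBias m r δ i z)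
      = (1 - 2 * δ) * prodExp (bscWeight δ) (bitBias m r δ i) := by
    rw [prodExp_mul_of_indep (bscWeight_sum δ) i signBit _ (bitBias_update m r i),
      bscWeight_zero, bscWeight_one]
    simp only [signBit, one_ne_zero, if_true, if_false]
    ring
  rw [← h1, ← sum_outLaw_mul_of_invariant m r δ, ← sum_update_pair i
    (fun y => outLaw m r δ y * (signBit (y i) * bitBias m r δ i y))]
  · refine Finset.sum_congr rfl fun z _ => ?_
    simp only [bitBias_update, Function.update_self, signBit, one_ne_zero, if_true, if_false]
    simp only [bitBias, chiSq]
    ring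
  · intro z u
    rw [bitBias_add_encode, ← mul_assoc]
    congr 1
    rw [Pi.add_apply]
    generalize encode m r u i = a
    generalize z i = b
    rcases zmod_two_cases a with rfl | rfl <;> rcases zmod_two_cases b with rfl | rfl <;>
      simp [signBit, show (1 : ZMod 2) + 1 = 0 by decide]

end BitBias

/-- Below capacity, some output bit is predictable with constant advantage from the others. -/
theorem exists_bitBias_ge (m r : ℕ) {δ η : ℝ} (h0 : 0 ≤ δ) (h1 : δ < 1 / 2) (hη : 0 < η)
    (h : (binomLe m r : ℝ) / 2 ^ m + Hbin δ + η ≤ 1) :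
    ∃ i, η * Real.log 2 ≤ prodExp (bscWeight δ) (bitBias m r δ i) := by
  have hlog2 : 0 < Real.log 2 := Real.log_pos one_lt_two
  have hpow : (0 : ℝ) < 2 ^ m := by positivity
  have hdef := entropy_deficit_le (outLaw m r δ) (outLaw_nonneg m r h0 h1) (sum_outLaw m r)
  have hent := neg_entropy_outLaw_ge m r h0 h1
  have hcard : (Fintype.card (Idx m) : ℝ) = 2 ^ m := by simp
  rw [hcard] at hdef
  have hrate : (binomLe m r : ℝ) + 2 ^ m * (Hbin δ + η) ≤ 2 ^ m := by
    have := mul_le_mul_of_nonneg_left h hpow.le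
    have e : (2 : ℝ) ^ m * ((binomLe m r : ℝ) / 2 ^ m) = binomLe m r := by field_simp
    nlinarith
  have hrate' := mul_le_mul_of_nonneg_right hrate hlog2.le
  have hsum : ∑ _i : Idx m, η * Real.log 2 ≤ ∑ i, ∑ z, chiSq (outLaw m r δ) i z / 2 := by
    rw [Finset.sum_const, Finset.card_univ, nsmul_eq_mul, hcard]
    nlinarith
  obtain ⟨i, -, hi⟩ := Finset.exists_le_of_sum_le Finset.univ_nonempty hsum
  refine ⟨i, hi.trans ?_⟩
  rw [sum_chiSq_outLaw] at hi ⊢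
  have hpos : 0 < (1 - 2 * δ) * prodExp (bscWeight δ) (bitBias m r δ i) :=
    lt_of_lt_of_le (by positivity) hi
  have : 0 < prodExp (bscWeight δ) (bitBias m r δ i) :=
    pos_of_mul_pos_right hpos (by linarith)
  nlinarith

/-- Functions on `F₂^n` given by polynomials of degree at most `d`. -/
def degLe (n d : ℕ) : Submodule (ZMod 2) (Idx n → ZMod 2) :=
  Submodule.span (ZMod 2) (Set.range fun s : {x : Idx n // wt x ≤ d} => fun x => Gmat n x s.val)

theorem mem_degLe_iff {n d : ℕ} {c : Idx n → ZMod 2} :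
    c ∈ degLe n d ↔ ∃ u : CoefLe n d, encode n d u = c := by
  rw [degLe, Submodule.mem_span_range_iff_exists_fun]
  refine exists_congr fun u => ?_
  have : encode n d u = ∑ s, u s • (fun x => Gmat n x s.val) := by
    funext x
    simp [encode, Finset.sum_apply, mul_comm]
  rw [this]

theorem Gmat_mem_degLe {n d : ℕ} {s : Idx n} (hs : wt s ≤ d) :
    (fun x => Gmat n x s) ∈ degLe n d :=
  Submodule.subset_span ⟨⟨s, hs⟩, rfl⟩

theorem Gmat_eq_prod (n : ℕ) (x s : Idx n) :
    Gmat n x s = ∏ j ∈ Finset.univ.filter (fun j => s j = 1), x j := by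
  rw [Finset.prod_filter, Gmat]
  refine Finset.prod_congr rfl fun j _ => ?_
  generalize x j = a
  generalize s j = b
  revert a b
  decide

theorem degLe_mono {n d d' : ℕ} (h : d ≤ d') : degLe n d ≤ degLe n d' := by
  refine Submodule.span_le.mpr ?_
  rintro _ ⟨s, rfl⟩
  exact Gmat_mem_degLe (s.2.trans h)

theorem one_mem_degLe (n d : ℕ) : (1 : Idx n → ZMod 2) ∈ degLe n d := by
  have : (1 : Idx n → ZMod 2) = fun x => Gmat n x 0 := by
    funext x; simp [Gmat_eq_prod]
  rw [this]
  exact Gmat_mem_degLe (by simp [wt])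

theorem const_mem_degLe (n d : ℕ) (b : ZMod 2) : (fun _ : Idx n => b) ∈ degLe n d := by
  have := (degLe n d).smul_mem b (one_mem_degLe n d)
  convert this using 1
  funext x
  simp

theorem coord_mem_degLe {n : ℕ} (j : Fin n) : (fun x : Idx n => x j) ∈ degLe n 1 := by
  have hf : (Finset.univ.filter fun i => (Pi.single j 1 : Idx n) i = 1) = {j} := by
    ext i
    by_cases h : i = j
    · subst h; simp
    · simp [h]
  have : (fun x : Idx n => x j) = fun x => Gmat n x (Pi.single j 1) := by
    funext x; simp [Gmat_eq_prod, hf]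
  rw [this]
  exact Gmat_mem_degLe (by simp [wt, hf])

theorem mul_mem_degLe {n a b : ℕ} {f g : Idx n → ZMod 2} (hf : f ∈ degLe n a)
    (hg : g ∈ degLe n b) : f * g ∈ degLe n (a + b) := by
  have hle : degLe n a * degLe n b ≤ degLe n (a + b) := by
    conv_lhs => rw [degLe, degLe]
    rw [Submodule.span_mul_span, Submodule.span_le]
    rintro _ ⟨_, ⟨s, rfl⟩, _, ⟨t, rfl⟩, rfl⟩
    let v : Idx n := fun j => if s.val j = 1 ∨ t.val j = 1 then 1 else 0
    have hv : (Finset.univ.filter fun j => v j = 1)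
        = (Finset.univ.filter fun j => s.val j = 1) ∪ Finset.univ.filter fun j => t.val j = 1 := by
      ext j; simp [v, or_iff_not_imp_left]
    have hmul : (fun x => Gmat n x s.val) * (fun x => Gmat n x t.val) = fun x => Gmat n x v := by
      funext x
      simp only [Pi.mul_apply, Gmat, ← Finset.prod_mul_distrib]
      refine Finset.prod_congr rfl fun j _ => ?_
      simp only [v]
      generalize x j = p
      generalize s.val j = q
      generalize t.val j = q'
      revert p q q'
      decide
    change (fun x => Gmat n x s.val) * (fun x => Gmat n x t.val) ∈ degLe n (a + b)
    rw [hmul]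
    refine Gmat_mem_degLe ?_
    rw [wt, hv]
    exact (Finset.card_union_le _ _).trans (add_le_add s.2 t.2)
  exact hle (Submodule.mul_mem_mul hf hg)

/-- Precomposition with a map of degree one does not increase the degree. -/
theorem comp_mem_degLe {n m d : ℕ} {T : Idx n → Idx m}
    (hT : ∀ j, (fun x => T x j) ∈ degLe n 1) {c : Idx m → ZMod 2} (hc : c ∈ degLe m d) :
    c ∘ T ∈ degLe n d := by
  have hprod : ∀ s : Finset (Fin m), (fun x => ∏ j ∈ s, T x j) ∈ degLe n s.card := by
    intro s
    induction s using Finset.induction_on with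
    | empty => simpa using const_mem_degLe n 0 1
    | insert j s hj ih =>
      rw [Finset.card_insert_of_notMem hj, add_comm]
      have := mul_mem_degLe (hT j) ih
      convert this using 1
      funext x
      simp [Finset.prod_insert hj]
  have hle : degLe m d ≤ (degLe n d).comap (LinearMap.funLeft (ZMod 2) (ZMod 2) T) := by
    refine Submodule.span_le.mpr ?_
    rintro _ ⟨s, rfl⟩
    change (fun x => Gmat m (T x) s.val) ∈ degLe n d
    simp only [Gmat_eq_prod]
    exact degLe_mono s.2 (hprod _)
  exact hle hc

/-- The affine embedding of `F₂^n` as a graph in `F₂^(n+k)` sending `i₀` to `i`. -/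
def graphEmb {n k : ℕ} (i : Idx (n + k)) (i₀ : Idx n) (A : Fin k → Fin n → ZMod 2)
    (x : Idx n) : Idx (n + k) :=
  Fin.append (fun j => x j + i₀ j + i (Fin.castAdd k j))
    (fun l => ∑ j, A l j * (x j + i₀ j) + i (Fin.natAdd n l))

section GraphEmb

variable {n k : ℕ} (i : Idx (n + k)) (i₀ : Idx n)

theorem graphEmb_base (A : Fin k → Fin n → ZMod 2) : graphEmb i i₀ A i₀ = i := by
  funext j
  refine Fin.addCases (fun j => ?_) (fun l => ?_) j <;>
    simp [graphEmb, CharTwo.add_self_eq_zero]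

theorem graphEmb_injective (A : Fin k → Fin n → ZMod 2) :
    Function.Injective (graphEmb i i₀ A) := by
  intro x y h
  funext j
  have := congrFun h (Fin.castAdd k j)
  simpa [graphEmb] using this

theorem graphEmb_coord_mem_degLe (A : Fin k → Fin n → ZMod 2) (j : Fin (n + k)) :
    (fun x => graphEmb i i₀ A x j) ∈ degLe n 1 := by
  refine Fin.addCases (fun j => ?_) (fun l => ?_) j
  · simp only [graphEmb, Fin.append_left]
    exact add_mem (add_mem (coord_mem_degLe j) (const_mem_degLe n 1 _)) (const_mem_degLe n 1 _)
  · simp only [graphEmb, Fin.append_right]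
    have : (fun x : Idx n => ∑ j, A l j * (x j + i₀ j))
        = ∑ j, A l j • fun x : Idx n => x j + i₀ j := by
      funext x; simp [Finset.sum_apply]
    have hlin : (fun x : Idx n => ∑ j, A l j * (x j + i₀ j)) ∈ degLe n 1 := by
      rw [this]
      exact sum_mem fun j _ => (degLe n 1).smul_mem _
        (add_mem (coord_mem_degLe j) (const_mem_degLe n 1 _))
    exact add_mem hlin (const_mem_degLe n 1 _)

/-- The slopes whose graph passes through `x` away from the base point. -/
def slopesThrough (x : Idx (n + k)) : Finset (Fin k → Fin n → ZMod 2) :=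
  Finset.univ.filter fun A => ∃ t, t ≠ i₀ ∧ graphEmb i i₀ A t = x

theorem card_slopesThrough_mul_le (x : Idx (n + k)) :
    (slopesThrough i i₀ x).card * 2 ^ k ≤ Fintype.card (Fin k → Fin n → ZMod 2) := by
  by_cases hne : ∃ A₀ t₀, t₀ ≠ i₀ ∧ graphEmb i i₀ A₀ t₀ = x
  swap
  · have : slopesThrough i i₀ x = ∅ := by
      refine Finset.filter_eq_empty_iff.mpr fun A _ hA => hne ⟨A, hA⟩
    simp [this]
  obtain ⟨A₀, t₀, ht₀, hx⟩ := hne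
  obtain ⟨j₀, hj₀⟩ : ∃ j, t₀ j ≠ i₀ j := Function.ne_iff.mp ht₀
  have hd : t₀ j₀ + i₀ j₀ = 1 := by
    revert hj₀
    generalize t₀ j₀ = a
    generalize i₀ j₀ = b
    revert a b
    decide
  have hval : ∀ A ∈ slopesThrough i i₀ x, ∀ l, ∑ j, A l j * (t₀ j + i₀ j)
      = ∑ j, A₀ l j * (t₀ j + i₀ j) := by
    intro A hA l
    obtain ⟨t, -, ht⟩ := (Finset.mem_filter.mp hA).2
    have htt : t = t₀ := by
      funext j
      have := congrFun (ht.trans hx.symm) (Fin.castAdd k j)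
      simpa [graphEmb] using this
    subst htt
    have := congrFun (ht.trans hx.symm) (Fin.natAdd n l)
    simpa [graphEmb] using this
  have hk : Fintype.card (Fin k → ZMod 2) = 2 ^ k := by simp
  rw [← hk, ← Finset.card_univ, ← Finset.card_product, ← Finset.card_univ]
  refine Finset.card_le_card_of_injOn
    (fun p l j => p.1 l j + if j = j₀ then p.2 l else 0)
    (fun _ _ => Finset.mem_coe.mpr (Finset.mem_univ _)) ?_
  rintro ⟨A, v⟩ hA ⟨B, w⟩ hB hAB
  have hA' := hval A (Finset.mem_product.mp (Finset.mem_coe.mp hA)).1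
  have hB' := hval B (Finset.mem_product.mp (Finset.mem_coe.mp hB)).1
  have hsum : ∀ (C : Fin k → Fin n → ZMod 2) (u : Fin k → ZMod 2) (l : Fin k),
      ∑ j, (C l j + if j = j₀ then u l else 0) * (t₀ j + i₀ j)
        = ∑ j, C l j * (t₀ j + i₀ j) + u l := by
    intro C u l
    simp [add_mul, Finset.sum_add_distrib, ite_mul, hd]
  have hvw : v = w := by
    funext l
    have h1 := hsum A v l
    have h2 := hsum B w l
    have h3 : ∑ j, (A l j + if j = j₀ then v l else 0) * (t₀ j + i₀ j)
        = ∑ j, (B l j + if j = j₀ then w l else 0) * (t₀ j + i₀ j) :=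
      Finset.sum_congr rfl fun j _ =>
        congrArg (· * (t₀ j + i₀ j)) (congrFun (congrFun hAB l) j)
    rw [h1, h2, hA', hB'] at h3
    exact add_left_cancel h3
  subst hvw
  have hAB' : A = B := by
    funext l j
    exact add_right_cancel (congrFun (congrFun hAB l) j)
  rw [hAB']

end GraphEmb

/-- Averaging the predictions along all graphs yields an estimator of the bit `i` with
constant mean and exponentially small variance. -/
theorem exists_boosted_estimator (n k r : ℕ) {δ η : ℝ} (h0 : 0 ≤ δ) (h1 : δ < 1 / 2)
    (hη : 0 < η) (h : (binomLe n r : ℝ) / 2 ^ n + Hbin δ + η ≤ 1) (i : Idx (n + k)) :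
    ∃ S : (Idx (n + k) → ZMod 2) → ℝ,
      (∀ u y, S (y + encode (n + k) r u) = signBit (encode (n + k) r u i) * S y) ∧
      η * Real.log 2 ≤ prodExp (bscWeight δ) S ∧
      prodExp (bscWeight δ) (fun z => S z ^ 2) - prodExp (bscWeight δ) S ^ 2 ≤ (1 / 2) ^ k := by
  obtain ⟨i₀, hi₀⟩ := exists_bitBias_ge n r h0 h1 hη h
  set f := bitBias n r δ i₀ with hf
  set w := bscWeight δ with hw
  have hw1 : w 0 + w 1 = 1 := bscWeight_sum δ
  have hw0 : ∀ b, 0 ≤ w b := bscWeight_nonneg h0 h1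
  obtain ⟨N, hN⟩ : ∃ N : ℝ, N = Fintype.card (Fin k → Fin n → ZMod 2) := ⟨_, rfl⟩
  have hNpos : 0 < N := by
    rw [hN]; exact_mod_cast Fintype.card_pos
  set F : (Fin k → Fin n → ZMod 2) → (Idx (n + k) → ZMod 2) → ℝ :=
    fun A z => f (z ∘ graphEmb i i₀ A) with hF
  have hmean (A) : prodExp w (F A) = prodExp w f :=
    prodExp_comp_injective hw1 (graphEmb_injective i i₀ A) f
  have hmeanS : prodExp w (fun z => ∑ A, F A z) = N * prodExp w f := by
    rw [prodExp_sum]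
    simp [hmean, hN]
  refine ⟨fun z => N⁻¹ * ∑ A, F A z, ?_, ?_, ?_⟩
  · intro u y
    rw [mul_left_comm, Finset.mul_sum (s := Finset.univ) (a := signBit _)]
    refine congrArg₂ (· * ·) rfl ?_
    refine Finset.sum_congr rfl fun A _ => ?_
    obtain ⟨v, hv⟩ := mem_degLe_iff.mp (comp_mem_degLe (graphEmb_coord_mem_degLe i i₀ A)
      (mem_degLe_iff.mpr ⟨u, rfl⟩))
    have hvi : encode (n + k) r u i = encode n r v i₀ := by
      rw [hv, Function.comp_apply, graphEmb_base]
    rw [hvi, hF, hf]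
    dsimp only
    rw [← bitBias_add_encode, hv]
    rfl
  · rw [prodExp_const_mul, hmeanS, inv_mul_cancel_left₀ hNpos.ne']
    exact hi₀
  · have hvar := variance_sum_le hw0 hw1 (K := N * (1 / 2) ^ k) F (slopesThrough i i₀)
      (fun x => by
        have hc : ((slopesThrough i i₀ x).card : ℝ) * 2 ^ k ≤ N := by
          rw [hN]; exact_mod_cast card_slopesThrough_mul_le i i₀ x
        rw [one_div, inv_pow, ← div_eq_mul_inv, le_div_iff₀ (by positivity)]
        exact hc)
      (fun x A hA z b => by
        have hcomp : ∀ t, t ≠ i₀ → Function.update z x b (graphEmb i i₀ A t)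
            = z (graphEmb i i₀ A t) := fun t ht =>
          Function.update_of_ne (fun hx => hA (Finset.mem_filter.mpr
            ⟨Finset.mem_univ _, t, ht, hx⟩)) _ _
        simp only [hF, hf]
        rw [← bitBias_update n r i₀ (z ∘ graphEmb i i₀ A)
          (Function.update z x b (graphEmb i i₀ A i₀))]
        congr 1
        funext t
        by_cases ht : t = i₀
        · subst ht; simp
        · simp only [Function.comp_apply, Function.update_of_ne ht]
          exact hcomp t ht)
    have hone (A) : prodExp w (fun z => F A z ^ 2) - prodExp w (F A) ^ 2 ≤ 1 := by
      have : prodExp w (fun z => F A z ^ 2) ≤ 1 := by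
        rw [← prodExp_const (ι := Idx (n + k)) w hw1 1]
        exact prodExp_mono hw0 fun z =>
          (sq_le_one_iff_abs_le_one _).mpr (abs_bitBias_le n r i₀ h0 h1 _)
      linarith [sq_nonneg (prodExp w (F A))]
    have hsum : ∑ A, (prodExp w (fun z => F A z ^ 2) - prodExp w (F A) ^ 2) ≤ N := by
      refine (Finset.sum_le_sum fun A _ => hone A).trans ?_
      simp [hN]
    have hfin := hvar.trans (mul_le_mul_of_nonneg_left hsum (by positivity))
    simp only [mul_pow]
    rw [prodExp_const_mul, prodExp_const_mul, mul_pow, ← mul_sub]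
    calc _ ≤ N⁻¹ ^ 2 * (N * (1 / 2) ^ k * N) := mul_le_mul_of_nonneg_left hfin (by positivity)
      _ = (1 / 2) ^ k := by field_simp

theorem centralBinom_sq_mul_le (n : ℕ) : n.centralBinom ^ 2 * (2 * n + 1) ≤ 16 ^ n := by
  induction n with
  | zero => simp
  | succ n ih =>
    have h := Nat.succ_mul_centralBinom_succ n
    have hpos : 0 < (n + 1) ^ 2 := by positivity
    refine Nat.le_of_mul_le_mul_left ?_ hpos
    calc (n + 1) ^ 2 * ((n + 1).centralBinom ^ 2 * (2 * (n + 1) + 1))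
        = ((n + 1) * (n + 1).centralBinom) ^ 2 * (2 * n + 3) := by ring
      _ = (n.centralBinom ^ 2 * (2 * n + 1)) * (4 * ((2 * n + 1) * (2 * n + 3))) := by
          rw [h]; ring
      _ ≤ 16 ^ n * (16 * (n + 1) ^ 2) := by
          refine Nat.mul_le_mul ih ?_
          nlinarith
      _ = (n + 1) ^ 2 * 16 ^ (n + 1) := by ring

theorem choose_sq_mul_le (N r : ℕ) : N.choose r ^ 2 * N ≤ 4 ^ N := by
  rcases Nat.even_or_odd' N with ⟨n, rfl | rfl⟩
  · calc (2 * n).choose r ^ 2 * (2 * n) ≤ n.centralBinom ^ 2 * (2 * n + 1) :=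
        Nat.mul_le_mul (Nat.pow_le_pow_left (Nat.choose_le_centralBinom r n) 2) (by omega)
      _ ≤ 16 ^ n := centralBinom_sq_mul_le n
      _ = 4 ^ (2 * n) := by rw [pow_mul]; norm_num
  · have hc : (2 * n + 1).choose r ≤ 2 * n.centralBinom := by
      cases r with
      | zero =>
        have := Nat.centralBinom_pos n
        simp; omega
      | succ r =>
        rw [Nat.choose_succ_succ']
        have h1 := Nat.choose_le_centralBinom r n
        have h2 := Nat.choose_le_centralBinom (r + 1) n
        omega
    calc (2 * n + 1).choose r ^ 2 * (2 * n + 1) ≤ (2 * n.centralBinom) ^ 2 * (2 * n + 1) :=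
        Nat.mul_le_mul_right _ (Nat.pow_le_pow_left hc 2)
      _ = 4 * (n.centralBinom ^ 2 * (2 * n + 1)) := by ring
      _ ≤ 4 * 16 ^ n := Nat.mul_le_mul_left _ (centralBinom_sq_mul_le n)
      _ = 4 ^ (2 * n + 1) := by rw [pow_succ, pow_mul]; norm_num; ring

theorem binomLe_succ_add (m r : ℕ) : binomLe (m + 1) r + m.choose r = 2 * binomLe m r := by
  induction r with
  | zero => simp [binomLe]
  | succ r ih =>
    have h1 : ∀ M, binomLe M (r + 1) = binomLe M r + M.choose (r + 1) := fun M => by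
      rw [binomLe, Finset.sum_range_succ]; rfl
    rw [h1, h1, Nat.choose_succ_succ']
    omega

theorem rate_step (m r : ℕ) (hm : 0 < m) :
    (binomLe m r : ℝ) / 2 ^ m ≤ binomLe (m + 1) r / 2 ^ (m + 1) + 1 / (2 * √m) := by
  have h : (binomLe (m + 1) r : ℝ) + m.choose r = 2 * binomLe m r := by
    exact_mod_cast binomLe_succ_add m r
  have hs : (0 : ℝ) < √m := Real.sqrt_pos.mpr (by exact_mod_cast hm)
  have hc : (m.choose r : ℝ) * √m ≤ 2 ^ m := by
    refine abs_le_of_sq_le_sq' ?_ (by positivity) |>.2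
    rw [mul_pow, Real.sq_sqrt (by positivity), ← pow_mul, mul_comm m 2, pow_mul]
    norm_num
    exact_mod_cast choose_sq_mul_le m r
  have hc' : (m.choose r : ℝ) / 2 ^ m ≤ 1 / √m := by
    rw [div_le_div_iff₀ (by positivity) hs]; linarith
  have e1 : (binomLe m r : ℝ) / 2 ^ m
      = binomLe (m + 1) r / 2 ^ (m + 1) + (m.choose r / 2 ^ m) / 2 := by
    rw [pow_succ]; field_simp; linarith
  have e2 : 1 / (2 * √(m : ℝ)) = 1 / √m / 2 := by field_simp
  rw [e1, e2]
  linarith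

/-- Shortening the length exponent by `k` raises the rate by at most `k / (2√n)`. -/
theorem rate_shorten (n r : ℕ) (hn : 0 < n) (k : ℕ) :
    (binomLe n r : ℝ) / 2 ^ n ≤ binomLe (n + k) r / 2 ^ (n + k) + k * (1 / (2 * √n)) := by
  induction k with
  | zero => simp
  | succ k ih =>
    have h := rate_step (n + k) r (by omega)
    have hs : (0 : ℝ) < √n := Real.sqrt_pos.mpr (by exact_mod_cast hn)
    have hmono : 1 / (2 * √((n + k : ℕ) : ℝ)) ≤ 1 / (2 * √n) := by
      have : √(n : ℝ) ≤ √((n + k : ℕ) : ℝ) :=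
        Real.sqrt_le_sqrt (by push_cast; linarith [k.cast_nonneg (α := ℝ)])
      exact one_div_le_one_div_of_le (by positivity) (by linarith)
    rw [← add_assoc]
    push_cast at *
    linarith

theorem binomLe_le_two_pow (m r : ℕ) : binomLe m r ≤ 2 ^ m := by
  rw [← card_wt_le]
  refine (Fintype.card_subtype_le _).trans ?_
  simp

theorem isProbabilityMeasure_bern2 {δ : ℝ} (h0 : 0 ≤ δ) (h1 : δ < 1 / 2) :
    IsProbabilityMeasure (bern2 δ) := by
  refine ⟨?_⟩
  simp only [bern2, Measure.add_apply, Measure.smul_apply, measure_univ, smul_eq_mul, mul_one]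
  rw [← ENNReal.ofReal_add h0 (by linarith)]
  simp

theorem bern2_real_singleton {δ : ℝ} (h0 : 0 ≤ δ) (h1 : δ < 1 / 2) (b : ZMod 2) :
    (bern2 δ).real {b} = bscWeight δ b := by
  rcases zmod_two_cases b with rfl | rfl
  · simp [bern2, measureReal_def, bscWeight, ENNReal.toReal_ofReal (show 0 ≤ 1 - δ by linarith)]
  · simp [bern2, measureReal_def, bscWeight, ENNReal.toReal_ofReal h0]

theorem unifM_eq_uniformOn (α : Type*) [MeasurableSpace α] :
    unifM α = ProbabilityTheory.uniformOn (Set.univ : Set α) := by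
  ext s hs
  simp [unifM, ProbabilityTheory.uniformOn, ProbabilityTheory.cond_apply]

theorem muRM_real_singleton (m r : ℕ) {δ : ℝ} (h0 : 0 ≤ δ) (h1 : δ < 1 / 2)
    (p : CoefLe m r × (Idx m → ZMod 2)) :
    (μRM m r δ).real {p} = (Fintype.card (CoefLe m r) : ℝ)⁻¹ * ∏ x, bscWeight δ (p.2 x) := by
  have := isProbabilityMeasure_bern2 h0 h1
  have hnoise : (noise m δ).real {p.2} = ∏ x, bscWeight δ (p.2 x) := by
    rw [noise, measureReal_def, Measure.pi_singleton, ENNReal.toReal_prod]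
    exact Finset.prod_congr rfl fun x _ => bern2_real_singleton h0 h1 _
  have : SigmaFinite (noise m δ) := by unfold noise; infer_instance
  rw [μRM, ← Set.singleton_prod_singleton, measureReal_prod_prod, hnoise]
  congr 1
  simp [unifM, measureReal_def, Measure.count_univ]

theorem isProbabilityMeasure_muRM (m r : ℕ) {δ : ℝ} (h0 : 0 ≤ δ) (h1 : δ < 1 / 2) :
    IsProbabilityMeasure (μRM m r δ) := by
  have := isProbabilityMeasure_bern2 h0 h1
  have : IsProbabilityMeasure (noise m δ) := by unfold noise; infer_instance
  have : IsProbabilityMeasure (unifM (CoefLe m r)) := by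
    rw [unifM_eq_uniformOn]
    exact ProbabilityTheory.isProbabilityMeasure_uniformOn Set.finite_univ Set.univ_nonempty
  unfold μRM
  infer_instance

/-- A most likely guess of a bit errs no more often than any other guess. -/
theorem measure_error_le_of_most_likely {Ω B : Type*} [MeasurableSpace Ω]
    [DiscreteMeasurableSpace Ω] [Fintype B] (μ : Measure Ω) (X : Ω → ZMod 2) (Y : Ω → B)
    (g g' : B → ZMod 2)
    (hg : ∀ y v, μ {p | Y p = y ∧ X p = v} ≤ μ {p | Y p = y ∧ X p = g y}) :
    μ {p | g (Y p) ≠ X p} ≤ μ {p | g' (Y p) ≠ X p} := by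
  have hU (h : B → ZMod 2) : {p | h (Y p) ≠ X p} = ⋃ y, {p | Y p = y ∧ h y ≠ X p} := by
    ext p; simp
  rw [hU g, hU g']
  refine (measure_iUnion_fintype_le μ _).trans ?_
  rw [measure_iUnion _ fun _ => MeasurableSet.of_discrete, tsum_fintype]
  · refine Finset.sum_le_sum fun y _ => ?_
    by_cases hy : g' y = g y
    · rw [hy]
    · have hbits : ∀ a b c : ZMod 2, b ≠ a → (a ≠ c → c = a + 1) ∧ (c = a → b ≠ c) := by
        decide
      calc μ {p | Y p = y ∧ g y ≠ X p} ≤ μ {p | Y p = y ∧ X p = g y + 1} :=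
            measure_mono fun p hp => ⟨hp.1, (hbits _ _ _ hy).1 hp.2⟩
        _ ≤ μ {p | Y p = y ∧ X p = g y} := hg y _
        _ ≤ μ {p | Y p = y ∧ g' y ≠ X p} :=
            measure_mono fun p hp => ⟨hp.1, (hbits _ _ _ hy).2 hp.2⟩
  · intro y y' hyy'
    exact Set.disjoint_left.mpr fun p hp hp' => hyy' (hp.1.symm.trans hp'.1)

theorem muRM_real_le_prodExp (m r : ℕ) {δ : ℝ} (h0 : 0 ≤ δ) (h1 : δ < 1 / 2)
    (A : Set (CoefLe m r × (Idx m → ZMod 2))) (G : (Idx m → ZMod 2) → ℝ)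
    (hG : ∀ z, 0 ≤ G z) (hA : ∀ p ∈ A, 1 ≤ G p.2) :
    (μRM m r δ).real A ≤ prodExp (bscWeight δ) G := by
  classical
  have := isProbabilityMeasure_muRM m r h0 h1
  have hMpos : (0 : ℝ) < Fintype.card (CoefLe m r) := by exact_mod_cast Fintype.card_pos
  have hq (z : Idx m → ZMod 2) : 0 ≤ ∏ x, bscWeight δ (z x) :=
    Finset.prod_nonneg fun _ _ => bscWeight_nonneg h0 h1 _
  rw [← Set.coe_toFinset A, ← sum_measureReal_singleton]
  calc ∑ p ∈ A.toFinset, (μRM m r δ).real {p}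
      ≤ ∑ p ∈ A.toFinset, (Fintype.card (CoefLe m r) : ℝ)⁻¹ *
          ((∏ x, bscWeight δ (p.2 x)) * G p.2) := by
        refine Finset.sum_le_sum fun p hp => ?_
        rw [muRM_real_singleton m r h0 h1]
        exact mul_le_mul_of_nonneg_left
          (le_mul_of_one_le_right (hq _) (hA p (Set.mem_toFinset.mp hp))) (by positivity)
    _ ≤ ∑ p : CoefLe m r × (Idx m → ZMod 2), (Fintype.card (CoefLe m r) : ℝ)⁻¹ *
          ((∏ x, bscWeight δ (p.2 x)) * G p.2) :=
        Finset.sum_le_sum_of_subset_of_nonneg (Finset.subset_univ _) fun p _ _ =>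
          mul_nonneg (by positivity) (mul_nonneg (hq _) (hG _))
    _ = prodExp (bscWeight δ) G := by
        rw [Fintype.sum_prod_type]
        simp only [← Finset.mul_sum, prodExp, Finset.sum_const, Finset.card_univ, nsmul_eq_mul]
        field_simp

/-- Bit-error bound in terms of the rate of the shortened code. -/
theorem bit_error_le (n k r : ℕ) {δ η : ℝ} (h0 : 0 ≤ δ) (h1 : δ < 1 / 2) (hη : 0 < η)
    (h : (binomLe n r : ℝ) / 2 ^ n + Hbin δ + η ≤ 1) (i : Idx (n + k))
    (g : (Idx (n + k) → ZMod 2) → ZMod 2)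
    (hg : ∀ (y : Idx (n + k) → ZMod 2) (v : ZMod 2),
      μRM (n + k) r δ {p | Yrm (n + k) r p = y ∧ Xrm (n + k) r p i = v}
        ≤ μRM (n + k) r δ {p | Yrm (n + k) r p = y ∧ Xrm (n + k) r p i = g y}) :
    (μRM (n + k) r δ {p | g (Yrm (n + k) r p) ≠ Xrm (n + k) r p i}).toReal
      ≤ (1 / 2) ^ k / (η * Real.log 2) ^ 2 := by
  have := isProbabilityMeasure_muRM (n + k) r h0 h1
  obtain ⟨S, hS, hmean, hvar⟩ := exists_boosted_estimator n k r h0 h1 hη h i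
  set E := prodExp (bscWeight δ) S with hE
  have hη' : 0 < η * Real.log 2 := mul_pos hη (Real.log_pos one_lt_two)
  have hEpos : 0 < E := hη'.trans_le hmean
  have hopt := measure_error_le_of_most_likely (μRM (n + k) r δ)
    (fun p => Xrm (n + k) r p i) (Yrm (n + k) r) g (fun y => if 0 < S y then 0 else 1) hg
  refine (ENNReal.toReal_mono (measure_ne_top _ _) hopt).trans ?_
  refine (muRM_real_le_prodExp (n + k) r h0 h1 _ (fun z => (E ^ 2)⁻¹ * (S z - E) ^ 2)
    (fun z => by positivity) ?_).trans ?_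
  · rintro ⟨u, z⟩ hp
    have hSz : S z ≤ 0 := by
      by_contra! hpos
      refine hp ?_
      have hY : Yrm (n + k) r (u, z) = z + encode (n + k) r u := add_comm _ _
      have hX : Xrm (n + k) r (u, z) i = encode (n + k) r u i := rfl
      rw [hY, hX, hS]
      rcases zmod_two_cases (encode (n + k) r u i) with hb | hb
      · simp [hb, signBit, hpos]
      · simp [hb, signBit, hpos.le]
    rw [inv_mul_eq_div, one_le_div (by positivity)]
    nlinarith
  · have hexp : prodExp (bscWeight δ) (fun z => (S z - E) ^ 2)
        = prodExp (bscWeight δ) (fun z => S z ^ 2) - E ^ 2 := by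
      have : (fun z => (S z - E) ^ 2) = fun z => S z ^ 2 + ((-2 * E) * S z + E ^ 2) := by
        funext z; ring
      rw [this, prodExp_add, prodExp_add, prodExp_const_mul,
        prodExp_const _ (bscWeight_sum δ), ← hE]
      ring
    rw [prodExp_const_mul, hexp, inv_mul_eq_div]
    gcongr

/-- for `δ ∈ [0, 1/2)` and rates below capacity
(`limsup binom(m, ≤ r_m)/2^m < 1 - H(δ)`), the bit-error probability of `RM(m, r_m)`
under bitwise maximum-likelihood decoding is `2^{-Ω(√m)}`: there are `c > 0` and `m₀`
such that for all `m ≥ m₀`, every coordinate `i` and every decoder `g` outputting a most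
likely value of `X_i` given `Y` satisfies `P(g(Y) ≠ X_i) ≤ 2^{-c√m}`. -/
theorem stmt19 (δ : ℝ) (hδ0 : 0 ≤ δ) (hδ : δ < 1/2) (rs : ℕ → ℕ)
    (hrate : Filter.limsup (fun m : ℕ => (binomLe m (rs m) : ℝ) / 2 ^ m) Filter.atTop
      < 1 - Hbin δ) :
    ∃ c > (0 : ℝ), ∃ m₀ : ℕ, ∀ m ≥ m₀, ∀ i : Idx m, ∀ g : (Idx m → ZMod 2) → ZMod 2,
      (∀ (y : Idx m → ZMod 2) (v : ZMod 2),
          μRM m (rs m) δ {p | Yrm m (rs m) p = y ∧ Xrm m (rs m) p i = v}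
            ≤ μRM m (rs m) δ {p | Yrm m (rs m) p = y ∧ Xrm m (rs m) p i = g y}) →
      (μRM m (rs m) δ {p | g (Yrm m (rs m) p) ≠ Xrm m (rs m) p i}).toReal
        ≤ (2 : ℝ) ^ (-(c * Real.sqrt m)) := by
  obtain ⟨ρ, hρ, hρ'⟩ := exists_between hrate
  obtain ⟨η, hη⟩ : ∃ η, η = (1 - Hbin δ - ρ) / 2 := ⟨_, rfl⟩
  have hηpos : 0 < η := by rw [hη]; linarith
  obtain ⟨a, ha⟩ : ∃ a, a = min η (1 / 2) := ⟨_, rfl⟩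
  have hapos : 0 < a := by rw [ha]; positivity
  have haη : a ≤ η := ha ▸ min_le_left _ _
  have hah : a ≤ 1 / 2 := ha ▸ min_le_right _ _
  obtain ⟨C, hC⟩ : ∃ C, C = 2 / (η * Real.log 2) ^ 2 := ⟨_, rfl⟩
  have hCpos : 0 < C := by
    have := Real.log_pos one_lt_two
    rw [hC]; positivity
  have hbdd : Filter.IsBoundedUnder (· ≤ ·) Filter.atTop
      (fun m : ℕ => (binomLe m (rs m) : ℝ) / 2 ^ m) :=
    Filter.isBoundedUnder_of ⟨1, fun m => div_le_one_of_le₀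
      (by exact_mod_cast binomLe_le_two_pow m (rs m)) (by positivity)⟩
  have hev := Filter.eventually_lt_of_limsup_lt hρ hbdd
  have hsqrt : Filter.Tendsto (fun m : ℕ => a / 2 * √(m : ℝ)) Filter.atTop Filter.atTop :=
    (Real.tendsto_sqrt_atTop.comp tendsto_natCast_atTop_atTop).const_mul_atTop (by positivity)
  obtain ⟨m₀, hm₀⟩ := Filter.eventually_atTop.mp
    ((hev.and (hsqrt.eventually_ge_atTop (Real.logb 2 C))).and (Filter.eventually_ge_atTop 1))
  refine ⟨a / 2, by positivity, m₀, fun m hm i g hg => ?_⟩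
  obtain ⟨⟨hlt, hbig⟩, hm1⟩ := hm₀ m hm
  have hm1' : (1 : ℝ) ≤ m := by exact_mod_cast hm1
  have hsm : 0 < √(m : ℝ) := Real.sqrt_pos.mpr (by linarith)
  have hsq : √(m : ℝ) ^ 2 = m := Real.sq_sqrt (by linarith)
  have hs1 : 1 ≤ √(m : ℝ) := Real.one_le_sqrt.mpr hm1'
  obtain ⟨k, hk⟩ : ∃ k, k = ⌊a * √(m : ℝ)⌋₊ := ⟨_, rfl⟩
  have hk1 : (k : ℝ) ≤ a * √m := hk ▸ Nat.floor_le (by positivity)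
  have hk2 : a * √m < k + 1 := hk ▸ Nat.lt_floor_add_one _
  have hkm : (k : ℝ) ≤ m / 2 := by nlinarith
  obtain ⟨n, rfl⟩ : ∃ n, m = n + k := by
    have : k ≤ m := by
      have : (k : ℝ) ≤ m := by linarith
      exact_mod_cast this
    exact ⟨m - k, by omega⟩
  have hn : ((n + k : ℕ) : ℝ) / 4 ≤ n := by push_cast at hkm ⊢; linarith
  have hnpos : 0 < n := by
    have : (0 : ℝ) < n := by linarith
    exact_mod_cast this
  have hsn : √((n + k : ℕ) : ℝ) / 2 ≤ √n := Real.le_sqrt_of_sq_le (by nlinarith)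
  have hshort := rate_shorten n (rs (n + k)) hnpos k
  have hloss : k * (1 / (2 * √(n : ℝ))) ≤ η := by
    rw [mul_one_div, div_le_iff₀ (by linarith)]
    nlinarith
  refine (bit_error_le n k (rs (n + k)) hδ0 hδ hηpos (by linarith) i g hg).trans ?_
  have hpow : ((1 : ℝ) / 2) ^ k ≤ 2 * (2 : ℝ) ^ (-(a * √((n + k : ℕ) : ℝ))) := by
    rw [one_div, inv_pow, ← Real.rpow_natCast, ← Real.rpow_neg (by norm_num)]
    calc (2 : ℝ) ^ (-(k : ℝ)) ≤ 2 ^ (1 + -(a * √((n + k : ℕ) : ℝ))) :=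
          Real.rpow_le_rpow_of_exponent_le one_le_two (by linarith)
      _ = _ := by rw [Real.rpow_add (by norm_num), Real.rpow_one]
  have hCle : C ≤ (2 : ℝ) ^ (a / 2 * √((n + k : ℕ) : ℝ)) :=
    (Real.logb_le_iff_le_rpow one_lt_two hCpos).mp hbig
  calc (1 / 2) ^ k / (η * Real.log 2) ^ 2
      ≤ 2 * (2 : ℝ) ^ (-(a * √((n + k : ℕ) : ℝ))) / (η * Real.log 2) ^ 2 := by gcongr
    _ = C * (2 : ℝ) ^ (-(a * √((n + k : ℕ) : ℝ))) := by rw [hC]; ring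
    _ ≤ (2 : ℝ) ^ (a / 2 * √((n + k : ℕ) : ℝ)) * (2 : ℝ) ^ (-(a * √((n + k : ℕ) : ℝ))) := by
        gcongr
    _ = (2 : ℝ) ^ (-(a / 2 * √((n + k : ℕ) : ℝ))) := by
        rw [← Real.rpow_add (by norm_num)]; congr 1; ring
end
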